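/- (Green–Tao) For every integer k ≥ 1 there exist infinitely many k-term arithmetic progressions consisting entirely of primes: for every k ≥ 1 and every N there exist integers a > N and d ≥ 1 such that a + i·d is prime for every i with 0 ≤ i ≤ k − 1. -/

import Mathlib

open Finset
open scoped BigOperators

set_option linter.unusedSectionVars false
set_option linter.unusedSimpArgs false

namespace GreenTao

noncomputable section

open Combinatorics

/-- The density of a subset of a finite type. -/
def dens {X : Type*} [Fintype X] (A : Set X) : ℝ := 𝔼 x, A.indicator 1 x

section dens
variable {X Y : Type*} [Fintype X] [Fintype Y]

lemma indicator_nonneg' (A : Set X) (x : X) : (0 : ℝ) ≤ A.indicator 1 x :=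
  Set.indicator_nonneg (fun _ _ => zero_le_one) x

lemma indicator_le_one' (A : Set X) (x : X) : A.indicator (1 : X → ℝ) x ≤ 1 :=
  Set.indicator_le_self' (fun _ _ => zero_le_one) x

lemma dens_nonneg (A : Set X) : 0 ≤ dens A :=
  expect_nonneg fun x _ => indicator_nonneg' A x

lemma expect_le_of_le {f : X → ℝ} {c : ℝ} (hc : 0 ≤ c) (h : ∀ x, f x ≤ c) : 𝔼 x, f x ≤ c := by
  rcases isEmpty_or_nonempty X with hX | hX
  · simpa [Finset.univ_eq_empty] using hc
  · exact expect_le univ_nonempty fun x _ => h x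

lemma dens_le_one (A : Set X) : dens A ≤ 1 :=
  expect_le_of_le zero_le_one (indicator_le_one' A)

lemma dens_mono {A B : Set X} (h : A ⊆ B) : dens A ≤ dens B :=
  expect_le_expect fun x _ => Set.indicator_le_indicator_of_subset h (fun _ => zero_le_one) x

lemma nonempty_of_dens_pos {A : Set X} (h : 0 < dens A) : A.Nonempty := by
  by_contra hA
  rw [Set.not_nonempty_iff_eq_empty] at hA
  simp [dens, hA] at h

lemma dens_iUnion_le {L : Type*} [Fintype L] (A : L → Set X) :
    dens (⋃ l, A l) ≤ ∑ l, dens (A l) := by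
  unfold dens
  rw [← expect_sum_comm]
  refine expect_le_expect fun x _ => ?_
  by_cases h : x ∈ ⋃ l, A l
  · obtain ⟨l, hl⟩ := Set.mem_iUnion.1 h
    rw [Set.indicator_of_mem h]
    calc (1 : X → ℝ) x = (A l).indicator 1 x := by simp [hl]
      _ ≤ _ := single_le_sum (f := fun l => (A l).indicator (1 : X → ℝ) x)
        (fun l _ => indicator_nonneg' (A l) x) (mem_univ l)
  · rw [Set.indicator_of_notMem h]
    exact sum_nonneg fun l _ => indicator_nonneg' (A l) x

/-- Pigeonhole principle for densities. -/
lemma exists_dens_ge {L : Type*} [Fintype L] [Nonempty L] {A : Set X} {P : L → X → Prop}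
    (h : ∀ x ∈ A, ∃ l, P l x) : ∃ l, dens A / Fintype.card L ≤ dens {x | P l x} := by
  by_contra! hcon
  have h1 : dens A ≤ ∑ l, dens {x | P l x} :=
    (dens_mono fun x hx => Set.mem_iUnion.2 (h x hx)).trans (dens_iUnion_le _)
  have h2 : ∑ l, dens {x | P l x} < ∑ _l : L, dens A / Fintype.card L :=
    sum_lt_sum_of_nonempty univ_nonempty fun l _ => hcon l
  rw [sum_const, card_univ, nsmul_eq_mul, mul_div_cancel₀] at h2
  · linarith
  · simp

lemma dens_ge_of_expect {f : X → ℝ} {δ δ' : ℝ} (h' : 0 ≤ δ') (hf : ∀ x, f x ≤ 1)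
    (h : δ ≤ 𝔼 x, f x) : δ - δ' ≤ dens {x | δ' ≤ f x} := by
  rcases isEmpty_or_nonempty X with hX | hX
  · simp [dens, Finset.univ_eq_empty] at h ⊢
    linarith
  have : 𝔼 x, f x ≤ 𝔼 x, ({x | δ' ≤ f x}.indicator 1 x + δ') := by
    refine expect_le_expect fun x _ => ?_
    by_cases hx : δ' ≤ f x
    · simp [hx]; linarith [hf x]
    · simp [hx]; linarith
  rw [expect_add_distrib, expect_const univ_nonempty] at this
  unfold dens
  linarith

lemma expect_prod' (f : X × Y → ℝ) : 𝔼 z, f z = 𝔼 x, 𝔼 y, f (x, y) := by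
  rw [← univ_product_univ, expect_product]

lemma expect_sumElim {ι₁ ι₂ α : Type*} [Fintype ι₁] [DecidableEq ι₁] [Fintype ι₂] [DecidableEq ι₂]
    [Fintype α] (f : (ι₁ ⊕ ι₂ → α) → ℝ) : 𝔼 z, f z = 𝔼 x, 𝔼 y, f (Sum.elim x y) := by
  rw [← expect_prod' (fun z : (ι₁ → α) × (ι₂ → α) => f (Sum.elim z.1 z.2))]
  exact Fintype.expect_equiv (Equiv.sumArrowEquivProdArrow ι₁ ι₂ α) _ _ fun x => by
    simp [Equiv.sumArrowEquivProdArrow]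

lemma expect_swap (f : X → Y → ℝ) : 𝔼 x, 𝔼 y, f x y = 𝔼 y, 𝔼 x, f x y := expect_comm _ _ _

lemma exists_ge_of_expect [Nonempty X] {f : X → ℝ} {δ : ℝ} (h : δ ≤ 𝔼 x, f x) :
    ∃ x, δ ≤ f x := by
  by_contra! hcon
  rw [Fintype.expect_eq_sum_div_card, le_div_iff₀ (by exact_mod_cast Fintype.card_pos)] at h
  have := sum_lt_sum_of_nonempty (s := (univ : Finset X)) univ_nonempty
    (f := f) (g := fun _ => δ) (fun x _ => hcon x)
  rw [sum_const, card_univ, nsmul_eq_mul] at this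
  linarith

lemma dens_preimage_equiv (e : X ≃ Y) (A : Set Y) : dens (e ⁻¹' A) = dens A :=
  Fintype.expect_equiv e _ _ fun x => by simp [Set.indicator, Set.mem_preimage]; rfl

end dens

lemma exists_equiv_sum {ι κ : Type} [Fintype ι] [Fintype κ] (h : Fintype.card κ ≤ Fintype.card ι) :
    ∃ n : ℕ, n + Fintype.card κ = Fintype.card ι ∧ Nonempty (Fin n ⊕ κ ≃ ι) :=
  ⟨Fintype.card ι - Fintype.card κ, by omega, ⟨Fintype.equivOfCardEq (by simp; omega)⟩⟩

/-- Lines in `ι → α` are encoded by words over `Option α` using `none`. -/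
def IsVar {ι α : Type} (x : ι → Option α) : Prop := ∃ i, x i = none

/-- The point of the line encoded by `x` at the letter `a`. -/
def line {ι α : Type} (x : ι → Option α) (a : α) : ι → α := fun i => (x i).getD a

/-- Density Hales-Jewett at density `δ`. -/
def DHJ (α : Type) [Fintype α] (δ : ℝ) : Prop :=
  ∃ n : ℕ, ∀ (ι : Type) [Fintype ι] [DecidableEq ι], n ≤ Fintype.card ι →
    ∀ A : Set (ι → α), δ ≤ dens A → ∃ x, IsVar x ∧ ∀ a, line x a ∈ A

lemma DHJ.mono {α : Type} [Fintype α] {δ δ' : ℝ} (h : DHJ α δ) (hδ : δ ≤ δ') : DHJ α δ' := by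
  obtain ⟨n, hn⟩ := h
  exact ⟨n, fun ι _ _ hι A hA => hn ι hι A (hδ.trans hA)⟩

lemma DHJ.of_one_lt {α : Type} [Fintype α] {δ : ℝ} (h : 1 < δ) : DHJ α δ :=
  ⟨0, fun _ _ _ _ A hA => absurd (hA.trans (dens_le_one A)) (not_le.2 h)⟩

/-- Density Hales-Jewett in one dimension implies it in all larger ones. -/
lemma DHJ.of_exists {α : Type} [Fintype α] [Nonempty α] {δ : ℝ} {κ : Type} [Fintype κ]
    [DecidableEq κ] (h : ∀ A : Set (κ → α), δ ≤ dens A → ∃ x, IsVar x ∧ ∀ a, line x a ∈ A) :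
    DHJ α δ := by
  refine ⟨Fintype.card κ, fun ι _ _ hι A hA => ?_⟩
  obtain ⟨n, -, ⟨e⟩⟩ := exists_equiv_sum hι
  have h1 : dens A = 𝔼 u : Fin n → α, dens {x : κ → α | (Sum.elim u x) ∘ e.symm ∈ A} := by
    rw [← dens_preimage_equiv (Equiv.arrowCongr e (Equiv.refl α)) A]
    unfold dens
    rw [expect_sumElim]
    rfl
  rw [h1] at hA
  obtain ⟨u, hu⟩ := exists_ge_of_expect hA
  obtain ⟨x, ⟨i, hi⟩, hxA⟩ := h _ hu
  refine ⟨(Sum.elim (fun j => some (u j)) x) ∘ e.symm, ⟨e (Sum.inr i), by simp [hi]⟩, fun a => ?_⟩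
  have := hxA a
  simp only [Set.mem_ofPred_eq] at this
  convert this using 1
  funext j
  simp only [line, Function.comp]
  rcases e.symm j with j | j <;> simp [line]

/-- Composition of combinatorial subspaces. -/
def subComp {η κ ι α : Type} (U : Subspace κ α ι) (V : Subspace η α κ) : Subspace η α ι where
  idxFun i := Sum.elim Sum.inl V.idxFun (U.idxFun i)
  proper e := by
    obtain ⟨j, hj⟩ := V.proper e
    obtain ⟨i, hi⟩ := U.proper j
    exact ⟨i, by simp [hi, hj]⟩

@[simp] lemma subComp_apply {η κ ι α : Type} (U : Subspace κ α ι) (V : Subspace η α κ)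
    (x : η → α) : subComp U V x = U (V x) := by
  funext i
  simp only [Subspace.coe_apply, subComp]
  rcases U.idxFun i with a | j <;> simp [Subspace.coe_apply]

/-- The extension of a subspace to words over `Option α`. -/
def liftSub {η ι α : Type} (V : Subspace η α ι) : Subspace η (Option α) ι where
  idxFun i := Sum.map some id (V.idxFun i)
  proper e := by
    obtain ⟨i, hi⟩ := V.proper e
    exact ⟨i, by simp [hi]⟩

lemma liftSub_subComp {η κ ι α : Type} (U : Subspace κ α ι) (V : Subspace η α κ)
    (x : η → Option α) : liftSub (subComp U V) x = liftSub U (liftSub V x) := by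
  funext i
  simp only [Subspace.coe_apply, subComp, liftSub]
  rcases U.idxFun i with a | j <;> simp [Subspace.coe_apply, liftSub]

lemma line_liftSub {η ι α : Type} (V : Subspace η α ι) (x : η → Option α) (a : α) :
    line (liftSub V x) a = V (line x a) := by
  funext i
  simp only [line, Subspace.coe_apply, liftSub]
  rcases V.idxFun i with b | j <;> simp [line]

lemma liftSub_some {η ι α : Type} (V : Subspace η α ι) (x : η → α) :
    liftSub V (fun i => some (x i)) = fun i => some (V x i) := by
  funext i
  simp only [Subspace.coe_apply, liftSub]
  rcases V.idxFun i with b | j <;> simp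

lemma IsVar.liftSub {η ι α : Type} (V : Subspace η α ι) {x : η → Option α} (hx : IsVar x) :
    IsVar (liftSub V x) := by
  obtain ⟨e, he⟩ := hx
  obtain ⟨i, hi⟩ := V.proper e
  exact ⟨i, by simp [Subspace.coe_apply, GreenTao.liftSub, hi, he]⟩

/-- Multidimensional density Hales-Jewett. -/
def MDHJ (α : Type) [Fintype α] (η : Type) (δ : ℝ) : Prop :=
  ∃ n : ℕ, ∀ (ι : Type) [Fintype ι] [DecidableEq ι], n ≤ Fintype.card ι →
    ∀ A : Set (ι → α), δ ≤ dens A → ∃ V : Subspace η α ι, ∀ y, V y ∈ A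

lemma mdhj_fin {α : Type} [Fintype α] [Nonempty α] (h : ∀ δ > 0, DHJ α δ) (m : ℕ) :
    ∀ δ > 0, MDHJ α (Fin m) δ := by
  induction m with
  | zero =>
    intro δ hδ
    refine ⟨0, fun ι _ _ _ A hA => ?_⟩
    obtain ⟨x, hx⟩ := nonempty_of_dens_pos (hδ.trans_le hA)
    exact ⟨⟨fun i => Sum.inl (x i), fun e => e.elim0⟩, fun y => hx⟩
  | succ m ih =>
    intro δ hδ
    obtain ⟨n₀, hn₀⟩ := h (δ / 2) (by positivity)
    let L := Fin n₀ → Option α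
    have hL : (0 : ℝ) < Fintype.card L := by exact_mod_cast Fintype.card_pos
    obtain ⟨n₁, hn₁⟩ := ih (δ / 2 / Fintype.card L) (by positivity)
    refine ⟨n₁ + n₀, fun ι _ _ hι A hA => ?_⟩
    obtain ⟨n, hn, ⟨e⟩⟩ := exists_equiv_sum (ι := ι) (κ := Fin n₀) (by simp; omega)
    have h1 : dens A = 𝔼 u : Fin n → α, dens {x : Fin n₀ → α | (Sum.elim u x) ∘ e.symm ∈ A} := by
      rw [← dens_preimage_equiv (Equiv.arrowCongr e (Equiv.refl α)) A]
      unfold dens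
      rw [expect_sumElim]
      rfl
    rw [h1] at hA
    have h2 := dens_ge_of_expect (δ' := δ / 2) (by positivity) (fun u => dens_le_one _) hA
    obtain ⟨x, hx⟩ := exists_dens_ge (L := L)
      (A := {u | δ / 2 ≤ dens {x : Fin n₀ → α | (Sum.elim u x) ∘ e.symm ∈ A}})
      (P := fun x u => IsVar x ∧ ∀ a, line x a ∈ {x : Fin n₀ → α | (Sum.elim u x) ∘ e.symm ∈ A})
      (fun u hu => hn₀ (Fin n₀) (by simp) _ hu)
    have hx' := le_trans (div_le_div_of_nonneg_right (by linarith : δ / 2 ≤ _) hL.le) hx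
    obtain ⟨V, hV⟩ := hn₁ (Fin n) (by simp at hn ⊢; omega) _ hx'
    obtain ⟨i₀, hi₀⟩ := (hV fun _ => Classical.arbitrary α).1
    refine ⟨⟨fun i => Sum.elim (fun j => Sum.map id Fin.succ (V.idxFun j))
      (fun j => (x j).elim (Sum.inr 0) Sum.inl) (e.symm i), ?_⟩, ?_⟩
    · intro k
      refine Fin.cases ?_ (fun k => ?_) k
      · exact ⟨e (Sum.inr i₀), by simp [hi₀]⟩
      · obtain ⟨j, hj⟩ := V.proper k
        exact ⟨e (Sum.inl j), by simp [hj]⟩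
    · intro y
      have := (hV (fun k => y k.succ)).2 (y 0)
      simp only [Set.mem_ofPred_eq] at this
      convert this using 1
      funext i
      simp only [Subspace.coe_apply, Function.comp]
      rcases e.symm i with j | j
      · simp only [Sum.elim_inl, Subspace.coe_apply]
        rcases V.idxFun j with b | k <;> simp
      · simp only [Sum.elim_inr, line]
        rcases x j with _ | b <;> simp

lemma mdhj {α : Type} [Fintype α] [Nonempty α] (h : ∀ δ > 0, DHJ α δ) (η : Type) [Fintype η]
    {δ : ℝ} (hδ : 0 < δ) : MDHJ α η δ := by
  obtain ⟨n, hn⟩ := mdhj_fin h (Fintype.card η) δ hδ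
  refine ⟨n, fun ι _ _ hι A hA => ?_⟩
  obtain ⟨V, hV⟩ := hn ι hι A hA
  refine ⟨V.reindex (Fintype.equivFin η).symm (Equiv.refl _) (Equiv.refl _), fun y => ?_⟩
  have := hV (fun k => y ((Fintype.equivFin η).symm k))
  convert this using 1
  funext i
  simp only [Subspace.reindex_apply]
  rfl

end

section

open Combinatorics

/-- Two variable words have the same topmost variable with respect to `ρ` and agree above it. -/
def TopEq {ι α : Type} (ρ : ι → ℕ) (x x' : ι → Option α) : Prop :=
  ∃ i₀, x i₀ = none ∧ x' i₀ = none ∧ ∀ i, ρ i₀ < ρ i → x i = x' i ∧ x i ≠ none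

/-- The colour of a word only depends on its topmost variable and the letters above it. -/
def Good {ι α κ : Type} (ρ : ι → ℕ) (c : (ι → Option α) → κ) : Prop :=
  ∀ x x', TopEq ρ x x' → c x = c x'

lemma Good.comp {ι η α κ : Type} [Fintype ι] {ρ : ι → ℕ} {c : (ι → Option α) → κ}
    (hc : Good ρ c) (V : Subspace η α ι) :
    ∃ ρ' : η → ℕ, (∀ e, ∃ i, V.idxFun i = Sum.inr e ∧ ρ' e = ρ i) ∧
      Good ρ' (fun z => c (liftSub V z)) := by
  classical
  have : ∀ e, ∃ i, V.idxFun i = Sum.inr e ∧ ∀ j, V.idxFun j = Sum.inr e → ρ j ≤ ρ i := by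
    intro e
    obtain ⟨i, hi⟩ := V.proper e
    obtain ⟨j, hj, hj'⟩ := exists_max_image (univ.filter fun i => V.idxFun i = Sum.inr e) ρ
      ⟨i, by simp [hi]⟩
    exact ⟨j, by simpa using hj, fun k hk => hj' k (by simp [hk])⟩
  choose m hm hm' using this
  refine ⟨fun e => ρ (m e), fun e => ⟨m e, hm e, rfl⟩, fun x x' ⟨e, h1, h2, h3⟩ => ?_⟩
  refine hc _ _ ⟨m e, by simp [Subspace.coe_apply, liftSub, hm, h1],
    by simp [Subspace.coe_apply, liftSub, hm, h2], fun i hi => ?_⟩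
  simp only [Subspace.coe_apply, liftSub]
  rcases hVi : V.idxFun i with a | e'
  · simp
  · have := h3 e' (hi.trans_le (hm' e' i hVi))
    simpa using this

/-- After passing to a subspace, the colour depends only on the topmost variable. -/
lemma exists_top_subspace (α κ : Type) [Finite α] [Nonempty α] [Finite κ] (m : ℕ) :
    ∃ n : ℕ, ∀ (ρ : Fin n → ℕ) (c : (Fin n → Option α) → κ), Good ρ c →
      ∃ (V : Subspace (Fin m) α (Fin n)) (k : Fin m → κ), ∀ (x : Fin m → Option α) (p : Fin m),
        x p = none → (∀ q, p < q → x q ≠ none) → c (liftSub V x) = k p := by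
  classical
  induction m with
  | zero =>
    exact ⟨0, fun ρ c hc => ⟨⟨fun i => i.elim0, fun e => e.elim0⟩, fun i => i.elim0,
      fun x p => p.elim0⟩⟩
  | succ m ih =>
    obtain ⟨n, hn⟩ := ih
    obtain ⟨M, hM⟩ := Subspace.exists_mono_in_high_dimension_fin α κ (Fin n)
    refine ⟨M + 1, fun ρ c hc => ?_⟩
    obtain ⟨i₀, -, hi₀⟩ := exists_min_image (univ : Finset (Fin (M + 1))) ρ univ_nonempty
    obtain ⟨W, k₀, hk₀⟩ := hM fun w => c (i₀.insertNth none fun i => some (w i))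
    let a₀ : α := Classical.arbitrary α
    let W' : Subspace (Fin n) α (Fin (M + 1)) :=
      ⟨i₀.insertNth (Sum.inl a₀) W.idxFun, fun e => by
        obtain ⟨i, hi⟩ := W.proper e
        exact ⟨i₀.succAbove i, by simpa using hi⟩⟩
    obtain ⟨ρ', hρ', hgood⟩ := hc.comp W'
    obtain ⟨V, k, hk⟩ := hn ρ' _ hgood
    let U : Option α → (Fin m → Option α) → Fin (M + 1) → Option α :=
      fun x₀ z => i₀.insertNth x₀ (liftSub (subComp W V) z)
    let V' : Subspace (Fin (m + 1)) α (Fin (M + 1)) :=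
      ⟨i₀.insertNth (Sum.inr 0) (fun i => Sum.map id Fin.succ ((subComp W V).idxFun i)), fun e => by
        refine Fin.cases ⟨i₀, by simp⟩ (fun e => ?_) e
        obtain ⟨i, hi⟩ := (subComp W V).proper e
        exact ⟨i₀.succAbove i, by simp [hi]⟩⟩
    have hV' : ∀ x, liftSub V' x = U (x 0) (fun i => x i.succ) := by
      intro x
      funext i
      refine Fin.succAboveCases i₀ ?_ (fun i => ?_) i
      · simp [U, V', liftSub, Subspace.coe_apply]
      · simp only [U, V', liftSub, Subspace.coe_apply, Fin.insertNth_apply_succAbove]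
        rcases (subComp W V).idxFun i with a | j <;> simp
    refine ⟨V', Fin.cons k₀ k, fun x p => ?_⟩
    rw [hV']
    refine Fin.cases (fun h0 htop => ?_) (fun p hp htop => ?_) p
    · have : ∀ i : Fin m, ∃ a, x i.succ = some a := fun i =>
        Option.ne_none_iff_exists'.1 (htop _ (Fin.succ_pos i))
      choose y hy using this
      have := hk₀ (V y)
      simp only [Fin.cons_zero]
      rw [← this]
      simp only [U, h0]
      congr 1
      rw [show (fun i : Fin m => x i.succ) = fun i => some (y i) from funext hy, liftSub_some]
      simp
    · have := hk (fun i => x i.succ) p hp (fun q hq => htop q.succ (by simpa using hq))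
      simp only [Fin.cons_succ]
      rw [← this]
      refine hc _ _ ?_
      obtain ⟨j, hj⟩ : IsVar (liftSub (subComp W V) fun i => x i.succ) := IsVar.liftSub _ ⟨p, hp⟩
      obtain ⟨j, hj, hmax⟩ := exists_max_image
        (univ.filter fun j => liftSub (subComp W V) (fun i => x i.succ) j = none)
        (fun j => ρ (i₀.succAbove j)) ⟨j, by simpa using hj⟩
      have hW' : liftSub W' (liftSub V fun i => x i.succ) =
          U (some a₀) fun i => x i.succ := by
        funext i
        refine Fin.succAboveCases i₀ ?_ (fun i => ?_) i
        · simp [U, W', liftSub, Subspace.coe_apply]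
        · simp only [U, liftSub_subComp, Fin.insertNth_apply_succAbove]
          simp [W', liftSub, Subspace.coe_apply]
      rw [hW']
      simp only [mem_filter, mem_univ, true_and] at hj hmax
      refine ⟨i₀.succAbove j, by simpa [U] using hj, by simpa [U] using hj, fun i => ?_⟩
      refine Fin.succAboveCases i₀ (fun h => ?_) (fun i h => ?_) i
      · exact absurd (hi₀ _ (mem_univ _)) (not_le.2 h)
      · refine ⟨by simp [U], fun h' => ?_⟩
        have := hmax i (by simpa [U] using h')
        omega

/-- Any colouring becomes good on a subspace. -/
lemma exists_good_subspace (α : Type) [Finite α] (m : ℕ) : ∀ (κ : Type) [Finite κ],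
    ∃ (ι : Type) (_ : Fintype ι), ∀ c : (ι → Option α) → κ,
      ∃ V : Subspace (Fin m) α ι, Good Fin.val fun z => c (liftSub V z) := by
  induction m with
  | zero =>
    intro κ _
    exact ⟨Fin 0, inferInstance, fun c => ⟨⟨fun i => i.elim0, fun e => e.elim0⟩,
      fun x x' ⟨i, _⟩ => i.elim0⟩⟩
  | succ m ih =>
    intro κ _
    obtain ⟨ι₁, _, h₁⟩ := ih (α → κ)
    obtain ⟨ι, _, hι⟩ := Subspace.exists_mono_in_high_dimension (Option α) κ ι₁
    refine ⟨ι ⊕ Unit, inferInstance, fun c => ?_⟩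
    obtain ⟨W, k, hk⟩ := hι fun y => c (Sum.elim y fun _ => none)
    let U : Subspace (ι₁ ⊕ Unit) α (ι ⊕ Unit) :=
      ⟨Sum.elim (fun i => Sum.elim (fun b : Option α => b.elim (Sum.inr (Sum.inr ())) Sum.inl)
        (fun e => Sum.inr (Sum.inl e)) (W.idxFun i)) fun _ => Sum.inr (Sum.inr ()), fun e => by
        rcases e with e | e
        · obtain ⟨i, hi⟩ := W.proper e
          exact ⟨Sum.inl i, by simp [hi]⟩
        · exact ⟨Sum.inr (), by simp⟩⟩
    have hU : ∀ y, liftSub U (Sum.elim y fun _ => none) = Sum.elim (W y) fun _ => none := by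
      intro y
      funext i
      rcases i with i | i
      · simp only [liftSub, U, Subspace.coe_apply, Sum.elim_inl]
        rcases W.idxFun i with b | e
        · rcases b with _ | b <;> simp
        · simp
      · simp [liftSub, U, Subspace.coe_apply]
    obtain ⟨V, hV⟩ := h₁ fun z a => c (liftSub U (Sum.elim z fun _ => some a))
    let T : Subspace (Fin (m + 1)) α (ι₁ ⊕ Unit) :=
      ⟨Sum.elim (fun i => Sum.map id Fin.castSucc (V.idxFun i)) fun _ => Sum.inr (Fin.last m),
        fun e => by
        refine Fin.lastCases ⟨Sum.inr (), by simp⟩ (fun e => ?_) e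
        obtain ⟨i, hi⟩ := V.proper e
        exact ⟨Sum.inl i, by simp [hi]⟩⟩
    have hT : ∀ x, liftSub T x =
        Sum.elim (liftSub V fun i => x i.castSucc) fun _ => x (Fin.last m) := by
      intro x
      funext i
      rcases i with i | i
      · simp only [liftSub, T, Subspace.coe_apply, Sum.elim_inl]
        rcases V.idxFun i with b | e <;> simp
      · simp [liftSub, T, Subspace.coe_apply]
    refine ⟨subComp U T, fun x x' ⟨p, hp, hp', hpp⟩ => ?_⟩
    simp only [liftSub_subComp, hT]
    revert hp hp' hpp
    refine Fin.lastCases (fun h h' _ => ?_) (fun p h h' hpp => ?_) p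
    · rw [h, h', hU, hU]
      exact (hk _).trans (hk _).symm
    · obtain ⟨hl, hl'⟩ := hpp (Fin.last m) (by simp)
      obtain ⟨a, ha⟩ := Option.ne_none_iff_exists'.1 hl'
      rw [← hl, ha]
      refine congrFun (hV (fun i => x i.castSucc) (fun i => x' i.castSucc)
        ⟨p, h, h', fun i hi => hpp i.castSucc (by simpa using hi)⟩) a

/-- The Graham-Rothschild theorem for combinatorial lines. -/
theorem graham_rothschild (α κ η : Type) [Finite α] [Nonempty α] [Finite κ] [Finite η] :
    ∃ (ι : Type) (_ : Fintype ι) (_ : DecidableEq ι), ∀ c : (ι → Option α) → κ,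
      ∃ V : Subspace η α ι, ∀ x x', IsVar x → IsVar x' → c (liftSub V x) = c (liftSub V x') := by
  classical
  have := Fintype.ofFinite κ
  have := Fintype.ofFinite η
  obtain ⟨n, hn⟩ := exists_top_subspace α κ (Fintype.card κ * Fintype.card η)
  obtain ⟨ι, _, hι⟩ := exists_good_subspace α n κ
  refine ⟨ι, inferInstance, inferInstance, fun c => ?_⟩
  rcases isEmpty_or_nonempty η with hη | hη
  · obtain ⟨V, -⟩ := hι c
    exact ⟨⟨fun _ => Sum.inl (Classical.arbitrary α), fun e => isEmptyElim e⟩,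
      fun x x' ⟨e, _⟩ => isEmptyElim e⟩
  obtain ⟨V, hV⟩ := hι c
  obtain ⟨W, k, hk⟩ := hn _ _ hV
  have : Nonempty κ := ⟨c fun _ => none⟩
  obtain ⟨b, hb⟩ := Fintype.exists_le_card_fiber_of_mul_le_card k (n := Fintype.card η) (by simp)
  obtain ⟨S, hS, hSc⟩ := exists_subset_card_eq hb
  have e : η ≃ S := Fintype.equivOfCardEq (by simp [hSc])
  let T : Subspace η α (Fin (Fintype.card κ * Fintype.card η)) :=
    ⟨fun i => if h : i ∈ S then Sum.inr (e.symm ⟨i, h⟩) else Sum.inl (Classical.arbitrary α),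
      fun j => ⟨e j, by simp⟩⟩
  have key : ∀ x, IsVar x → c (liftSub (subComp V (subComp W T)) x) = b := by
    intro x hx
    rw [liftSub_subComp, liftSub_subComp]
    obtain ⟨p, hp⟩ := IsVar.liftSub T hx
    obtain ⟨p, hp, hmax⟩ := exists_max_image (univ.filter fun p => liftSub T x p = none) id
      ⟨p, by simpa using hp⟩
    simp only [mem_filter, mem_univ, true_and, id] at hp hmax
    rw [hk _ p hp fun q hq h => absurd (hmax q h) (not_le.2 hq)]
    have hpS : p ∈ S := by
      by_contra h
      simp [liftSub, T, Subspace.coe_apply, h] at hp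
    simpa using hS hpS
  exact ⟨subComp V (subComp W T), fun x x' hx hx' => (key x hx).trans (key x' hx').symm⟩

end

noncomputable section

open Combinatorics

lemma dens_pi {ι β : Type} [Fintype ι] [DecidableEq ι] [Fintype β] (t : ι → Finset β) :
    dens {z : ι → β | ∀ i, z i ∈ t i} = ∏ i, (#(t i) : ℝ) / Fintype.card β := by
  classical
  unfold dens
  rw [Fintype.expect_eq_sum_div_card, prod_div_distrib, Fintype.card_fun, prod_const, card_univ]
  push_cast
  congr 1
  rw [← Nat.cast_prod, ← Fintype.card_piFinset, card_eq_sum_ones, Nat.cast_sum]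
  have : ∀ z : ι → β, Set.indicator {z : ι → β | ∀ i, z i ∈ t i} (1 : (ι → β) → ℝ) z =
      if z ∈ Fintype.piFinset t then 1 else 0 := by
    intro z
    by_cases h : ∀ i, z i ∈ t i
    · rw [Set.indicator_of_mem (by exact h), if_pos (by simpa using h)]
      rfl
    · rw [Set.indicator_of_notMem (by exact h), if_neg (by simpa using h)]
  simp only [this]
  rw [sum_ite_mem, univ_inter]
  simp

lemma dens_none_pos {ι α : Type} [Fintype ι] [DecidableEq ι] [Fintype α] (S : Finset ι) :
    dens {z : ι → Option α | ∀ i ∈ S, z i = none} =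
      ((1 : ℝ) / (Fintype.card α + 1)) ^ #S := by
  classical
  have := dens_pi (fun i : ι => if i ∈ S then ({none} : Finset (Option α)) else univ)
  rw [show {z : ι → Option α | ∀ i ∈ S, z i = none} = {z : ι → Option α | ∀ i, z i ∈
    (if i ∈ S then ({none} : Finset (Option α)) else univ)} from ?_, this]
  · rw [← prod_subset (subset_univ S), prod_congr rfl, prod_const]
    · intro i hi
      simp [hi]
    · intro i _ hi
      simp only [hi, if_false, card_univ, Fintype.card_option]
      exact div_self (by positivity)
  · ext z
    refine forall_congr' fun i => ?_
    by_cases hi : i ∈ S <;> simp [hi]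

lemma dens_not_isVar {ι α : Type} [Fintype ι] [DecidableEq ι] [Fintype α] :
    dens {z : ι → Option α | ¬ IsVar z} =
      ((Fintype.card α : ℝ) / (Fintype.card α + 1)) ^ Fintype.card ι := by
  classical
  have := dens_pi (fun _ : ι => (univ.erase none : Finset (Option α)))
  rw [show {z : ι → Option α | ¬ IsVar z} = {z : ι → Option α | ∀ i, z i ∈
    (univ.erase none : Finset (Option α))} from ?_, this]
  · simp [card_erase_of_mem, div_pow]
  · ext z
    simp [IsVar]

/-- Replace the letters of `z` by those of `x`, keeping the variables. -/
def fillStars {ι α : Type} (z : ι → Option α) (x : ι → α) : ι → Option α :=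
  fun i => (z i).map fun _ => x i

lemma expect_fillStars {ι α : Type} [Fintype ι] [DecidableEq ι] [Fintype α] [Nonempty α]
    (f : (ι → Option α) → ℝ) : 𝔼 z, f z = 𝔼 z, 𝔼 x, f (fillStars z x) := by
  have e : 𝔼 p : (ι → Option α) × (ι → α), f p.1 =
      𝔼 p : (ι → Option α) × (ι → α), f (fillStars p.1 p.2) := by
    let g : (ι → Option α) × (ι → α) → (ι → Option α) × (ι → α) :=
      fun p => (fillStars p.1 p.2, fun i => (p.1 i).getD (p.2 i))
    have hg : Function.Involutive g := by
      rintro ⟨z, x⟩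
      ext i
      · simp only [g, fillStars]
        rcases z i with _ | a <;> simp
      · simp only [g, fillStars]
        rcases z i with _ | a <;> simp
    exact Fintype.expect_equiv hg.toPerm _ _ fun p => by
      have := congrArg Prod.fst (hg p)
      simpa [g] using congrArg f this.symm
  rw [expect_prod', expect_prod'] at e
  simpa [expect_const] using e

lemma expect_restrict {ι α : Type} [Fintype ι] [DecidableEq ι] [Fintype α] [Nonempty α]
    (p : ι → Prop) [DecidablePred p] (f : ({i // p i} → α) → ℝ) :
    𝔼 x : ι → α, f (fun i => x i) = 𝔼 x, f x := by
  have := expect_prod' (fun z : ({i // p i} → α) × ({i // ¬ p i} → α) => f z.1)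
  simp only [expect_const univ_nonempty] at this
  rw [← this]
  exact Fintype.expect_equiv (Equiv.piEquivPiSubtypeProd p fun _ => α) _ _ fun x => rfl

/-- Dense sets insensitive to replacing `none` by `a` contain large subspaces. -/
lemma exists_subspace_insensitive {α : Type} [Fintype α] [Nonempty α] (h : ∀ δ > 0, DHJ α δ)
    (η : Type) [Fintype η] (a : α) {γ : ℝ} (hγ : 0 < γ) :
    ∃ (ι : Type) (_ : Fintype ι) (_ : DecidableEq ι), ∀ C : Set (ι → α),
      γ ≤ dens {z : ι → Option α | line z a ∈ C} →
        ∃ V : Subspace η (Option α) ι, ∀ y, line (V y) a ∈ C := by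
  classical
  obtain ⟨n, hn⟩ := mdhj h η (half_pos hγ)
  have hk : (1 : ℝ) / (Fintype.card α + 1) < 1 := by
    rw [div_lt_one (by positivity)]
    have : (0 : ℝ) < Fintype.card α := by exact_mod_cast Fintype.card_pos
    linarith
  obtain ⟨s, hs⟩ := exists_pow_lt_of_lt_one (show 0 < γ / 4 / (n + 1) by positivity) hk
  refine ⟨Fin n × Fin s, inferInstance, inferInstance, fun C hC => ?_⟩
  let D : Set (Fin n × Fin s → Option α) := {z | line z a ∈ C}
  have h1 : γ ≤ 𝔼 z, 𝔼 x, D.indicator 1 (fillStars z x) := by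
    rw [← expect_fillStars]
    exact hC
  have h2 := dens_ge_of_expect (half_pos hγ).le
    (fun z => expect_le_of_le zero_le_one fun x => indicator_le_one' D _) h1
  have h3 : dens {z : Fin n × Fin s → Option α | ∃ i, ∀ j, z (i, j) = none} ≤ γ / 4 := by
    rw [show {z : Fin n × Fin s → Option α | ∃ i, ∀ j, z (i, j) = none} =
      ⋃ i, {z | ∀ j ∈ (univ : Finset (Fin s)).map ⟨fun j => (i, j), fun j j' hj => by simpa using hj⟩,
        z j = none} from by ext; simp; rfl]
    refine (dens_iUnion_le _).trans ?_
    simp only [dens_none_pos, card_map, card_univ, Fintype.card_fin, sum_const, nsmul_eq_mul]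
    calc (n : ℝ) * (1 / (Fintype.card α + 1)) ^ s ≤ (n + 1) * (γ / 4 / (n + 1)) := by
          gcongr
          linarith
      _ = γ / 4 := by field_simp
  obtain ⟨z, hz, hz'⟩ : ∃ z, γ / 2 ≤ 𝔼 x, D.indicator 1 (fillStars z x) ∧
      ¬ ∃ i, ∀ j, z (i, j) = none := by
    by_contra! hcon
    have := dens_mono (A := {z | γ / 2 ≤ 𝔼 x, D.indicator 1 (fillStars z x)})
      (B := {z : Fin n × Fin s → Option α | ∃ i, ∀ j, z (i, j) = none}) fun z hz => hcon z hz
    linarith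
  push Not at hz'
  choose g hg using hz'
  let J := {p : Fin n × Fin s // z p ≠ none}
  let ext : (J → α) → (Fin n × Fin s → Option α) :=
    fun x i => if hi : z i ≠ none then some (x ⟨i, hi⟩) else none
  have hcard : n ≤ Fintype.card J := by
    have := Fintype.card_le_of_injective (fun i : Fin n => (⟨(i, g i), hg i⟩ : J))
      (fun i j hij => by simp at hij; exact hij.1)
    rwa [Fintype.card_fin] at this
  obtain ⟨V, hV⟩ := hn J hcard (ext ⁻¹' D) (by
    refine hz.trans (le_of_eq ?_)
    unfold dens
    rw [← expect_restrict (fun p => z p ≠ none)]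
    refine expect_congr rfl fun x _ => ?_
    have : fillStars z x = ext fun i => x i := by
      funext i
      simp only [fillStars, ext]
      rcases hi : z i with _ | b <;> simp [hi]
    rw [this]
    rfl)
  refine ⟨⟨fun i => if hi : z i ≠ none then Sum.map some id (V.idxFun ⟨i, hi⟩) else Sum.inl none,
    fun e => ?_⟩, fun y => ?_⟩
  · obtain ⟨i, hi⟩ := V.proper e
    exact ⟨i, by simp [i.2, hi]⟩
  · have := hV (line y a)
    simp only [D, Set.mem_preimage, Set.mem_ofPred_eq] at this
    convert this using 1
    funext i
    simp only [line, Subspace.coe_apply, ext]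
    by_cases hi : z i ≠ none
    · simp only [hi, not_false_eq_true, dif_pos, ne_eq]
      rcases V.idxFun ⟨i, hi⟩ with b | e <;> simp [line]
    · simp [hi]

/-- A subspace together with fixed coordinates on the right. -/
def fixRight {η ι κ β : Type} (V : Subspace η β ι) (y : κ → β) : Subspace η β (ι ⊕ κ) where
  idxFun := Sum.elim V.idxFun fun j => Sum.inl (y j)
  proper e := by
    obtain ⟨i, hi⟩ := V.proper e
    exact ⟨Sum.inl i, by simp [hi]⟩

/-- A subspace together with fixed coordinates on the left. -/
def fixLeft {η ι κ β : Type} (x : ι → β) (V : Subspace η β κ) : Subspace η β (ι ⊕ κ) where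
  idxFun := Sum.elim (fun j => Sum.inl (x j)) V.idxFun
  proper e := by
    obtain ⟨i, hi⟩ := V.proper e
    exact ⟨Sum.inr i, by simp [hi]⟩

@[simp] lemma fixRight_apply {η ι κ β : Type} (V : Subspace η β ι) (y : κ → β) (w : η → β) :
    fixRight V y w = Sum.elim (V w) y := by
  funext i
  rcases i with i | i <;> simp [Subspace.coe_apply, fixRight]

@[simp] lemma fixLeft_apply {η ι κ β : Type} (x : ι → β) (V : Subspace η β κ) (w : η → β) :
    fixLeft x V w = Sum.elim x (V w) := by
  funext i
  rcases i with i | i <;> simp [Subspace.coe_apply, fixLeft]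

lemma line_sumElim {ι κ α : Type} (x : ι → Option α) (y : κ → Option α) (a : α) :
    line (Sum.elim x y) a = Sum.elim (line x a) (line y a) := by
  funext i
  rcases i with i | i <;> simp [line]

lemma expect_image {X Y : Type} [Fintype X] [Fintype Y] [Nonempty X] (f : X → Y)
    (hf : Function.Injective f) (h : Y → ℝ) :
    𝔼 y, h y * (Set.range f).indicator 1 y =
      (Fintype.card X : ℝ) / Fintype.card Y * 𝔼 x, h (f x) := by
  classical
  rw [Fintype.expect_eq_sum_div_card, Fintype.expect_eq_sum_div_card]
  have h1 : ∀ y, h y * (Set.range f).indicator 1 y = if y ∈ univ.image f then h y else 0 := by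
    intro y
    by_cases hy : y ∈ Set.range f
    · rw [if_pos (by simpa using hy)]
      simp [hy]
    · rw [if_neg (by simpa using hy)]
      simp [hy]
  simp only [h1]
  rw [sum_ite_mem, univ_inter, sum_image fun a _ b _ hab => hf hab]
  have : (Fintype.card X : ℝ) ≠ 0 := by simp
  field_simp

lemma subspace_injective {η ι β : Type} (V : Subspace η β ι) : Function.Injective V := by
  intro x y hxy
  funext e
  obtain ⟨i, hi⟩ := V.proper e
  have := congrFun hxy i
  simpa [Subspace.coe_apply, hi] using this

/-- Repeatedly removing subspaces from an insensitive set. -/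
lemma insensitive_iterate {α : Type} [Fintype α] [Nonempty α] (η : Type) [Fintype η]
    [DecidableEq η] (a : α) {γ : ℝ} (hγ : 0 < γ) (ι : Type) [Fintype ι] [DecidableEq ι]
    (hι : ∀ C : Set (ι → α), γ / 2 ≤ dens {z : ι → Option α | line z a ∈ C} →
      ∃ V : Subspace η (Option α) ι, ∀ y, line (V y) a ∈ C) (t : ℕ) :
    ∃ (κ : Type) (_ : Fintype κ) (_ : DecidableEq κ), ∀ h : (κ → Option α) → ℝ, (∀ z, h z ≤ 1) →
      (∀ V : Subspace η (Option α) κ, 𝔼 y, h (V y) ≤ 0) → ∀ C : Set (κ → α),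
        𝔼 z, h z * {z : κ → Option α | line z a ∈ C}.indicator 1 z ≤
          γ + (max 0 (1 - (Fintype.card (η → Option α) : ℝ) /
            Fintype.card (ι → Option α) / 2)) ^ t * dens {z : κ → Option α | line z a ∈ C} := by
  classical
  induction t with
  | zero =>
    refine ⟨Fin 0, inferInstance, inferInstance, fun h h1 _ C => ?_⟩
    rw [pow_zero, one_mul]
    refine le_trans (expect_le_expect fun z _ => ?_) (le_add_of_nonneg_left hγ.le)
    exact mul_le_of_le_one_left (indicator_nonneg' _ _) (h1 z)
  | succ t ih =>
    obtain ⟨κ, _, _, hκ⟩ := ih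
    set θ : ℝ := (Fintype.card (η → Option α) : ℝ) / Fintype.card (ι → Option α) with hθ
    have hθ0 : 0 ≤ θ := by positivity
    set r := max 0 (1 - θ / 2) with hr
    have hr0 : 0 ≤ r := le_max_left _ _
    refine ⟨ι ⊕ κ, inferInstance, inferInstance, fun h h1 hV C => ?_⟩
    set D : Set (ι ⊕ κ → Option α) := {z | line z a ∈ C} with hD
    let fib : (κ → α) → Set (ι → α) := fun u => {x | Sum.elim x u ∈ C}
    let dfib : (κ → α) → ℝ := fun u => dens {z : ι → Option α | line z a ∈ fib u}
    have hdD : dens D = 𝔼 y : κ → Option α, dfib (line y a) := by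
      unfold dens
      rw [expect_sumElim, expect_swap]
      refine expect_congr rfl fun y _ => expect_congr rfl fun x _ => ?_
      simp [hD, Set.indicator, line_sumElim, fib, Set.mem_ofPred_eq]
    by_cases hγD : dens D ≤ γ
    · calc 𝔼 z, h z * D.indicator 1 z ≤ dens D := expect_le_expect fun z _ =>
            mul_le_of_le_one_left (indicator_nonneg' _ _) (h1 z)
        _ ≤ γ := hγD
        _ ≤ _ := le_add_of_nonneg_right (mul_nonneg (pow_nonneg hr0 _) (dens_nonneg _))
    push Not at hγD
    have hR : ∀ u : κ → α, ∃ R : Set (ι → Option α), (∀ x ∈ R, line x a ∈ fib u) ∧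
        (∀ y : κ → Option α, 𝔼 x, h (Sum.elim x y) * R.indicator 1 x ≤ 0) ∧
        (γ / 2 ≤ dfib u → θ ≤ dens R) := by
      intro u
      by_cases hu : γ / 2 ≤ dfib u
      · obtain ⟨V, hVu⟩ := hι _ hu
        refine ⟨Set.range V, ?_, fun y => ?_, fun _ => ?_⟩
        · rintro _ ⟨y, rfl⟩
          exact hVu y
        · rw [expect_image V (subspace_injective V) fun x => h (Sum.elim x y)]
          refine mul_nonpos_of_nonneg_of_nonpos hθ0 ?_
          simpa using hV (fixRight V y)
        · have := expect_image V (subspace_injective V) fun _ => 1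
          simp only [one_mul, expect_const univ_nonempty, mul_one] at this
          exact this.ge
      · exact ⟨∅, by simp, by simp, fun h => absurd h hu⟩
    choose R hRsub hRh hRθ using hR
    let Rm : Set (ι ⊕ κ → Option α) := {z | z ∘ Sum.inl ∈ R (line (z ∘ Sum.inr) a)}
    have hRmD : Rm ⊆ D := by
      intro z hz
      have := hRsub _ _ hz
      simp only [fib, Set.mem_ofPred_eq] at this
      simp only [hD, Set.mem_ofPred_eq]
      convert this using 1
      rw [← line_sumElim]
      congr 1
      exact (Sum.elim_comp_inl_inr z).symm
    have hRmi : ∀ x y, Rm.indicator (1 : (ι ⊕ κ → Option α) → ℝ) (Sum.elim x y) =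
        (R (line y a)).indicator 1 x := by
      intro x y
      simp only [Rm, Set.indicator, Set.mem_ofPred_eq, Sum.elim_comp_inl, Sum.elim_comp_inr,
        Pi.one_apply]
      congr
    have hsplit : ∀ z, D.indicator (1 : (ι ⊕ κ → Option α) → ℝ) z =
        Rm.indicator 1 z + (D \ Rm).indicator 1 z := by
      intro z
      by_cases hz : z ∈ Rm
      · simp [hz, hRmD hz]
      · by_cases hz' : z ∈ D <;> simp [hz, hz']
    have e1 : 𝔼 z, h z * Rm.indicator 1 z ≤ 0 := by
      rw [expect_sumElim, expect_swap]
      simp only [hRmi]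
      exact expect_le_of_le le_rfl fun y => hRh _ y
    let C' : (ι → Option α) → Set (κ → α) :=
      fun x => {u | Sum.elim (line x a) u ∈ C ∧ x ∉ R u}
    have hD'i : ∀ x y, (D \ Rm).indicator (1 : (ι ⊕ κ → Option α) → ℝ) (Sum.elim x y) =
        {z : κ → Option α | line z a ∈ C' x}.indicator 1 y := by
      intro x y
      simp [Rm, hD, C', Set.indicator, Set.mem_ofPred_eq, line_sumElim]
    have e2 : 𝔼 z, h z * (D \ Rm).indicator 1 z ≤ γ + r ^ t * dens (D \ Rm) := by
      unfold dens
      rw [expect_sumElim, expect_sumElim]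
      simp only [hD'i]
      have : γ + r ^ t * 𝔼 x : ι → Option α, 𝔼 y : κ → Option α,
          {z : κ → Option α | line z a ∈ C' x}.indicator (1 : (κ → Option α) → ℝ) y =
          𝔼 x : ι → Option α, (γ + r ^ t * dens {z : κ → Option α | line z a ∈ C' x}) := by
        rw [expect_add_distrib, expect_const univ_nonempty, ← mul_expect]
        rfl
      rw [this]
      refine expect_le_expect fun x _ => ?_
      exact hκ (fun y => h (Sum.elim x y)) (fun y => h1 _)
        (fun V => by simpa using hV (fixLeft x V)) (C' x)
    have e3 : θ * (dens D - γ / 2) ≤ dens Rm := by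
      have := dens_ge_of_expect (half_pos hγ).le (fun y => dens_le_one _) hdD.le
      refine (mul_le_mul_of_nonneg_left this hθ0).trans ?_
      unfold dens
      rw [expect_sumElim, expect_swap, mul_expect]
      simp only [hRmi]
      refine expect_le_expect fun y _ => ?_
      by_cases hy : γ / 2 ≤ dfib (line y a)
      · rw [Set.indicator_of_mem (by exact hy)]
        rw [Pi.one_apply, mul_one]
        exact hRθ _ hy
      · rw [Set.indicator_of_notMem (by exact hy), mul_zero]
        exact dens_nonneg _
    have e4 : dens D = dens Rm + dens (D \ Rm) := by
      unfold dens
      rw [← expect_add_distrib]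
      exact expect_congr rfl fun z _ => hsplit z
    have e5 : dens (D \ Rm) ≤ r * dens D := by
      have : (1 - θ / 2) * dens D ≤ r * dens D :=
        mul_le_mul_of_nonneg_right (le_max_right _ _) (dens_nonneg _)
      nlinarith
    calc 𝔼 z, h z * D.indicator 1 z
        = 𝔼 z, h z * Rm.indicator 1 z + 𝔼 z, h z * (D \ Rm).indicator 1 z := by
          rw [← expect_add_distrib]
          exact expect_congr rfl fun z _ => by rw [hsplit, mul_add]
      _ ≤ 0 + (γ + r ^ t * dens (D \ Rm)) := add_le_add e1 e2
      _ ≤ γ + r ^ (t + 1) * dens D := by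
          rw [pow_succ, mul_assoc, zero_add]
          gcongr

/-- Functions with nonpositive averages on subspaces have small correlation with insensitive
sets. -/
lemma insensitive_single {α : Type} [Fintype α] [Nonempty α] (H : ∀ δ > 0, DHJ α δ)
    (η : Type) [Fintype η] [DecidableEq η] (a : α) {γ : ℝ} (hγ : 0 < γ) :
    ∃ (κ : Type) (_ : Fintype κ) (_ : DecidableEq κ), ∀ h : (κ → Option α) → ℝ, (∀ z, h z ≤ 1) →
      (∀ V : Subspace η (Option α) κ, 𝔼 y, h (V y) ≤ 0) → ∀ C : Set (κ → α),
        𝔼 z, h z * {z : κ → Option α | line z a ∈ C}.indicator 1 z ≤ γ := by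
  classical
  obtain ⟨ι, _, _, hι⟩ := exists_subspace_insensitive H η a (half_pos (half_pos hγ))
  set r : ℝ := max 0 (1 - (Fintype.card (η → Option α) : ℝ) / Fintype.card (ι → Option α) / 2)
    with hr
  have hr1 : r < 1 := max_lt one_pos (by
    have : (0 : ℝ) < (Fintype.card (η → Option α) : ℝ) / Fintype.card (ι → Option α) := by
      have : 0 < Fintype.card (η → Option α) := Fintype.card_pos
      have : 0 < Fintype.card (ι → Option α) := Fintype.card_pos
      positivity
    linarith)
  obtain ⟨t, ht⟩ := exists_pow_lt_of_lt_one (half_pos hγ) hr1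
  obtain ⟨κ, i1, i2, hκ⟩ := insensitive_iterate η a (half_pos hγ) ι hι t
  refine ⟨κ, i1, i2, fun h h1 h2 C => (hκ h h1 h2 C).trans ?_⟩
  rw [← hr]
  have : r ^ t * dens {z : κ → Option α | line z a ∈ C} ≤ r ^ t * 1 :=
    mul_le_mul_of_nonneg_left (dens_le_one _) (pow_nonneg (le_max_left _ _) _)
  linarith

/-- The analogue for intersections of sets insensitive with respect to several letters. -/
lemma insensitive_many {α : Type} [Fintype α] [Nonempty α] (H : ∀ δ > 0, DHJ α δ)
    (B : Finset α) : ∀ (η : Type) [Fintype η] [DecidableEq η] {γ : ℝ}, 0 < γ →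
    ∃ (κ : Type) (_ : Fintype κ) (_ : DecidableEq κ), ∀ h : (κ → Option α) → ℝ, (∀ z, h z ≤ 1) →
      (∀ V : Subspace η (Option α) κ, 𝔼 y, h (V y) ≤ 0) → ∀ C : α → Set (κ → α),
        𝔼 z, h z * ∏ a ∈ B, {z : κ → Option α | line z a ∈ C a}.indicator 1 z ≤ γ := by
  classical
  induction B using Finset.induction_on with
  | empty =>
    intro η _ _ γ hγ
    refine ⟨η, inferInstance, inferInstance, fun h _ hV C => ?_⟩
    have := hV ⟨Sum.inr, fun e => ⟨e, rfl⟩⟩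
    simp only [prod_empty, mul_one]
    exact le_trans this hγ.le
  | insert a B ha ih =>
    intro η _ _ γ hγ
    obtain ⟨η', _, _, hη'⟩ := ih η (half_pos hγ)
    obtain ⟨κ, _, _, hκ⟩ := insensitive_single H η' a (half_pos hγ)
    refine ⟨κ, inferInstance, inferInstance, fun h h1 hV C => ?_⟩
    set G : (κ → Option α) → ℝ :=
      fun z => ∏ b ∈ B, {z : κ → Option α | line z b ∈ C b}.indicator 1 z with hG
    have hG0 : ∀ z, 0 ≤ G z := fun z => prod_nonneg fun b _ => indicator_nonneg' _ _
    have hG1 : ∀ z, G z ≤ 1 := fun z =>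
      prod_le_one (fun b _ => indicator_nonneg' _ _) fun b _ => indicator_le_one' _ _
    have key := hκ (fun z => h z * G z - γ / 2)
      (fun z => by nlinarith [h1 z, hG0 z, hG1 z]) (fun V => ?_) (C a)
    · have e : 𝔼 z, h z * ∏ b ∈ insert a B, {z : κ → Option α | line z b ∈ C b}.indicator 1 z =
          𝔼 z, (h z * G z - γ / 2) * {z : κ → Option α | line z a ∈ C a}.indicator 1 z +
          γ / 2 * dens {z : κ → Option α | line z a ∈ C a} := by
        unfold dens
        rw [mul_expect, ← expect_add_distrib]
        refine expect_congr rfl fun z _ => ?_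
        rw [prod_insert ha]
        ring
      rw [e]
      have := mul_le_mul_of_nonneg_left
        (dens_le_one {z : κ → Option α | line z a ∈ C a}) (half_pos hγ).le
      linarith
    · rw [expect_sub_distrib, expect_const univ_nonempty, sub_nonpos]
      have := hη' (fun y => h (V y)) (fun y => h1 _)
        (fun W => by simpa using hV (subComp V W))
        (fun b => {u | (fun i => Sum.elim (fun c : Option α => c.getD b) u (V.idxFun i)) ∈ C b})
      refine le_trans (le_of_eq (expect_congr rfl fun y _ => ?_)) this
      congr 1
      simp only [hG]
      refine prod_congr rfl fun b _ => ?_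
      have : line (V y) b = fun i => Sum.elim (fun c : Option α => c.getD b) (line y b)
          (V.idxFun i) := by
        funext i
        simp only [line, Subspace.coe_apply]
        rcases V.idxFun i with c | e <;> simp [line]
      simp [Set.indicator, this, Set.mem_ofPred_eq]

end

noncomputable section

open Combinatorics

/-- The identity subspace. -/
def idSub (η α : Type) : Subspace η α η := ⟨Sum.inr, fun e => ⟨e, rfl⟩⟩

lemma sum_prod_indicator {Z α : Type} [Fintype α] [DecidableEq α] (D : α → Set Z) (z : Z) :
    ∑ p : α → Bool, ∏ a, (if p a then D a else (D a)ᶜ).indicator (1 : Z → ℝ) z = 1 := by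
  have := Finset.prod_univ_sum (fun _ : α => (univ : Finset Bool))
    (fun a b => (if b then D a else (D a)ᶜ).indicator (1 : Z → ℝ) z)
  rw [Fintype.piFinset_univ] at this
  rw [← this]
  refine prod_eq_one fun a _ => ?_
  by_cases hz : z ∈ D a <;> simp [hz]

lemma line_some {ι α : Type} (y : ι → α) (a : α) : line (fun i => some (y i)) a = y := rfl

lemma dhj_decrement {α : Type} [Fintype α] [Nonempty α] (H : ∀ δ > 0, DHJ α δ) {δ₀ : ℝ}
    (hδ₀ : 0 < δ₀) (K : ∀ c > 0, DHJ (Option α) (δ₀ + c)) :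
    ∃ c > 0, DHJ (Option α) (δ₀ - c) := by
  classical
  rcases lt_or_ge 1 δ₀ with h1 | h1
  · exact ⟨(δ₀ - 1) / 2, by linarith, DHJ.of_one_lt (by linarith)⟩
  obtain ⟨n₀, hn₀⟩ := H (δ₀ / 4) (by positivity)
  let L := Fin n₀ → Option α
  have hL : (1 : ℝ) ≤ Fintype.card L := by exact_mod_cast Fintype.card_pos
  set θ := δ₀ / 4 / Fintype.card L with hθ
  have hθ0 : 0 < θ := by positivity
  have hθ1 : θ ≤ 1 / 4 := by
    rw [hθ, div_le_iff₀ (by linarith)]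
    nlinarith
  set q := δ₀ * θ / 16 with hq
  have hq0 : 0 < q := by positivity
  have hq1 : q ≤ δ₀ / 64 := by nlinarith
  obtain ⟨n₁, hn₁⟩ := K q hq0
  have hk : (Fintype.card α : ℝ) / (Fintype.card α + 1) < 1 := by
    rw [div_lt_one (by positivity)]
    linarith
  obtain ⟨s, hs⟩ := exists_pow_lt_of_lt_one hq0 hk
  set γ := q / Fintype.card (α → Bool) with hγ
  have hcB : (1 : ℝ) ≤ Fintype.card (α → Bool) := by exact_mod_cast Fintype.card_pos
  have hγ0 : 0 < γ := by positivity
  have hγ1 : γ < 1 := by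
    rw [hγ, div_lt_one (by linarith)]
    linarith
  obtain ⟨η, _, _, hη⟩ := insensitive_many H univ (Fin (n₁ + s)) hγ0
  have hηs : s ≤ Fintype.card η := by
    by_contra hcon
    have := hη (fun _ => 1) (fun _ => le_rfl) (fun V => by
      exfalso
      choose f hf using V.proper
      have := Fintype.card_le_of_injective f fun i j hij => by
        have h1 := hf i
        rw [hij, hf j] at h1
        simpa using h1.symm
      simp at this
      omega) fun _ => Set.univ
    simp [Set.indicator, expect_const] at this
    linarith
  obtain ⟨ι₁, _, _, hι₁⟩ := graham_rothschild α Bool (η ⊕ Fin n₀)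
  have hT : (1 : ℝ) ≤ Fintype.card (ι₁ → Option α) := by exact_mod_cast Fintype.card_pos
  set T : ℝ := (Fintype.card (ι₁ → Option α) : ℝ) with hTdef
  have hc : 0 < q / (2 * T) := by positivity
  obtain ⟨n₂, hn₂⟩ := K _ hc
  refine ⟨_, hc, DHJ.of_exists (κ := ι₁ ⊕ Fin n₂) fun A hA => ?_⟩
  by_contra! hno
  let At : (ι₁ → Option α) → Set (Fin n₂ → Option α) := fun t => {y | Sum.elim t y ∈ A}
  have hAt1 : ∀ t, dens (At t) ≤ δ₀ + q / (2 * T) := by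
    intro t
    by_contra! h
    obtain ⟨x, ⟨i, hi⟩, hx⟩ := hn₂ (Fin n₂) (by simp) (At t) h.le
    obtain ⟨a, ha⟩ := hno (Sum.elim (fun i => some (t i)) x) ⟨Sum.inr i, by simp [hi]⟩
    rw [line_sumElim] at ha
    exact ha (hx a)
  have hAavg : dens A = 𝔼 t, dens (At t) := by
    unfold dens
    rw [expect_sumElim]
    rfl
  have hAt2 : ∀ t, δ₀ - q ≤ dens (At t) := by
    intro t
    rw [hAavg, Fintype.expect_eq_sum_div_card, le_div_iff₀ (by linarith),
      ← add_sum_erase _ _ (mem_univ t)] at hA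
    have h2 : ∑ t ∈ univ.erase t, dens (At t) ≤ (T - 1) * (δ₀ + q / (2 * T)) := by
      refine (sum_le_card_nsmul _ _ _ fun t _ => hAt1 t).trans (le_of_eq ?_)
      rw [nsmul_eq_mul, card_erase_of_mem (mem_univ t), card_univ,
        Nat.cast_sub Fintype.card_pos, Nat.cast_one]
    have h3 : q / (2 * T) * T = q / 2 := by field_simp
    rw [← hTdef] at hA
    nlinarith
  let good : (ι₁ → Option α) → Prop := fun w =>
    θ ≤ dens {y | ∀ a, Sum.elim (fun i => some (line w a i)) y ∈ A}
  obtain ⟨U, hU⟩ := hι₁ fun w => decide (good w)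
  let a₀ : α := Classical.arbitrary α
  have hgood : ∀ x, IsVar x → good (liftSub U x) := by
    let U₀ := subComp U (fixLeft (fun _ => a₀) (idSub (Fin n₀) α))
    have e1 : δ₀ / 2 ≤ 𝔼 y, dens {t | y ∈ At (fun i => some (U₀ t i))} := by
      have : 𝔼 y, dens {t | y ∈ At (fun i => some (U₀ t i))} =
          𝔼 t, dens (At (fun i => some (U₀ t i))) := by
        unfold dens
        rw [expect_swap]
        rfl
      rw [this]
      refine le_trans ?_ (expect_le_expect (f := fun _ => δ₀ - q) fun t _ => hAt2 _)
      rw [expect_const univ_nonempty]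
      linarith
    have e2 := dens_ge_of_expect (show 0 ≤ δ₀ / 4 by positivity) (fun y => dens_le_one _) e1
    obtain ⟨x, hx⟩ := exists_dens_ge (L := L)
      (A := {y | δ₀ / 4 ≤ dens {t | y ∈ At (fun i => some (U₀ t i))}})
      (P := fun x y => IsVar x ∧ ∀ a, line x a ∈ {t | y ∈ At (fun i => some (U₀ t i))})
      (fun y hy => hn₀ (Fin n₀) (by simp) _ hy)
    have hx' : θ ≤ _ :=
      le_trans (div_le_div_of_nonneg_right (by linarith) (by linarith)) hx
    obtain ⟨y, hy⟩ := nonempty_of_dens_pos (hθ0.trans_le hx')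
    have hxv : IsVar x := hy.1
    have hgx : good (liftSub U₀ x) := by
      refine hx'.trans (dens_mono fun y hy a => ?_)
      rw [line_liftSub]
      exact hy.2 a
    intro z hz
    have := hU _ _ hz (IsVar.liftSub (fixLeft (fun _ => a₀) (idSub (Fin n₀) α)) hxv)
    rw [← liftSub_subComp] at this
    exact of_decide_eq_true (this.trans (decide_eq_true hgx))
  let U' : Subspace η α ι₁ := subComp U (fixRight (idSub η α) fun _ => a₀)
  let C : (Fin n₂ → Option α) → Set (η → α) := fun y => {t | y ∈ At (fun i => some (U' t i))}
  let G : (Fin n₂ → Option α) → (η → Option α) → ℝ :=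
    fun y w => ∏ a, {z : η → Option α | line z a ∈ C y}.indicator 1 w
  have hG : ∀ y w, G y w = {z : η → Option α | ∀ a, line z a ∈ C y}.indicator 1 w := by
    intro y w
    by_cases hw : ∀ a, line w a ∈ C y
    · rw [Set.indicator_of_mem (by exact hw)]
      exact prod_eq_one fun a _ => Set.indicator_of_mem (by exact hw a) _
    · rw [Set.indicator_of_notMem (by exact hw)]
      push Not at hw
      obtain ⟨a, ha⟩ := hw
      exact prod_eq_zero (mem_univ a) (Set.indicator_of_notMem (by exact ha) _)
  set ε := dens {z : η → Option α | ¬ IsVar z} with hε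
  have hεq : ε ≤ q := by
    rw [hε, dens_not_isVar]
    exact (pow_le_pow_of_le_one (by positivity) hk.le hηs).trans hs.le
  have hGavg : θ * (1 - ε) ≤ 𝔼 y, 𝔼 w, G y w := by
    have : 1 - ε = 𝔼 w : η → Option α, {z : η → Option α | IsVar z}.indicator (1 : (η → Option α) → ℝ) w := by
      rw [sub_eq_iff_eq_add, hε]
      unfold dens
      rw [← expect_add_distrib, ← expect_const (univ_nonempty (α := η → Option α)) (1 : ℝ)]
      refine expect_congr rfl fun w _ => ?_
      by_cases hw : IsVar w <;> simp [hw, Set.indicator, Set.mem_ofPred_eq]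
    rw [this, mul_expect, expect_swap]
    refine expect_le_expect fun w _ => ?_
    by_cases hw : IsVar w
    · rw [Set.indicator_of_mem (by exact hw), Pi.one_apply, mul_one]
      have := hgood (liftSub (fixRight (idSub η α) fun _ => a₀) w) (IsVar.liftSub _ hw)
      rw [← liftSub_subComp] at this
      refine le_trans this (le_of_eq ?_)
      unfold dens
      refine expect_congr rfl fun y _ => ?_
      rw [hG]
      simp only [line_liftSub, Set.indicator, Set.mem_ofPred_eq, C, At, U', Pi.one_apply]
    · rw [Set.indicator_of_notMem (by exact hw), mul_zero]
      exact expect_nonneg fun y _ => by rw [hG]; exact indicator_nonneg' _ _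
  let h : (Fin n₂ → Option α) → (η → Option α) → ℝ :=
    fun y w => (At (liftSub U' w)).indicator 1 y - (δ₀ + q)
  have hh1 : ∀ y w, h y w ≤ 1 := by
    intro y w
    have := indicator_le_one' (At (liftSub U' w)) y
    simp only [h]
    linarith
  have hsub : ∀ y, ∀ V : Subspace (Fin (n₁ + s)) (Option α) η, 𝔼 v, h y (V v) ≤ 0 := by
    intro y V
    simp only [h]
    rw [expect_sub_distrib, expect_const univ_nonempty, sub_nonpos]
    by_contra! hcon
    obtain ⟨x, hxv, hx⟩ := hn₁ (Fin (n₁ + s)) (by simp) {v | y ∈ At (liftSub U' (V v))} hcon.le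
    obtain ⟨i, hi⟩ := IsVar.liftSub (subComp (liftSub U') V) hxv
    obtain ⟨b, hb⟩ := hno (Sum.elim (liftSub (subComp (liftSub U') V) x) fun i => some (y i))
      ⟨Sum.inl i, by simp [hi]⟩
    rw [line_sumElim, line_liftSub, line_some, subComp_apply] at hb
    exact hb (hx b)
  have hmain : ∀ y, 𝔼 w, h y w ≤ q + (ε - δ₀ * 𝔼 w, G y w) := by
    intro y
    have e1 : 𝔼 w, h y w = ∑ p : α → Bool, 𝔼 w, h y w * ∏ a,
        {z : η → Option α | line z a ∈ (if p a then C y else (C y)ᶜ)}.indicator 1 w := by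
      rw [← expect_sum_comm]
      refine expect_congr rfl fun w _ => ?_
      rw [← mul_sum]
      have := sum_prod_indicator (fun a : α => {z : η → Option α | line z a ∈ C y}) w
      conv_lhs => rw [← mul_one (h y w), ← this]
      congr 1
      refine sum_congr rfl fun p _ => prod_congr rfl fun a _ => ?_
      by_cases hp : p a <;> simp [hp, Set.indicator, Set.mem_ofPred_eq]
    rw [e1, ← sum_erase_add _ _ (mem_univ fun _ => true)]
    refine add_le_add ?_ ?_
    · calc _ ≤ ∑ p ∈ univ.erase (fun _ : α => true), γ :=
            sum_le_sum fun p _ => hη (h y) (hh1 y) (hsub y) fun a => if p a then C y else (C y)ᶜ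
        _ ≤ ∑ p : α → Bool, γ := sum_le_univ_sum_of_nonneg fun _ => hγ0.le
        _ = q := by
          rw [sum_const, card_univ, nsmul_eq_mul, hγ]
          field_simp
    · simp only [if_true]
      have : ∀ w, h y w * G y w ≤
          {z : η → Option α | ¬ IsVar z}.indicator (1 : (η → Option α) → ℝ) w - δ₀ * G y w := by
        intro w
        simp only [h]
        have hG0 : 0 ≤ G y w := by rw [hG]; exact indicator_nonneg' _ _
        have : (At (liftSub U' w)).indicator 1 y * G y w ≤
            {z : η → Option α | ¬ IsVar z}.indicator (1 : (η → Option α) → ℝ) w := by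
          by_cases hw : IsVar w
          · rw [Set.indicator_of_notMem (s := {z : η → Option α | ¬ IsVar z}) (by simpa using hw)]
            rw [hG]
            by_cases hC : ∀ a, line w a ∈ C y
            · by_cases hwA : y ∈ At (liftSub U' w)
              · exfalso
                let w' : η → Option (Option α) := fun i => (w i).map some
                obtain ⟨j, hj⟩ := hw
                obtain ⟨i, hi⟩ := IsVar.liftSub (liftSub U') (x := w') ⟨j, by simp [w', hj]⟩
                obtain ⟨b, hb⟩ := hno (Sum.elim (liftSub (liftSub U') w') fun i => some (y i))
                  ⟨Sum.inl i, by simp [hi]⟩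
                rw [line_sumElim, line_liftSub, line_some] at hb
                rcases b with _ | a
                · have : line w' none = w := by
                    funext i
                    simp only [line, w']
                    rcases w i with _ | a <;> simp
                  rw [this] at hb
                  exact hb hwA
                · have : line w' (some a) = fun i => some (line w a i) := by
                    funext i
                    simp only [line, w']
                    rcases w i with _ | a <;> simp
                  rw [this, liftSub_some] at hb
                  exact hb (hC a)
              · simp [hwA]
            · rw [Set.indicator_of_notMem (s := {z | ∀ a, line z a ∈ C y}) (by exact hC), mul_zero]
          · rw [Set.indicator_of_mem (s := {z : η → Option α | ¬ IsVar z}) (by exact hw), Pi.one_apply]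
            refine mul_le_one₀ (indicator_le_one' _ _) hG0 ?_
            rw [hG]
            exact indicator_le_one' _ _
        nlinarith
      refine (expect_le_expect fun w _ => this w).trans (le_of_eq ?_)
      rw [expect_sub_distrib, ← mul_expect]
      rfl
  have f1 : 𝔼 y, 𝔼 w, h y w ≤ q + (ε - δ₀ * 𝔼 y, 𝔼 w, G y w) := by
    refine (expect_le_expect fun y _ => hmain y).trans (le_of_eq ?_)
    rw [expect_add_distrib, expect_sub_distrib, ← mul_expect, expect_const univ_nonempty,
      expect_const univ_nonempty]
  have f2 : -(2 * q) ≤ 𝔼 y, 𝔼 w, h y w := by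
    rw [expect_swap]
    refine le_trans (le_of_eq (expect_const univ_nonempty _).symm)
      (expect_le_expect fun w _ => ?_)
    simp only [h]
    rw [expect_sub_distrib, expect_const univ_nonempty]
    have := hAt2 (liftSub U' w)
    unfold dens at this
    linarith
  nlinarith

/-- The density Hales-Jewett theorem passes from `α` to `Option α`. -/
lemma dhj_option {α : Type} [Fintype α] [Nonempty α] (H : ∀ δ > 0, DHJ α δ) :
    ∀ δ > 0, DHJ (Option α) δ := by
  set S := {δ : ℝ | 0 ≤ δ ∧ DHJ (Option α) δ} with hS
  have hSbd : BddBelow S := ⟨0, fun δ h => h.1⟩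
  have hSne : S.Nonempty := ⟨2, by norm_num, DHJ.of_one_lt (by norm_num)⟩
  have h0 : 0 ≤ sInf S := le_csInf hSne fun δ h => h.1
  have habove : ∀ c > 0, DHJ (Option α) (sInf S + c) := by
    intro c hc
    obtain ⟨δ, hδ, hlt⟩ := exists_lt_of_csInf_lt hSne (lt_add_of_pos_right (sInf S) hc)
    exact hδ.2.mono hlt.le
  rcases h0.eq_or_lt with h | h
  · intro δ hδ
    simpa [← h] using habove δ hδ
  · exfalso
    obtain ⟨c, hc, hD⟩ := dhj_decrement H h habove
    have hm : max (sInf S - c) 0 ∈ S := ⟨le_max_right _ _, hD.mono (le_max_left _ _)⟩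
    have := csInf_le hSbd hm
    rcases max_choice (sInf S - c) 0 with h' | h' <;> rw [h'] at this <;> linarith

lemma dhj_unique {α : Type} [Fintype α] [Unique α] {δ : ℝ} (hδ : 0 < δ) : DHJ α δ := by
  refine ⟨1, fun ι _ _ hι A hA => ?_⟩
  obtain ⟨i⟩ : Nonempty ι := Fintype.card_pos_iff.1 hι
  obtain ⟨x, hx⟩ := nonempty_of_dens_pos (hδ.trans_le hA)
  exact ⟨fun _ => none, ⟨i, rfl⟩, fun a => by
    convert hx
    exact Subsingleton.elim _ _⟩

/-- The **density Hales-Jewett theorem**. -/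
theorem density_hales_jewett (k : ℕ) :
    ∃ (α : Type) (_ : Fintype α), Fintype.card α = k + 1 ∧ ∀ δ > 0, DHJ α δ := by
  induction k with
  | zero => exact ⟨Unit, inferInstance, by simp, fun δ hδ => dhj_unique hδ⟩
  | succ k ih =>
    obtain ⟨α, _, hα, h⟩ := ih
    have : Nonempty α := Fintype.card_pos_iff.1 (by omega)
    exact ⟨Option α, inferInstance, by simp [hα], dhj_option h⟩

end

noncomputable section

open Combinatorics

lemma card_ge_of_sum {β : Type*} (s : Finset β) (f : β → ℝ) {S t : ℝ} (h1 : ∀ z ∈ s, f z ≤ 1)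
    (ht : 0 ≤ t) (hS : S ≤ ∑ z ∈ s, f z) : S - t * s.card ≤ (s.filter fun z => t ≤ f z).card := by
  have : ∑ z ∈ s, f z ≤ ∑ z ∈ s, (t + if t ≤ f z then 1 else 0) := by
    refine sum_le_sum fun z hz => ?_
    split_ifs with h
    · linarith [h1 z hz]
    · linarith
  rw [sum_add_distrib, sum_boole, sum_const, nsmul_eq_mul] at this
  linarith

/-- The arithmetic progressions of length `k + 1` in a dense subset of an interval. -/
lemma card_progressions (k : ℕ) {δ : ℝ} (hδ : 0 < δ) :
    ∃ c > 0, ∃ N₀ : ℕ, ∀ N : ℕ, N₀ ≤ N → ∀ A ⊆ Icc (-N : ℤ) N, δ * N ≤ A.card →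
      c * N ^ 2 ≤ (((Icc (-2 * N : ℤ) (2 * N) ×ˢ Icc (-2 * N : ℤ) (2 * N)).filter
        fun p : ℤ × ℤ => ∀ j : Fin (k + 1), p.1 + (j : ℕ) * p.2 ∈ A).card : ℝ) := by
  classical
  obtain ⟨α, _, hα, H⟩ := density_hales_jewett k
  have : Nonempty α := Fintype.card_pos_iff.1 (by omega)
  let e : α ≃ Fin (k + 1) := Fintype.equivFinOfCardEq hα
  obtain ⟨n, hn⟩ := H (δ / 10) (by positivity)
  set M := (k + 1) * (n + 1) with hM
  have hM0 : 0 < M := by positivity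
  set L : ℕ := Fintype.card (Fin n → Option α) with hL
  have hL0 : 0 < L := Fintype.card_pos
  refine ⟨δ / (4 * M * L), by positivity, M, fun N hN A hA hAc => ?_⟩
  have hN1 : 1 ≤ N := hM0.trans_le hN
  set P := (Icc (-2 * N : ℤ) (2 * N) ×ˢ Icc (-2 * N : ℤ) (2 * N)).filter
        fun p : ℤ × ℤ => ∀ j : Fin (k + 1), p.1 + (j : ℕ) * p.2 ∈ A with hP
  let σ : (Fin n → α) → ℤ := fun x => ∑ i, ((e (x i) : ℕ) : ℤ)
  have hσ0 : ∀ x, 0 ≤ σ x := fun x => sum_nonneg fun i _ => by positivity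
  have hσ1 : ∀ x, σ x ≤ M := by
    intro x
    calc σ x ≤ ∑ i : Fin n, (k : ℤ) := sum_le_sum fun i _ => by
            have := (e (x i)).2
            omega
      _ = n * k := by simp
      _ ≤ M := by rw [hM]; push_cast; nlinarith
  set Y := Icc (1 : ℤ) (N / M : ℕ) with hY
  set Z := Icc (-2 * N : ℤ) (2 * N) with hZ
  have hDσ : ∀ D ∈ Y, ∀ x, 0 ≤ D * σ x ∧ D * σ x ≤ N := by
    intro D hD x
    rw [hY, mem_Icc] at hD
    refine ⟨mul_nonneg (by omega) (hσ0 x), ?_⟩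
    calc D * σ x ≤ (N / M : ℕ) * M := mul_le_mul hD.2 (hσ1 x) (hσ0 x) (by positivity)
      _ ≤ N := by exact_mod_cast Nat.div_mul_le_self N M
  let B : ℤ × ℤ → Set (Fin n → α) := fun p => {x | p.1 + p.2 * σ x ∈ A}
  set Q := (Z ×ˢ Y).filter fun p => δ / 10 ≤ dens (B p) with hQ
  have hQcard : (δ / 2 * N) * (N / M : ℕ) ≤ Q.card := by
    have : ∀ D ∈ Y, δ / 2 * N ≤ ((Z.filter fun z => δ / 10 ≤ dens (B (z, D))).card : ℝ) := by
      intro D hD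
      have h1 : ∑ z ∈ Z, dens (B (z, D)) = A.card := by
        unfold dens
        rw [← expect_sum_comm]
        rw [← expect_const (univ_nonempty (α := Fin n → α)) (A.card : ℝ)]
        refine expect_congr rfl fun x _ => ?_
        have : ∀ z, (B (z, D)).indicator (1 : (Fin n → α) → ℝ) x =
            if z + D * σ x ∈ A then 1 else 0 := by
          intro z
          simp only [Set.indicator, B, Set.mem_ofPred_eq, Pi.one_apply]
        simp only [this]
        rw [sum_boole]
        congr 1
        refine card_bij (fun z _ => z + D * σ x) ?_ ?_ ?_
        · intro z hz
          exact (mem_filter.1 hz).2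
        · intro z _ w _ h
          linarith
        · intro a ha
          refine ⟨a - D * σ x, mem_filter.2 ⟨?_, by simpa using ha⟩, by ring⟩
          have := mem_Icc.1 (hA ha)
          have := hDσ D hD x
          rw [hZ, mem_Icc]
          constructor <;> linarith
      have h2 := card_ge_of_sum Z (fun z => dens (B (z, D))) (fun z _ => dens_le_one _)
        (show 0 ≤ δ / 10 by positivity) (hAc.trans h1.ge)
      refine le_trans ?_ h2
      have hZc : (Z.card : ℝ) ≤ 5 * N := by
        have : Z.card ≤ 5 * N := by
          rw [hZ, Int.card_Icc]
          omega
        exact_mod_cast this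
      nlinarith
    have hYc : Y.card = N / M := by
      rw [hY, Int.card_Icc, add_sub_cancel_right, Int.toNat_natCast]
    have hQs : Q.card = ∑ D ∈ Y, (Z.filter fun z => δ / 10 ≤ dens (B (z, D))).card := by
      simp only [card_filter, hQ]
      rw [sum_product_right]
    rw [hQs, ← hYc]
    push_cast
    rw [mul_comm, ← nsmul_eq_mul, ← sum_const]
    exact sum_le_sum this
  have hx : ∀ p : ℤ × ℤ, ∃ x : Fin n → Option α, p ∈ Q → IsVar x ∧ ∀ a, line x a ∈ B p := by
    intro p
    by_cases hp : p ∈ Q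
    · obtain ⟨x, hx⟩ := hn (Fin n) (by simp) (B p) (mem_filter.1 hp).2
      exact ⟨x, fun _ => hx⟩
    · exact ⟨fun _ => none, fun h => absurd h hp⟩
  choose X hX using hx
  have hQL : Q.card ≤ P.card * L := by
    rw [hL, ← card_univ]
    refine card_le_mul_card_image_of_maps_to (f := X) (fun _ _ => mem_univ _) _ fun x _ => ?_
    let v : ℤ := ∑ i, if x i = none then 1 else 0
    let F : ℤ := σ (line x (e.symm 0))
    have hline : ∀ j, σ (line x (e.symm j)) = F + (j : ℕ) * v := by
      intro j
      simp only [σ, F, v, mul_sum, ← sum_add_distrib, line]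
      refine sum_congr rfl fun i _ => ?_
      rcases x i with _ | a <;> simp
    refine card_le_card_of_injOn (fun p => (p.1 + p.2 * F, p.2 * v)) ?_ ?_
    · intro p hp
      obtain ⟨hpQ, rfl⟩ := mem_filter.1 hp
      have hl := (hX p hpQ).2
      have hpY := mem_product.1 (mem_filter.1 hpQ).1
      have hj : ∀ j : Fin (k + 1), p.1 + p.2 * F + (j : ℕ) * (p.2 * v) ∈ A := by
        intro j
        have : p.1 + p.2 * σ (line (X p) (e.symm j)) ∈ A := hl (e.symm j)
        rw [hline] at this
        convert this using 1
        ring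
      refine mem_filter.2 ⟨mem_product.2 ⟨?_, ?_⟩, hj⟩
      · have := mem_Icc.1 (hA (hj 0))
        simp only [Fin.val_zero, Nat.cast_zero, zero_mul, add_zero] at this
        rw [mem_Icc]
        constructor <;> linarith
      · have hv0 : 0 ≤ v := sum_nonneg fun i _ => by split_ifs <;> norm_num
        have hvn : v ≤ M := by
          calc v ≤ ∑ i : Fin n, (1 : ℤ) := sum_le_sum fun i _ => by split_ifs <;> norm_num
            _ = n := by simp
            _ ≤ M := by rw [hM]; push_cast; nlinarith
        have hD := mem_Icc.1 hpY.2
        have h1 : 0 ≤ p.2 * v := mul_nonneg (by omega) hv0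
        have h2 : p.2 * v ≤ N := by
          calc p.2 * v ≤ (N / M : ℕ) * M := mul_le_mul hD.2 hvn hv0 (by positivity)
            _ ≤ N := by exact_mod_cast Nat.div_mul_le_self N M
        rw [mem_Icc]
        constructor <;> linarith
    · intro p hp q hq h
      obtain ⟨hpQ, hpx⟩ := mem_filter.1 (mem_coe.1 hp)
      obtain ⟨i, hi⟩ := (hX p hpQ).1
      rw [hpx] at hi
      have hv : 0 < v := by
        refine sum_pos' (fun i _ => by split_ifs <;> norm_num) ⟨i, mem_univ i, by simp [hi]⟩
      simp only [Prod.mk.injEq] at h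
      have h2 : p.2 = q.2 := mul_right_cancel₀ hv.ne' h.2
      refine Prod.ext ?_ h2
      have := h.1
      rw [h2] at this
      linarith
  have hfloor : (N : ℝ) ≤ 2 * M * (N / M : ℕ) := by
    have h1 : 1 ≤ N / M := (Nat.one_le_div_iff hM0).2 hN
    have h2 : N < M * (N / M) + M := by
      have := Nat.div_add_mod N M
      have := Nat.mod_lt N hM0
      omega
    have : N ≤ 2 * M * (N / M) := by nlinarith
    exact_mod_cast this
  have hQL' : (Q.card : ℝ) ≤ P.card * L := by exact_mod_cast hQL
  have hMr : (0 : ℝ) < M := by exact_mod_cast hM0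
  have hLr : (0 : ℝ) < L := by exact_mod_cast hL0
  have hNr : (0 : ℝ) < N := by exact_mod_cast hN1
  rw [div_mul_eq_mul_div, div_le_iff₀ (by positivity)]
  calc δ * N ^ 2 = δ * N * N := by ring
    _ ≤ δ * N * (2 * M * (N / M : ℕ)) := by gcongr
    _ = 4 * M * ((δ / 2 * N) * (N / M : ℕ)) := by ring
    _ ≤ 4 * M * (P.card * L) := mul_le_mul_of_nonneg_left (hQcard.trans hQL') (by positivity)
    _ = _ := by ring

/-- **Szemerédi's theorem**, in Varnavides form for bounded functions. -/
theorem szemeredi (k : ℕ) {δ : ℝ} (hδ : 0 < δ) :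
    ∃ c > 0, ∃ N₀ : ℕ, ∀ N : ℕ, N₀ ≤ N → ∀ g : ℤ → ℝ, (∀ z, 0 ≤ g z) → (∀ z, g z ≤ 1) →
      δ * N ≤ ∑ z ∈ Icc (-N : ℤ) N, g z →
      c * N ^ 2 ≤ ∑ p ∈ Icc (-2 * N : ℤ) (2 * N) ×ˢ Icc (-2 * N : ℤ) (2 * N),
        ∏ j : Fin (k + 1), if p.1 + (j : ℕ) * p.2 ∈ Icc (-N : ℤ) N then g (p.1 + (j : ℕ) * p.2) else 0 := by
  classical
  obtain ⟨c, hc, N₀, H⟩ := card_progressions k (show 0 < δ / 2 by positivity)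
  refine ⟨(δ / 6) ^ (k + 1) * c, by positivity, max N₀ 1, fun N hN g hg0 hg1 hg => ?_⟩
  have hN1 : (1 : ℝ) ≤ N := by exact_mod_cast (le_max_right _ _).trans hN
  have h1 := card_ge_of_sum (Icc (-N : ℤ) N) g (fun z _ => hg1 z) (show 0 ≤ δ / 6 by positivity) hg
  have h2 := H N ((le_max_left _ _).trans hN) _
    (filter_subset (fun z => δ / 6 ≤ g z) (Icc (-N : ℤ) N)) (by
      refine le_trans ?_ h1
      have : ((Icc (-N : ℤ) N).card : ℝ) ≤ 3 * N := by
        have : (Icc (-N : ℤ) N).card ≤ 3 * N := by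
          have : 1 ≤ N := by exact_mod_cast hN1
          rw [Int.card_Icc]
          omega
        exact_mod_cast this
      nlinarith)
  rw [mul_assoc]
  refine (mul_le_mul_of_nonneg_left h2 (by positivity)).trans ?_
  rw [mul_comm, ← nsmul_eq_mul, ← sum_const]
  refine le_trans (sum_le_sum fun p hp => ?_)
    (sum_le_sum_of_subset_of_nonneg (filter_subset _ _) fun p _ _ =>
      prod_nonneg fun j _ => by split_ifs; exacts [hg0 _, le_rfl])
  have hp := (mem_filter.1 hp).2
  calc (δ / 6) ^ (k + 1) = ∏ j : Fin (k + 1), δ / 6 := by rw [prod_const, card_univ, Fintype.card_fin]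
    _ ≤ _ := prod_le_prod (fun _ _ => by positivity) fun j _ => by
      have := mem_filter.1 (hp j)
      rw [if_pos this.1]
      exact this.2

end

noncomputable section

variable {J X Y : Type} [Fintype J] [DecidableEq J] [Fintype X] [Nonempty X] [Fintype Y]
  [Nonempty Y]

lemma expect_update (i : J) (F : (J → Y) → ℝ) :
    𝔼 p, 𝔼 q, F (Function.update p i q) = 𝔼 p, F p := by
  let e : (J → Y) × Y ≃ (J → Y) × Y :=
    { toFun := fun z => (Function.update z.1 i z.2, z.1 i)
      invFun := fun z => (Function.update z.1 i z.2, z.1 i)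
      left_inv := fun z => by simp
      right_inv := fun z => by simp }
  have h : 𝔼 z : (J → Y) × Y, F (Function.update z.1 i z.2) = 𝔼 z : (J → Y) × Y, F z.1 :=
    Fintype.expect_equiv e _ _ fun z => rfl
  rw [expect_prod', expect_prod'] at h
  rw [h]
  exact expect_congr rfl fun p _ => expect_const univ_nonempty (F p)

/-- Swap the two entries of the pairs in the coordinates belonging to `ω`. -/
def flip (ω : Finset J) (p : J → X × X) : J → X × X := fun i => if i ∈ ω then (p i).swap else p i

lemma flip_empty (p : J → X × X) : flip ∅ p = p := by
  funext i
  simp [flip]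

lemma flip_flip_singleton {ω : Finset J} {i : J} (h : i ∉ ω) (p : J → X × X) :
    flip ω (flip {i} p) = flip (insert i ω) p := by
  funext l
  by_cases hl : l = i
  · subst hl
    simp [flip, h]
  · simp [flip, hl]

lemma flip_update {ω : Finset J} {i : J} (h : i ∉ ω) (p : J → X × X) (q : X × X) :
    flip ω (Function.update p i q) = Function.update (flip ω p) i q := by
  funext l
  by_cases hl : l = i
  · subst hl
    simp [flip, h]
  · simp [flip, hl]

lemma flip_singleton_update (i : J) (p : J → X × X) (q : X × X) :
    flip {i} (Function.update p i q) = Function.update p i q.swap := by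
  funext l
  by_cases hl : l = i
  · subst hl
    simp [flip]
  · simp [flip, hl]

/-- `F` does not depend on the coordinate `i`. -/
def Indep (i : J) (F : (J → Y) → ℝ) : Prop := ∀ p q, F (Function.update p i q) = F p

/-- `F` does not depend on the second entry of the pair in the coordinate `i`. -/
def Indep₂ (i : J) (F : (J → X × X) → ℝ) : Prop :=
  ∀ p q q', q.1 = q'.1 → F (Function.update p i q) = F (Function.update p i q')

lemma cauchy_schwarz_weighted (U V H : Y → ℝ) (hUV : ∀ p, |U p| ≤ V p) :
    (𝔼 p, U p * H p) ^ 2 ≤ (𝔼 p, V p) * 𝔼 p, V p * H p ^ 2 := by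
  have h0 : ∀ p, 0 ≤ V p := fun p => (abs_nonneg _).trans (hUV p)
  have h1 : |𝔼 p, U p * H p| ≤ 𝔼 p, √(V p) * (√(V p) * |H p|) := by
    refine (abs_expect_le _ _).trans (expect_le_expect fun p _ => ?_)
    rw [← mul_assoc, Real.mul_self_sqrt (h0 p), abs_mul]
    exact mul_le_mul_of_nonneg_right (hUV p) (abs_nonneg _)
  rw [← sq_abs]
  refine (pow_le_pow_left₀ (abs_nonneg _) h1 2).trans
    ((expect_mul_sq_le_sq_mul_sq _ _ _).trans (le_of_eq ?_))
  congr 1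
  · exact expect_congr rfl fun p _ => Real.sq_sqrt (h0 p)
  · exact expect_congr rfl fun p _ => by rw [mul_pow, Real.sq_sqrt (h0 p), sq_abs]

lemma cauchy_schwarz_step (i : J) (U V H : (J → X × X) → ℝ) (hUV : ∀ p, |U p| ≤ V p)
    (hU : Indep i U) (hV : Indep i V) (hH : Indep₂ i H) :
    (𝔼 p, U p * H p) ^ 2 ≤ (𝔼 p, V p) * 𝔼 p, V p * (H p * H (flip {i} p)) := by
  have e1 : 𝔼 p, U p * H p = 𝔼 p, U p * 𝔼 q, H (Function.update p i q) := by
    rw [← expect_update i]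
    refine expect_congr rfl fun p _ => ?_
    rw [mul_expect]
    exact expect_congr rfl fun q _ => by rw [hU]
  have e2 : 𝔼 p, V p * (H p * H (flip {i} p)) =
      𝔼 p, V p * (𝔼 q, H (Function.update p i q)) ^ 2 := by
    rw [← expect_update i]
    refine expect_congr rfl fun p _ => ?_
    simp only [hV p, flip_singleton_update]
    rw [← mul_expect]
    congr 1
    obtain ⟨h, h1⟩ : ∃ h : X → ℝ, ∀ a b, H (Function.update p i (a, b)) = h a :=
      ⟨fun a => H (Function.update p i (a, a)), fun a b => hH p _ _ rfl⟩
    rw [expect_prod', expect_prod']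
    simp only [Prod.swap_prod_mk, h1, expect_const univ_nonempty]
    rw [sq, expect_mul_expect]
  rw [e1, e2]
  exact cauchy_schwarz_weighted U V _ hUV

/-- Iterated Cauchy-Schwarz in the coordinates of `S`. -/
theorem gowers_cauchy_schwarz (S : Finset J) (H : (J → X × X) → ℝ)
    (u v : J → (J → X × X) → ℝ) (hH : ∀ i ∈ S, Indep₂ i H)
    (hu : ∀ i ∈ S, Indep i (u i)) (hv : ∀ i ∈ S, Indep i (v i))
    (hu₂ : ∀ i ∈ S, ∀ l ∈ S, Indep₂ l (u i)) (hv₂ : ∀ i ∈ S, ∀ l ∈ S, Indep₂ l (v i))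
    (huv : ∀ i ∈ S, ∀ p, |u i p| ≤ v i p)
    (hC : ∀ i ∈ S, ∀ R ⊆ S, i ∉ R → 𝔼 p, ∏ ω ∈ R.powerset, v i (flip ω p) ≤ 2) :
    |𝔼 p, H p * ∏ i ∈ S, u i p| ^ 2 ^ S.card ≤ 2 ^ 2 ^ S.card *
      |𝔼 p, (∏ ω ∈ S.powerset, H (flip ω p)) *
        ∏ i ∈ S, ∏ ω ∈ (S.erase i).powerset, v i (flip ω p)| := by
  have key : ∀ R ⊆ S, 2 * |𝔼 p, H p * ∏ i ∈ S, u i p| ^ 2 ^ R.card ≤ 2 ^ 2 ^ R.card *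
      |𝔼 p, (∏ ω ∈ R.powerset, H (flip ω p)) *
        (∏ i ∈ R, ∏ ω ∈ (R.erase i).powerset, v i (flip ω p)) *
        ∏ i ∈ S \ R, ∏ ω ∈ R.powerset, u i (flip ω p)| := by
    intro R
    induction R using Finset.induction_on with
    | empty =>
      intro _
      simp [flip_empty]
    | insert i R hi ih =>
      intro hR
      have hiS : i ∈ S := hR (mem_insert_self _ _)
      have hRS : R ⊆ S := (subset_insert _ _).trans hR
      have hω : ∀ T ⊆ R, ∀ ω ∈ T.powerset, i ∉ ω := fun T hT ω h h' => hi (hT (mem_powerset.1 h h'))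
      let H' : (J → X × X) → ℝ := fun p => (∏ ω ∈ R.powerset, H (flip ω p)) *
        (∏ l ∈ R, ∏ ω ∈ (R.erase l).powerset, v l (flip ω p)) *
        ∏ l ∈ S \ insert i R, ∏ ω ∈ R.powerset, u l (flip ω p)
      have hstep := cauchy_schwarz_step i (fun p => ∏ ω ∈ R.powerset, u i (flip ω p))
        (fun p => ∏ ω ∈ R.powerset, v i (flip ω p)) H'
        (fun p => by
          rw [abs_prod]
          exact prod_le_prod (fun _ _ => abs_nonneg _) fun ω _ => huv i hiS _)
        (fun p q => prod_congr rfl fun ω h => by rw [flip_update (hω R subset_rfl ω h), hu i hiS])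
        (fun p q => prod_congr rfl fun ω h => by rw [flip_update (hω R subset_rfl ω h), hv i hiS])
        (fun p q q' hq => by
          simp only [H']
          congr 1
          · congr 1
            · refine prod_congr rfl fun ω h => ?_
              rw [flip_update (hω R subset_rfl ω h), flip_update (hω R subset_rfl ω h)]
              exact hH i hiS _ _ _ hq
            · refine prod_congr rfl fun l hl => prod_congr rfl fun ω h => ?_
              rw [flip_update (hω _ (erase_subset _ _) ω h),
                flip_update (hω _ (erase_subset _ _) ω h)]
              exact hv₂ l (hRS hl) i hiS _ _ _ hq
          · refine prod_congr rfl fun l hl => prod_congr rfl fun ω h => ?_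
            rw [flip_update (hω R subset_rfl ω h), flip_update (hω R subset_rfl ω h)]
            exact hu₂ l (mem_sdiff.1 hl).1 i hiS _ _ _ hq)
      have e1 : 𝔼 p, (∏ ω ∈ R.powerset, u i (flip ω p)) * H' p =
          𝔼 p, (∏ ω ∈ R.powerset, H (flip ω p)) *
        (∏ i ∈ R, ∏ ω ∈ (R.erase i).powerset, v i (flip ω p)) *
        ∏ i ∈ S \ R, ∏ ω ∈ R.powerset, u i (flip ω p) := by
        refine expect_congr rfl fun p _ => ?_
        have : S \ R = insert i (S \ insert i R) := by
          ext l
          simp only [mem_sdiff, mem_insert]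
          by_cases hl : l = i
          · subst hl; simp [hiS, hi]
          · simp [hl]
        rw [this, prod_insert (by simp)]
        simp only [H']
        ring
      have e2 : 𝔼 p, (∏ ω ∈ R.powerset, v i (flip ω p)) * (H' p * H' (flip {i} p)) =
          𝔼 p, (∏ ω ∈ (insert i R).powerset, H (flip ω p)) *
        (∏ l ∈ insert i R, ∏ ω ∈ ((insert i R).erase l).powerset, v l (flip ω p)) *
        ∏ l ∈ S \ insert i R, ∏ ω ∈ (insert i R).powerset, u l (flip ω p) := by
        refine expect_congr rfl fun p _ => ?_
        rw [prod_insert hi, erase_insert hi, prod_powerset_insert hi]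
        have a1 : ∏ l ∈ R, ∏ ω ∈ ((insert i R).erase l).powerset, v l (flip ω p) =
            (∏ l ∈ R, ∏ ω ∈ (R.erase l).powerset, v l (flip ω p)) *
            ∏ l ∈ R, ∏ ω ∈ (R.erase l).powerset, v l (flip ω (flip {i} p)) := by
          rw [← prod_mul_distrib]
          refine prod_congr rfl fun l hl => ?_
          have hil : i ≠ l := fun h => hi (h ▸ hl)
          rw [erase_insert_of_ne hil, prod_powerset_insert (fun h => hi (mem_of_mem_erase h))]
          congr 1
          exact prod_congr rfl fun ω h => by
            rw [flip_flip_singleton (hω _ (erase_subset _ _) ω h)]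
        have a2 : ∏ l ∈ S \ insert i R, ∏ ω ∈ (insert i R).powerset, u l (flip ω p) =
            (∏ l ∈ S \ insert i R, ∏ ω ∈ R.powerset, u l (flip ω p)) *
            ∏ l ∈ S \ insert i R, ∏ ω ∈ R.powerset, u l (flip ω (flip {i} p)) := by
          rw [← prod_mul_distrib]
          refine prod_congr rfl fun l hl => ?_
          rw [prod_powerset_insert hi]
          congr 1
          exact prod_congr rfl fun ω h => by rw [flip_flip_singleton (hω R subset_rfl ω h)]
        have a3 : ∏ ω ∈ R.powerset, H (flip (insert i ω) p) =
            ∏ ω ∈ R.powerset, H (flip ω (flip {i} p)) :=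
          prod_congr rfl fun ω h => by rw [flip_flip_singleton (hω R subset_rfl ω h)]
        rw [a1, a2, a3]
        simp only [H']
        ring
      rw [e1, e2] at hstep
      have ih := ih hRS
      rw [card_insert_of_notMem hi]
      set A := |𝔼 p, H p * ∏ i ∈ S, u i p| with hA
      have hA0 : 0 ≤ A := abs_nonneg _
      have b1 := pow_le_pow_left₀ (by positivity) ih 2
      rw [mul_pow, mul_pow, sq_abs, ← pow_mul, ← pow_mul, ← pow_succ] at b1
      have b2 := hstep.trans ((mul_le_mul_of_nonneg_left (le_abs_self _)
        (expect_nonneg fun p _ => prod_nonneg fun ω _ =>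
          (abs_nonneg _).trans (huv i hiS _))).trans
        (mul_le_mul_of_nonneg_right (hC i hiS R hRS hi) (abs_nonneg _)))
      have b3 := b1.trans (mul_le_mul_of_nonneg_left b2 (by positivity))
      nlinarith
  have := key S subset_rfl
  simp only [sdiff_self, bot_eq_empty, prod_empty, mul_one] at this
  have h0 : 0 ≤ |𝔼 p, H p * ∏ i ∈ S, u i p| ^ 2 ^ S.card := by positivity
  linarith

end

noncomputable section

variable {J X Y : Type} [Fintype J] [DecidableEq J] [Fintype X] [Nonempty X] [Fintype Y]
  [Nonempty Y]

lemma abs_expect_prod_sub_one_le {κ : Type*} [DecidableEq κ] {K : Finset κ} (hK : K.Nonempty)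
    (F : κ → Y → ℝ) (G : Y → ℝ) {ε : ℝ}
    (h : ∀ T ⊆ K, |𝔼 y, (∏ k ∈ T, F k y) * G y - 1| ≤ ε) :
    |𝔼 y, (∏ k ∈ K, (F k y - 1)) * G y| ≤ 2 ^ K.card * ε := by
  have e1 : 𝔼 y, (∏ k ∈ K, (F k y - 1)) * G y =
      ∑ T ∈ K.powerset, (𝔼 y, (∏ k ∈ T, F k y) * G y) * ∏ k ∈ K \ T, (-1 : ℝ) := by
    rw [← sum_congr rfl fun T _ => (expect_mul _ _ _).symm, ← expect_sum_comm]
    refine expect_congr rfl fun y _ => ?_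
    simp only [sub_eq_add_neg, prod_add]
    rw [sum_mul]
    exact sum_congr rfl fun T _ => by ring
  have e2 : ∑ T ∈ K.powerset, (∏ k ∈ T, (1 : ℝ)) * ∏ k ∈ K \ T, (-1 : ℝ) = 0 := by
    rw [← prod_add]
    simp [hK.ne_empty]
  have e3 : 𝔼 y, (∏ k ∈ K, (F k y - 1)) * G y =
      ∑ T ∈ K.powerset, (𝔼 y, (∏ k ∈ T, F k y) * G y - 1) * ∏ k ∈ K \ T, (-1 : ℝ) := by
    rw [e1, ← sub_zero (∑ T ∈ K.powerset, _), ← e2, ← sum_sub_distrib]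
    exact sum_congr rfl fun T _ => by simp only [prod_const_one]; ring
  have e4 : 2 ^ K.card * ε = ∑ T ∈ K.powerset, ε := by simp [card_powerset]
  rw [e3, e4]
  refine (abs_sum_le_sum_abs _ _).trans (sum_le_sum fun T hT => ?_)
  rw [abs_mul, abs_prod]
  simpa using h T (mem_powerset.1 hT)

/-- The entries of the pairs in `p` selected by `ω`. -/
def proj (ω : Finset J) (p : J → X × X) : J → X := fun i => (flip ω p i).1

lemma proj_flip {ω : Finset J} (p : J → X × X) : proj ∅ (flip ω p) = proj ω p := by
  funext i
  simp [proj, flip]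

lemma proj_singleton_flip {ω : Finset J} {j : J} (h : j ∉ ω) (p : J → X × X) :
    proj {j} (flip ω p) = proj (insert j ω) p := by
  funext i
  by_cases hi : i = j
  · subst hi
    simp [proj, flip, h]
  · simp [proj, flip, hi]

lemma proj_update (ω : Finset J) (i : J) (p : J → X × X) (q : X × X) :
    proj ω (Function.update p i q) =
      Function.update (proj ω p) i (if i ∈ ω then q.2 else q.1) := by
  funext l
  by_cases hl : l = i
  · subst hl
    by_cases h : l ∈ ω <;> simp [proj, flip, h]
  · simp [proj, flip, hl]

lemma Indep.proj {i : J} {F : (J → X) → ℝ} (h : Indep i F) (ω : Finset J) :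
    Indep i fun p : J → X × X => F (proj ω p) := fun p q => by
  simp only [proj_update]
  exact h _ _

lemma indep₂_proj {i : J} (F : (J → X) → ℝ) {ω : Finset J} (h : i ∉ ω) :
    Indep₂ i fun p => F (proj ω p) := fun p q q' hq => by
  simp only [proj_update, if_neg h, hq]

/-- The linear forms condition for the majorant `ν` of a hypergraph system. -/
def LinForms (ν : J → (J → X) → ℝ) (ε : ℝ) : Prop :=
  ∀ E : Finset (J × Finset J), (∀ e ∈ E, e.1 ∉ e.2) →
    |𝔼 p, ∏ e ∈ E, ν e.1 (proj e.2 p) - 1| ≤ ε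

lemma LinForms.ite {ν : J → (J → X) → ℝ} {ε : ℝ} (h : LinForms ν ε) (P : J × Finset J → Prop)
    [DecidablePred P] (E : Finset (J × Finset J)) (hE : ∀ e ∈ E, e.1 ∉ e.2) :
    |𝔼 p, ∏ e ∈ E, (if P e then ν e.1 (GreenTao.proj e.2 p) else 1) - 1| ≤ ε := by
  simp only [← prod_filter]
  exact h _ fun e he => hE e (mem_filter.1 he).1

lemma LinForms.update {ν : J → (J → X) → ℝ} {ε : ℝ} (h : LinForms ν ε) (j : J) :
    LinForms (Function.update ν j 1) ε := fun E hE => by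
  convert h.ite (fun e => e.1 ≠ j) E hE using 6 with p _ e
  by_cases he : e.1 = j
  · rw [he]; simp
  · simp [he]

/-- The strong linear forms estimate. -/
theorem strong_linear_forms {ν : J → (J → X) → ℝ} {ε : ℝ} (hε : ε ≤ 1) (hν : LinForms ν ε)
    (hind : ∀ i, Indep i (ν i)) (j : J) (A B : Finset J)
    (a b : J → (J → X) → ℝ) (hai : ∀ i, Indep i (a i)) (hbi : ∀ i, Indep i (b i))
    (ha : ∀ i x, |a i x| ≤ if i ∈ A then ν i x else 1)
    (hb : ∀ i x, |b i x| ≤ if i ∈ B then ν i x else 1) :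
    |𝔼 p, (ν j (proj ∅ p) - 1) * ∏ i ∈ univ.erase j, (a i (proj ∅ p) * b i (proj {j} p))|
      ^ 2 ^ (Fintype.card J - 1) ≤ 4 ^ 2 ^ (Fintype.card J - 1) * ε := by
  set S := univ.erase j with hS
  have hcard : S.card = Fintype.card J - 1 := by rw [hS, card_erase_of_mem (mem_univ j), card_univ]
  have hjS : j ∉ S := by simp [hS]
  have hne : ∀ {i}, i ∈ S → i ≠ j := fun h => ne_of_mem_erase h
  let P : J × Finset J → Prop := fun e => if j ∈ e.2 then e.1 ∈ B else e.1 ∈ A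
  let v : J → (J → X × X) → ℝ := fun i p =>
    (if i ∈ A then ν i (proj ∅ p) else 1) * (if i ∈ B then ν i (proj {j} p) else 1)
  have hite : ∀ (s : Finset J) i, Indep i fun x => if i ∈ s then ν i x else 1 := by
    intro s i x y
    simp only
    split_ifs
    exacts [hind i x y, rfl]
  have hvprod : ∀ i, ∀ R ⊆ S, ∀ p, ∏ ω ∈ R.powerset, v i (flip ω p) =
      ∏ ω ∈ (insert j R).powerset, if P (i, ω) then ν i (proj ω p) else 1 := by
    intro i R hR p
    have hjR : j ∉ R := fun h => hjS (hR h)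
    rw [prod_powerset_insert hjR, ← prod_mul_distrib]
    refine prod_congr rfl fun ω hω => ?_
    have hjω : j ∉ ω := fun h => hjR (mem_powerset.1 hω h)
    simp only [v, P, proj_flip, proj_singleton_flip hjω, if_neg hjω,
      if_pos (mem_insert_self j ω)]
  have main := gowers_cauchy_schwarz S (fun p => ν j (proj ∅ p) - 1)
    (fun i p => a i (proj ∅ p) * b i (proj {j} p)) v
    (fun i _ p q q' hq => by
      have := indep₂_proj (ν j) (notMem_empty i) p q q' hq
      simp only at this ⊢
      rw [this])
    (fun i _ p q => by
      have h1 := (hai i).proj ∅ p q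
      have h2 := (hbi i).proj {j} p q
      simp only at h1 h2 ⊢
      rw [h1, h2])
    (fun i _ p q => by
      have h1 := (hite A i).proj ∅ p q
      have h2 := (hite B i).proj {j} p q
      simp only at h1 h2
      simp only [v]
      rw [h1, h2])
    (fun i _ l hl p q q' hq => by
      have h1 := indep₂_proj (a i) (notMem_empty l) p q q' hq
      have h2 := indep₂_proj (b i) (by simpa using hne hl : l ∉ ({j} : Finset J)) p q q' hq
      simp only at h1 h2 ⊢
      rw [h1, h2])
    (fun i _ l hl p q q' hq => by
      have h1 := indep₂_proj (fun x => if i ∈ A then ν i x else 1) (notMem_empty l) p q q' hq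
      have h2 := indep₂_proj (fun x => if i ∈ B then ν i x else 1)
        (by simpa using hne hl : l ∉ ({j} : Finset J)) p q q' hq
      simp only at h1 h2
      simp only [v]
      rw [h1, h2])
    (fun i _ p => by
      rw [abs_mul]
      exact mul_le_mul (ha i _) (hb i _) (abs_nonneg _) ((abs_nonneg _).trans (ha i _)))
    (fun i hi R hR hiR => by
      simp only [hvprod i R hR]
      have := hν.ite P ((insert j R).powerset.image fun ω => (i, ω)) (by
        intro e he
        obtain ⟨ω, hω, rfl⟩ := mem_image.1 he
        intro h
        rcases mem_insert.1 (mem_powerset.1 hω h) with h | h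
        exacts [hne hi h, hiR h])
      simp only [prod_image (s := (insert j R).powerset) (g := fun ω => (i, ω))
        (fun _ _ _ _ h => (Prod.mk.inj h).2)] at this
      have := (abs_le.1 this).2
      linarith)
  rw [hcard] at main
  refine main.trans ?_
  have hS0 : S.powerset.Nonempty := ⟨∅, empty_mem_powerset _⟩
  have h2 := abs_expect_prod_sub_one_le hS0 (fun ω p => ν j (proj ω p))
    (fun p => ∏ i ∈ S, ∏ ω ∈ (S.erase i).powerset, v i (flip ω p)) (ε := ε) (by
      intro T hT
      let E₁ : Finset (J × Finset J) := T.image fun ω => (j, ω)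
      let E₂ : Finset (J × Finset J) := univ.filter fun e => e.1 ∈ S ∧
        e.2 ∈ (insert j (S.erase e.1)).powerset
      have hdisj : Disjoint E₁ E₂ := by
        rw [disjoint_left]
        intro e he he'
        obtain ⟨ω, hω, rfl⟩ := mem_image.1 he
        exact hjS (mem_filter.1 he').2.1
      have h1 : ∀ e ∈ E₁, e.1 ∉ e.2 := by
        intro e he
        obtain ⟨ω, hω, rfl⟩ := mem_image.1 he
        exact fun h => hjS (mem_powerset.1 (hT hω) h)
      have h2 : ∀ e ∈ E₂, e.1 ∉ e.2 := by
        intro e he h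
        obtain ⟨he1, he2⟩ := (mem_filter.1 he).2
        rcases mem_insert.1 (mem_powerset.1 he2 h) with h | h
        · exact hne he1 h
        · simp at h
      have := hν.ite (fun e => e.1 = j ∨ P e) (E₁ ∪ E₂) (by
        intro e he
        rcases mem_union.1 he with h | h
        exacts [h1 e h, h2 e h])
      convert this using 5 with p
      rw [prod_union hdisj]
      congr 1
      · rw [prod_image (fun _ _ _ _ h => (Prod.mk.inj h).2)]
        simp
      · rw [prod_finset_product' (f := fun i ω => if i = j ∨ P (i, ω) then ν i (proj ω p) else 1)
          E₂ S (fun i => (insert j (S.erase i)).powerset) (by simp [E₂])]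
        refine prod_congr rfl fun i hi => ?_
        rw [hvprod i _ (erase_subset _ _)]
        simp [hne hi])
  simp only [proj_flip]
  rw [card_powerset, hcard] at h2
  refine (mul_le_mul_of_nonneg_left h2 (by positivity)).trans (le_of_eq ?_)
  rw [← mul_assoc, ← mul_pow]
  norm_num

end

noncomputable section

variable {J X Y : Type} [Fintype J] [DecidableEq J] [Fintype X] [Nonempty X] [Fintype Y]
  [Nonempty Y]

lemma expect_eval (j : J) (G : Y → ℝ) : 𝔼 y : J → Y, G (y j) = 𝔼 s, G s := by
  rw [← expect_update j]
  simp only [Function.update_self]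
  exact expect_const univ_nonempty _

lemma expect_proj_empty (F : (J → X) → ℝ) : 𝔼 p, F (proj ∅ p) = 𝔼 x, F x := by
  have h : 𝔼 p : J → X × X, F (proj ∅ p) = 𝔼 z : (J → X) × (J → X), F z.1 :=
    Fintype.expect_equiv (Equiv.arrowProdEquivProdArrow J (fun _ => X) (fun _ => X)) _ _
      fun p => by
        congr 1
  rw [h, expect_prod']
  exact expect_congr rfl fun x _ => expect_const univ_nonempty (F x)

lemma expect_proj_pair (j : J) (F : (J → X) → (J → X) → ℝ) :
    𝔼 p, F (proj ∅ p) (proj {j} p) = 𝔼 x, 𝔼 s, F x (Function.update x j s) := by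
  have h : 𝔼 p : J → X × X, F (proj ∅ p) (proj {j} p) =
      𝔼 z : (J → X) × (J → X), F z.1 (Function.update z.1 j (z.2 j)) :=
    Fintype.expect_equiv (Equiv.arrowProdEquivProdArrow J (fun _ => X) (fun _ => X)) _ _
      fun p => by
        congr 1
        funext i
        by_cases hi : i = j
        · subst hi
          simp [proj, flip]
        · simp [proj, flip, hi]
  rw [h, expect_prod']
  exact expect_congr rfl fun x _ => expect_eval j fun s => F x (Function.update x j s)

/-- The average over the coordinate `j`. -/
def avg (j : J) (F : (J → X) → ℝ) (x : J → X) : ℝ := 𝔼 s, F (Function.update x j s)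

lemma indep_avg (j : J) (F : (J → X) → ℝ) : Indep j (avg j F) := fun x s => by
  simp [avg, Function.update_idem]

lemma expect_mul_avg (j : J) {G : (J → X) → ℝ} (hG : Indep j G) (F : (J → X) → ℝ) :
    𝔼 x, G x * avg j F x = 𝔼 x, G x * F x := by
  rw [← expect_update j fun x => G x * F x]
  refine expect_congr rfl fun x _ => ?_
  simp only [avg, mul_expect, hG x]

lemma expect_mul_avg_mul_avg (j : J) {V : (J → X) → ℝ} (hV : Indep j V) (F G : (J → X) → ℝ) :
    𝔼 x, V x * (avg j F x * avg j G x) = 𝔼 p, V (proj ∅ p) * (F (proj ∅ p) * G (proj {j} p)) := by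
  rw [expect_proj_pair j fun x y => V x * (F x * G y)]
  have h1 : Indep j fun x => V x * avg j G x := fun x s => by
    simp only [hV x s, indep_avg j G x s]
  have h2 := expect_mul_avg j h1 F
  calc 𝔼 x, V x * (avg j F x * avg j G x) = 𝔼 x, V x * avg j G x * avg j F x :=
        expect_congr rfl fun x _ => by ring
    _ = _ := by
      rw [h2]
      refine expect_congr rfl fun x _ => ?_
      simp only [avg, mul_expect, expect_mul]
      exact expect_congr rfl fun s _ => by ring

lemma abs_expect_le_of_sq {κ : ℝ} (hκ : 0 ≤ κ) {F : Y → ℝ} (h : 𝔼 y, F y ^ 2 ≤ κ ^ 2) :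
    𝔼 y, |F y| ≤ κ := by
  have := cauchy_schwarz_weighted (fun _ : Y => (1 : ℝ)) (fun _ => 1) (fun y => |F y|)
    (fun _ => by simp)
  simp only [one_mul, sq_abs, expect_const univ_nonempty] at this
  exact le_of_sq_le_sq (this.trans h) hκ
where
  le_of_sq_le_sq {a b : ℝ} (h : a ^ 2 ≤ b ^ 2) (hb : 0 ≤ b) : a ≤ b := by nlinarith [sq_nonneg (a - b)]

/-- Two hypergraph systems are close in the cut norm. -/
def CutClose (f g : J → (J → X) → ℝ) (ε : ℝ) : Prop :=
  ∀ j, ∀ u : J → (J → X) → ℝ, (∀ i, Indep i (u i)) → (∀ i x, 0 ≤ u i x) → (∀ i x, u i x ≤ 1) →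
    |𝔼 x, (f j x - g j x) * ∏ i ∈ univ.erase j, u i x| ≤ ε

lemma counting_bounded {f g : J → (J → X) → ℝ} {ε : ℝ} (hfi : ∀ i, Indep i (f i))
    (hgi : ∀ i, Indep i (g i)) (hf0 : ∀ i x, 0 ≤ f i x) (hf1 : ∀ i x, f i x ≤ 1)
    (hg0 : ∀ i x, 0 ≤ g i x) (hg1 : ∀ i x, g i x ≤ 1) (h : CutClose f g ε) :
    |𝔼 x, ∏ i, f i x - 𝔼 x, ∏ i, g i x| ≤ Fintype.card J * ε := by
  have key : ∀ R : Finset J, |𝔼 x, ∏ i, f i x - 𝔼 x, ∏ i, (if i ∈ R then g i x else f i x)| ≤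
      R.card * ε := by
    intro R
    induction R using Finset.induction_on with
    | empty => simp
    | insert j R hj ih =>
      have := h j (fun i x => if i ∈ R then g i x else f i x)
        (fun i x s => by simp only; split_ifs; exacts [hgi i x s, hfi i x s])
        (fun i x => by split_ifs; exacts [hg0 i x, hf0 i x])
        (fun i x => by split_ifs; exacts [hg1 i x, hf1 i x])
      have e : 𝔼 x, (f j x - g j x) * ∏ i ∈ univ.erase j, (if i ∈ R then g i x else f i x) =
          𝔼 x, ∏ i, (if i ∈ R then g i x else f i x) -
          𝔼 x, ∏ i, (if i ∈ insert j R then g i x else f i x) := by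
        rw [← expect_sub_distrib]
        refine expect_congr rfl fun x _ => ?_
        rw [← mul_prod_erase _ _ (mem_univ j), ← mul_prod_erase _ _ (mem_univ j), if_neg hj,
          if_pos (mem_insert_self _ _), sub_mul]
        congr 2
        refine prod_congr rfl fun i hi => ?_
        simp [ne_of_mem_erase hi]
      rw [e] at this
      rw [card_insert_of_notMem hj]
      push_cast
      have := abs_add_le (𝔼 x, ∏ i, f i x - 𝔼 x, ∏ i, (if i ∈ R then g i x else f i x))
        (𝔼 x, ∏ i, (if i ∈ R then g i x else f i x) -
          𝔼 x, ∏ i, (if i ∈ insert j R then g i x else f i x))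
      rw [sub_add_sub_cancel] at this
      linarith
  simpa using key univ

lemma LinForms.expect_le {ν : J → (J → X) → ℝ} {ε : ℝ} (hν : LinForms ν ε) (j : J) :
    𝔼 x, ν j x ≤ 1 + ε := by
  have := (abs_le.1 (hν {(j, ∅)} (by simp))).2
  simp only [prod_singleton] at this
  rw [expect_proj_empty (ν j)] at this
  linarith

lemma LinForms.expect_avg_sub_one_sq {ν : J → (J → X) → ℝ} {ε : ℝ} (hν : LinForms ν ε) (j : J) :
    𝔼 x, (avg j (fun x => ∏ i ∈ univ.erase j, ν i x) x - 1) ^ 2 ≤ 3 * ε := by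
  set F : (J → X) → ℝ := fun x => ∏ i ∈ univ.erase j, ν i x with hF
  have h1 : 1 - ε ≤ 𝔼 x, avg j F x := by
    have := (abs_le.1 (hν ((univ.erase j).image fun i => (i, ∅)) (by simp))).1
    simp only [prod_image (s := univ.erase j) (g := fun i => (i, (∅ : Finset J)))
      (fun _ _ _ _ h => (Prod.mk.inj h).1)] at this
    rw [expect_proj_empty F] at this
    have h2 := expect_mul_avg (G := fun _ => 1) j (fun _ _ => rfl) F
    simp only [one_mul] at h2
    linarith
  have h2 : 𝔼 x, avg j F x * avg j F x ≤ 1 + ε := by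
    have hinj : ∀ ω : Finset J, Set.InjOn (fun i : J => (i, ω)) (univ.erase j : Finset J) :=
      fun ω _ _ _ _ h => (Prod.mk.inj h).1
    have := (abs_le.1 (hν ((univ.erase j).image (fun i => (i, ∅)) ∪
      (univ.erase j).image (fun i => (i, {j}))) (by
        intro e he
        simp only [mem_union, mem_image, mem_erase, mem_univ, and_true] at he
        rcases he with ⟨i, hi, rfl⟩ | ⟨i, hi, rfl⟩
        · simp
        · simpa using hi))).2
    rw [expect_congr rfl fun p _ => prod_union (by
      rw [disjoint_left]
      intro e he he'
      obtain ⟨i, hi, rfl⟩ := mem_image.1 he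
      obtain ⟨i', hi', h⟩ := mem_image.1 he'
      simp at h)] at this
    simp only [prod_image (hinj _)] at this
    have h3 := expect_mul_avg_mul_avg (V := fun _ => 1) j (fun _ _ => rfl) F F
    simp only [one_mul] at h3
    rw [h3]
    linarith
  have h3 : 𝔼 x, (avg j F x - 1) ^ 2 = 𝔼 x, avg j F x * avg j F x - 2 * 𝔼 x, avg j F x + 1 := by
    rw [mul_expect, ← expect_const (univ_nonempty (α := J → X)) (1 : ℝ), ← expect_sub_distrib,
      ← expect_add_distrib]
    refine expect_congr rfl fun x _ => ?_
    rw [expect_const univ_nonempty]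
    ring
  rw [h3]
  linarith

end

noncomputable section

variable {J X Y : Type} [Fintype J] [DecidableEq J] [Fintype X] [Nonempty X] [Fintype Y]
  [Nonempty Y]

lemma expect_prod_eq_mul_avg (j : J) {f : J → (J → X) → ℝ} (hf : Indep j (f j)) :
    𝔼 x, ∏ i, f i x = 𝔼 x, f j x * avg j (fun x => ∏ i ∈ univ.erase j, f i x) x := by
  rw [expect_mul_avg j hf]
  exact expect_congr rfl fun x _ => (mul_prod_erase _ _ (mem_univ j)).symm

lemma avg_nonneg {j : J} {F : (J → X) → ℝ} (h : ∀ x, 0 ≤ F x) (x : J → X) : 0 ≤ avg j F x :=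
  expect_nonneg fun _ _ => h _

lemma avg_mono {j : J} {F G : (J → X) → ℝ} (h : ∀ x, F x ≤ G x) (x : J → X) :
    avg j F x ≤ avg j G x :=
  expect_le_expect fun _ _ => h _

lemma avg_le_one {j : J} {F : (J → X) → ℝ} (h : ∀ x, F x ≤ 1) (x : J → X) : avg j F x ≤ 1 :=
  expect_le_of_le zero_le_one fun _ => h _

lemma prod_update_erase (j : J) (f : J → (J → X) → ℝ) (F : (J → X) → ℝ) (x : J → X) :
    ∏ i, Function.update f j F i x = F x * ∏ i ∈ univ.erase j, f i x := by
  rw [← mul_prod_erase _ _ (mem_univ j), Function.update_self]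
  congr 1
  exact prod_congr rfl fun i hi => by rw [Function.update_of_ne (ne_of_mem_erase hi)]

lemma CutClose.update {f g : J → (J → X) → ℝ} {ε : ℝ} (h : CutClose f g ε) (hε : 0 ≤ ε) (j : J)
    (F : (J → X) → ℝ) : CutClose (Function.update f j F) (Function.update g j F) ε := by
  intro i u h1 h2 h3
  by_cases hi : i = j
  · subst hi
    simpa using hε
  · simpa [hi] using h i u h1 h2 h3

lemma error_bound {ν : J → (J → X) → ℝ} {ε κ : ℝ} (hκ : 0 ≤ κ) (hε : ε ≤ 1)
    (hεκ : ε ≤ (κ / 4) ^ 2 ^ (Fintype.card J - 1)) (hν : LinForms ν ε)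
    (hind : ∀ i, Indep i (ν i)) (j : J) (A B : Finset J)
    (a b : J → (J → X) → ℝ) (hai : ∀ i, Indep i (a i)) (hbi : ∀ i, Indep i (b i))
    (ha : ∀ i x, |a i x| ≤ if i ∈ A then ν i x else 1)
    (hb : ∀ i x, |b i x| ≤ if i ∈ B then ν i x else 1) :
    |𝔼 x, (ν j x - 1) * (avg j (fun x => ∏ i ∈ univ.erase j, a i x) x *
      avg j (fun x => ∏ i ∈ univ.erase j, b i x) x)| ≤ κ := by
  rw [expect_mul_avg_mul_avg j (V := fun x => ν j x - 1) (fun x q => by simp only [hind j x q])]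
  have := strong_linear_forms hε hν hind j A B a b hai hbi ha hb
  simp only [prod_mul_distrib] at this
  refine (pow_le_pow_iff_left₀ (abs_nonneg _) hκ (by positivity)).1 (this.trans ?_)
  calc _ ≤ (4 : ℝ) ^ 2 ^ (Fintype.card J - 1) * (κ / 4) ^ 2 ^ (Fintype.card J - 1) :=
        mul_le_mul_of_nonneg_left hεκ (by positivity)
    _ = _ := by
      rw [← mul_pow]
      congr 1
      ring

/-- The relative counting lemma of Conlon, Fox and Zhao. -/
theorem counting (J : Type) [Fintype J] [DecidableEq J] (T : Finset J) :
    ∀ η > 0, ∃ ε > 0, ∀ (X : Type) [Fintype X] [Nonempty X] (ν f g : J → (J → X) → ℝ),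
      (∀ i x, 0 ≤ ν i x) → LinForms ν ε → (∀ i, Indep i (ν i)) → (∀ i, Indep i (f i)) →
      (∀ i, Indep i (g i)) → (∀ i x, 0 ≤ f i x) → (∀ i x, f i x ≤ ν i x) →
      (∀ i x, 0 ≤ g i x) → (∀ i x, g i x ≤ 1) → (∀ i ∉ T, ∀ x, ν i x = 1) → CutClose f g ε →
      |𝔼 x, ∏ i, f i x - 𝔼 x, ∏ i, g i x| ≤ η := by
  induction T using Finset.induction_on with
  | empty =>
    intro η hη
    refine ⟨η / (Fintype.card J + 1), by positivity,
      fun X _ _ ν f g _ _ _ hfi hgi hf0 hfν hg0 hg1 hν1 hcut => ?_⟩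
    refine (counting_bounded hfi hgi hf0
      (fun i x => (hfν i x).trans (hν1 i (notMem_empty i) x).le) hg0 hg1 hcut).trans ?_
    rw [mul_div_assoc', div_le_iff₀ (by positivity)]
    nlinarith
  | insert j T hj ih =>
    intro η hη
    set κ := min 1 ((η / 2) ^ 2 / 24) with hκ
    have hκ0 : 0 < κ := by positivity
    have hκ1 : κ ≤ 1 := min_le_left _ _
    have hκη : 24 * κ ≤ (η / 2) ^ 2 := by
      have := min_le_right 1 ((η / 2) ^ 2 / 24)
      linarith
    obtain ⟨ε₀, hε₀, H⟩ := ih κ hκ0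
    set ε := min (min 1 ε₀) (min (κ ^ 2 / 3) (min (η / 2) ((κ / 4) ^ 2 ^ (Fintype.card J - 1))))
      with hε
    have hε0 : 0 < ε := by positivity
    have hεa : ε ≤ 1 := (min_le_left _ _).trans (min_le_left _ _)
    have hεb : ε ≤ ε₀ := (min_le_left _ _).trans (min_le_right _ _)
    have hεc : ε ≤ κ ^ 2 / 3 := (min_le_right _ _).trans (min_le_left _ _)
    have hεd : ε ≤ η / 2 := (min_le_right _ _).trans ((min_le_right _ _).trans (min_le_left _ _))
    have hεe : ε ≤ (κ / 4) ^ 2 ^ (Fintype.card J - 1) :=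
      (min_le_right _ _).trans ((min_le_right _ _).trans (min_le_right _ _))
    refine ⟨ε, hε0, fun X _ _ ν f g hν0 hν hνi hfi hgi hf0 hfν hg0 hg1 hν1 hcut => ?_⟩
    set F : (J → X) → ℝ := avg j fun x => ∏ i ∈ univ.erase j, f i x with hF
    set G : (J → X) → ℝ := avg j fun x => ∏ i ∈ univ.erase j, g i x with hG
    set N : (J → X) → ℝ := avg j fun x => ∏ i ∈ univ.erase j, ν i x with hN
    have hF0 : ∀ x, 0 ≤ F x := avg_nonneg fun x => prod_nonneg fun i _ => hf0 i x
    have hFN : ∀ x, F x ≤ N x := avg_mono fun x => prod_le_prod (fun i _ => hf0 i x) fun i _ => hfν i x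
    have hG0 : ∀ x, 0 ≤ G x := avg_nonneg fun x => prod_nonneg fun i _ => hg0 i x
    have hG1 : ∀ x, G x ≤ 1 := avg_le_one fun x => prod_le_one (fun i _ => hg0 i x) fun i _ => hg1 i x
    have hFi : Indep j F := indep_avg j _
    have hGi : Indep j G := indep_avg j _
    set F' : (J → X) → ℝ := fun x => min (F x) 1 with hF'
    have hF'0 : ∀ x, 0 ≤ F' x := fun x => le_min (hF0 x) zero_le_one
    have hF'1 : ∀ x, F' x ≤ 1 := fun x => min_le_right _ _
    have hF'i : Indep j F' := fun x q => by simp only [hF', hFi x q]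
    have t1 : 𝔼 x, (F x - F' x) ^ 2 ≤ κ ^ 2 := by
      refine le_trans (expect_le_expect fun x _ => ?_)
        ((hν.expect_avg_sub_one_sq j).trans (by linarith))
      rw [← hN]
      simp only [hF']
      rcases le_total (F x) 1 with h | h
      · rw [min_eq_left h]
        nlinarith [sq_nonneg (N x - 1)]
      · rw [min_eq_right h]
        have := hFN x
        nlinarith
    have t2 : 𝔼 x, |F x - F' x| ≤ κ := abs_expect_le_of_sq hκ0.le t1
    have hbd : ∀ D : (J → X) → ℝ, Indep j D → (∀ x, 0 ≤ D x) → (∀ x, D x ≤ 1) →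
        |𝔼 x, D x * (F x - G x)| ≤ κ := by
      intro D hDi hD0 hD1
      have := H X (Function.update ν j 1) (Function.update f j D) (Function.update g j D)
        (fun i x => by
          by_cases hi : i = j
          · subst hi; simp
          · simpa [hi] using hν0 i x)
        (fun E hE => (hν.update j E hE).trans hεb)
        (fun i => by
          by_cases hi : i = j
          · subst hi; rw [Function.update_self]; exact fun _ _ => rfl
          · simpa [hi] using hνi i)
        (fun i => by
          by_cases hi : i = j
          · subst hi; simpa using hDi
          · simpa [hi] using hfi i)
        (fun i => by
          by_cases hi : i = j
          · subst hi; simpa using hDi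
          · simpa [hi] using hgi i)
        (fun i x => by
          by_cases hi : i = j
          · subst hi; simpa using hD0 x
          · simpa [hi] using hf0 i x)
        (fun i x => by
          by_cases hi : i = j
          · subst hi; simpa using hD1 x
          · simpa [hi] using hfν i x)
        (fun i x => by
          by_cases hi : i = j
          · subst hi; simpa using hD0 x
          · simpa [hi] using hg0 i x)
        (fun i x => by
          by_cases hi : i = j
          · subst hi; simpa using hD1 x
          · simpa [hi] using hg1 i x)
        (fun i hiT x => by
          by_cases hi : i = j
          · subst hi; simp
          · simpa [hi] using hν1 i (by simp [hi, hiT]) x)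
        (fun i u h1 h2 h3 => (hcut.update hε0.le j D i u h1 h2 h3).trans hεb)
      simp only [prod_update_erase] at this
      rw [← expect_mul_avg j hDi (fun x => ∏ i ∈ univ.erase j, f i x),
        ← expect_mul_avg j hDi (fun x => ∏ i ∈ univ.erase j, g i x), ← expect_sub_distrib] at this
      simpa only [mul_sub] using this
    have t3 : 𝔼 x, (F' x - G x) ^ 2 ≤ 3 * κ := by
      have e : 𝔼 x, (F' x - G x) ^ 2 = 𝔼 x, F' x * (F x - G x) - 𝔼 x, G x * (F x - G x) +
          𝔼 x, (F' x - G x) * (F' x - F x) := by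
        rw [← expect_sub_distrib, ← expect_add_distrib]
        exact expect_congr rfl fun x _ => by ring
      have b1 := (abs_le.1 (hbd F' hF'i hF'0 hF'1)).2
      have b2 := (abs_le.1 (hbd G hGi hG0 hG1)).1
      have b3 : 𝔼 x, (F' x - G x) * (F' x - F x) ≤ κ := by
        refine le_trans (expect_le_expect fun x _ => ?_) t2
        rw [abs_sub_comm]
        refine (le_abs_self _).trans ?_
        rw [abs_mul]
        refine mul_le_of_le_one_left (abs_nonneg _) ?_
        rw [abs_le]
        constructor <;> linarith [hF'0 x, hF'1 x, hG0 x, hG1 x]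
      rw [e]
      linarith
    have t4 : 𝔼 x, (F x - G x) ^ 2 ≤ 8 * κ := by
      have : 𝔼 x, (F x - G x) ^ 2 ≤ 𝔼 x, (2 * (F x - F' x) ^ 2 + 2 * (F' x - G x) ^ 2) :=
        expect_le_expect fun x _ => by nlinarith [sq_nonneg (F x - F' x - (F' x - G x))]
      rw [expect_add_distrib, ← mul_expect, ← mul_expect] at this
      nlinarith
    have t5 : 𝔼 x, ν j x * (F x - G x) ^ 2 ≤ 12 * κ := by
      have hf : ∀ i x, |f i x| ≤ if i ∈ (univ : Finset J) then ν i x else 1 := fun i x => by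
        rw [abs_of_nonneg (hf0 i x), if_pos (mem_univ i)]
        exact hfν i x
      have hg : ∀ i x, |g i x| ≤ if i ∈ (∅ : Finset J) then ν i x else 1 := fun i x => by
        rw [abs_of_nonneg (hg0 i x), if_neg (notMem_empty i)]
        exact hg1 i x
      have c1 := error_bound hκ0.le hεa hεe hν hνi j _ _ f f hfi hfi hf hf
      have c2 := error_bound hκ0.le hεa hεe hν hνi j _ _ f g hfi hgi hf hg
      have c3 := error_bound hκ0.le hεa hεe hν hνi j _ _ g g hgi hgi hg hg
      rw [← hF] at c1
      rw [← hF, ← hG] at c2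
      rw [← hG] at c3
      have e : 𝔼 x, ν j x * (F x - G x) ^ 2 = 𝔼 x, (F x - G x) ^ 2 +
          𝔼 x, (ν j x - 1) * (F x * F x) - 2 * 𝔼 x, (ν j x - 1) * (F x * G x) +
          𝔼 x, (ν j x - 1) * (G x * G x) := by
        rw [mul_expect, ← expect_add_distrib, ← expect_sub_distrib, ← expect_add_distrib]
        exact expect_congr rfl fun x _ => by ring
      rw [e]
      linarith [(abs_le.1 c1).2, (abs_le.1 c2).1, (abs_le.1 c3).2]
    have t6 : |𝔼 x, f j x * (F x - G x)| ≤ η / 2 := by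
      have := cauchy_schwarz_weighted (f j) (ν j) (fun x => F x - G x) (fun x => by
        rw [abs_of_nonneg (hf0 j x)]
        exact hfν j x)
      refine abs_expect_le_of_sq.le_of_sq_le_sq ?_ (by positivity)
      rw [sq_abs]
      refine this.trans (le_trans (mul_le_mul ((hν.expect_le j).trans (by linarith : _ ≤ (2 : ℝ))) t5
        (expect_nonneg fun x _ => mul_nonneg (hν0 j x) (sq_nonneg _)) (by norm_num)) ?_)
      linarith
    have t7 : |𝔼 x, (f j x - g j x) * G x| ≤ η / 2 := by
      have hi : Indep j fun x => f j x - g j x := fun x q => by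
        simp only [hfi j x q, hgi j x q]
      rw [hG, expect_mul_avg j hi]
      exact (hcut j g hgi hg0 hg1).trans hεd
    rw [expect_prod_eq_mul_avg j (hfi j), expect_prod_eq_mul_avg j (hgi j), ← hF, ← hG]
    have e : 𝔼 x, f j x * F x - 𝔼 x, g j x * G x =
        𝔼 x, f j x * (F x - G x) + 𝔼 x, (f j x - g j x) * G x := by
      rw [← expect_sub_distrib, ← expect_add_distrib]
      exact expect_congr rfl fun x _ => by ring
    rw [e]
    linarith [abs_add_le (𝔼 x, f j x * (F x - G x)) (𝔼 x, (f j x - g j x) * G x)]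

end

noncomputable section

section DenseModel

variable {Z : Type} [Fintype Z] [Nonempty Z]

lemma convex_abs_expect_mul_le (h : Z → ℝ) (ε : ℝ) :
    Convex ℝ {ψ : Z → ℝ | |𝔼 z, h z * ψ z| ≤ ε} := by
  intro x hx y hy a b ha hb hab
  simp only [Set.mem_ofPred_eq] at hx hy ⊢
  have e : 𝔼 z, h z * (a • x + b • y) z = a * 𝔼 z, h z * x z + b * 𝔼 z, h z * y z := by
    simp only [mul_expect, ← expect_add_distrib]
    refine expect_congr rfl fun z _ => ?_
    simp only [Pi.add_apply, Pi.smul_apply, smul_eq_mul]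
    ring
  rw [e]
  refine (abs_add_le _ _).trans ?_
  rw [abs_mul, abs_mul, abs_of_nonneg ha, abs_of_nonneg hb]
  calc a * |𝔼 z, h z * x z| + b * |𝔼 z, h z * y z| ≤ a * ε + b * ε := by gcongr
    _ = ε := by rw [← add_mul, hab, one_mul]

lemma abs_expect_mul_pow_le {Φ : Set (Z → ℝ)} {h : Z → ℝ} {ε : ℝ} {n : ℕ}
    (H : ∀ l : List (Z → ℝ), (∀ φ ∈ l, φ ∈ Φ) → l.length ≤ n → |𝔼 z, h z * l.prod z| ≤ ε)
    {φ : Z → ℝ} (hφ : φ ∈ convexHull ℝ (Φ ∪ -Φ)) (b : ℕ) :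
    ∀ l : List (Z → ℝ), (∀ φ ∈ l, φ ∈ Φ) → b + l.length ≤ n →
      |𝔼 z, h z * (φ z ^ b * l.prod z)| ≤ ε := by
  induction b with
  | zero => exact fun l h1 h2 => by simpa using H l h1 (by omega)
  | succ b ih =>
    intro l h1 h2
    have key : convexHull ℝ (Φ ∪ -Φ) ⊆
        {ψ : Z → ℝ | |𝔼 z, (h z * (φ z ^ b * l.prod z)) * ψ z| ≤ ε} := by
      refine convexHull_min ?_ (convex_abs_expect_mul_le _ _)
      have base : ∀ ψ ∈ Φ, |𝔼 z, (h z * (φ z ^ b * l.prod z)) * ψ z| ≤ ε := by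
        intro ψ hψ
        have := ih (ψ :: l) (by simpa using ⟨hψ, h1⟩) (by simp; omega)
        convert this using 3
        simp
        ring
      rintro ψ (hψ | hψ)
      · exact base ψ hψ
      · have := base (-ψ) hψ
        simp only [Pi.neg_apply, mul_neg, expect_neg_distrib, abs_neg] at this
        exact this
    have := key hφ
    simp only [Set.mem_ofPred_eq] at this
    convert this using 3
    ring

lemma exists_separating {Φ : Set (Z → ℝ)} {f : Z → ℝ} {ε : ℝ}
    (hno : ∀ g : Z → ℝ, (∀ z, 0 ≤ g z) → (∀ z, g z ≤ 1) →
      ∃ φ ∈ Φ ∪ -Φ, ε < 𝔼 z, (f z - g z) * φ z) :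
    ∃ φ ∈ convexHull ℝ (Φ ∪ -Φ), ∀ g : Z → ℝ, (∀ z, 0 ≤ g z) → (∀ z, g z ≤ 1) →
      ε < 𝔼 z, (f z - g z) * φ z := by
  have hmem : ∀ g : Z → ℝ, g ∈ Set.Icc (0 : Z → ℝ) 1 ↔ (∀ z, 0 ≤ g z) ∧ ∀ z, g z ≤ 1 :=
    fun g => by simp [Set.mem_Icc, Pi.le_def]
  have hcont : ∀ φ : Z → ℝ, Continuous fun g : Z → ℝ => 𝔼 z, (f z - g z) * φ z := by
    intro φ
    simp only [Fintype.expect_eq_sum_div_card]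
    fun_prop
  have hcont' : ∀ g : Z → ℝ, Continuous fun φ : Z → ℝ => 𝔼 z, (f z - g z) * φ z := by
    intro g
    simp only [Fintype.expect_eq_sum_div_card]
    fun_prop
  have hc : IsCompact (Set.Icc (0 : Z → ℝ) 1) := isCompact_Icc
  obtain ⟨s, hsΦ, hs⟩ := hc.elim_finite_subcover_image
    (b := Φ ∪ -Φ) (c := fun φ => {g : Z → ℝ | ε < 𝔼 z, (f z - g z) * φ z})
    (fun φ _ => isOpen_lt continuous_const (hcont φ))
    (fun g hg => by
      obtain ⟨φ, h1, h2⟩ := hno g ((hmem g).1 hg).1 ((hmem g).1 hg).2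
      exact Set.mem_biUnion h1 h2)
  obtain ⟨φ, hφ, h⟩ := Sion.exists_lt_iInf_of_lt_iInf_of_finite
    (X := Set.Icc (0 : Z → ℝ) 1) (Y := convexHull ℝ (Φ ∪ -Φ))
    (f := fun g φ : Z → ℝ => 𝔼 z, (f z - g z) * φ z) ⟨0, by simp⟩ hc
    (fun φ _ => (hcont φ).lowerSemicontinuous.lowerSemicontinuousOn _)
    (fun φ _ => by
      refine ConvexOn.quasiconvexOn ⟨convex_Icc _ _, ?_⟩
      intro x _ y _ a b _ _ hab
      refine le_of_eq ?_
      simp only [smul_eq_mul, mul_expect, ← expect_add_distrib]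
      refine expect_congr rfl fun z _ => ?_
      simp only [Pi.add_apply, Pi.smul_apply, smul_eq_mul]
      linear_combination (-(f z * φ z)) * hab)
    (convex_convexHull _ _)
    (fun g _ => (hcont' g).upperSemicontinuous.upperSemicontinuousOn _)
    (fun g _ => by
      refine ConcaveOn.quasiconcaveOn ⟨convex_convexHull _ _, ?_⟩
      intro x _ y _ a b _ _ hab
      refine le_of_eq ?_
      simp only [smul_eq_mul, mul_expect, ← expect_add_distrib]
      refine expect_congr rfl fun z _ => ?_
      simp only [Pi.add_apply, Pi.smul_apply, smul_eq_mul]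
      ring)
    (convex_Icc _ _) hs.1 (hsΦ.trans (subset_convexHull ℝ _)) (t := ε)
    (fun g hg => by
      have := hs.2 hg
      simp only [Set.mem_iUnion, Set.mem_ofPred_eq] at this
      obtain ⟨φ, h1, h2⟩ := this
      exact ⟨φ, h1, h2⟩)
  exact ⟨φ, hφ, fun g h0 h1 => h g ((hmem g).2 ⟨h0, h1⟩)⟩

end DenseModel

/-- The dense model theorem. -/
theorem dense_model {ε : ℝ} (hε : 0 < ε) : ∃ n : ℕ, ∃ κ > 0, ∀ (Z : Type) [Fintype Z] [Nonempty Z]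
    (Φ : Set (Z → ℝ)) (ν f : Z → ℝ), (∀ φ ∈ Φ, ∀ z, |φ z| ≤ 1) → (∀ z, 0 ≤ f z) →
    (∀ z, f z ≤ ν z) →
    (∀ l : List (Z → ℝ), (∀ φ ∈ l, φ ∈ Φ) → l.length ≤ n → |𝔼 z, (ν z - 1) * l.prod z| ≤ κ) →
    ∃ g : Z → ℝ, (∀ z, 0 ≤ g z) ∧ (∀ z, g z ≤ 1) ∧ ∀ φ ∈ Φ, |𝔼 z, (f z - g z) * φ z| ≤ ε := by
  obtain ⟨P, hP⟩ := exists_polynomial_near_of_continuousOn (-1) 1 (fun x => max x 0)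
    (by fun_prop) (ε / 8) (by positivity)
  have hS : 0 ≤ ∑ b ∈ range (P.natDegree + 1), |P.coeff b| :=
    sum_nonneg fun _ _ => abs_nonneg _
  set S := ∑ b ∈ range (P.natDegree + 1), |P.coeff b| with hSdef
  refine ⟨P.natDegree, min 1 (ε / (2 * (S + 1))), by positivity, ?_⟩
  intro Z _ _ Φ ν f hΦ hf0 hfν H
  by_contra hno
  push Not at hno
  obtain ⟨φ, hφ, hsep⟩ := exists_separating (Φ := Φ) (f := f) (ε := ε) (by
    intro g h0 h1
    obtain ⟨φ, hφ, h⟩ := hno g h0 h1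
    rcases lt_abs.1 h with h | h
    · exact ⟨φ, Or.inl hφ, h⟩
    · exact ⟨-φ, Or.inr (by simpa using hφ), by
        simpa only [Pi.neg_apply, mul_neg, expect_neg_distrib] using h⟩)
  have hφ1 : ∀ z, |φ z| ≤ 1 := by
    have : convexHull ℝ (Φ ∪ -Φ) ⊆ Set.Icc (-1 : Z → ℝ) 1 := by
      refine convexHull_min ?_ (convex_Icc _ _)
      rintro ψ (hψ | hψ)
      · exact ⟨fun z => (abs_le.1 (hΦ ψ hψ z)).1, fun z => (abs_le.1 (hΦ ψ hψ z)).2⟩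
      · have := hΦ _ hψ
        simp only [Pi.neg_apply, abs_neg] at this
        exact ⟨fun z => (abs_le.1 (this z)).1, fun z => (abs_le.1 (this z)).2⟩
    exact fun z => abs_le.2 ⟨(this hφ).1 z, (this hφ).2 z⟩
  have hν0 : ∀ z, 0 ≤ ν z := fun z => (hf0 z).trans (hfν z)
  have h1 := hsep (fun z => if 0 < φ z then 1 else 0)
    (fun z => by split_ifs <;> norm_num) (fun z => by split_ifs <;> norm_num)
  have h2 : 𝔼 z, (f z - if 0 < φ z then 1 else 0) * φ z ≤ 𝔼 z, (ν z - 1) * max (φ z) 0 := by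
    refine expect_le_expect fun z _ => ?_
    split_ifs with h
    · rw [max_eq_left h.le]
      exact mul_le_mul_of_nonneg_right (by linarith [hfν z]) h.le
    · push Not at h
      rw [max_eq_right h]
      nlinarith [hf0 z]
  have hνE : 𝔼 z, (ν z + 1) ≤ 3 := by
    have := (H [] (by simp) (by simp)).trans (min_le_left _ _)
    simp only [List.prod_nil, Pi.one_apply, mul_one] at this
    rw [expect_sub_distrib, expect_const univ_nonempty (1 : ℝ)] at this
    rw [expect_add_distrib, expect_const univ_nonempty (1 : ℝ)]
    linarith [(abs_le.1 this).2]
  have h3 : 𝔼 z, (ν z - 1) * max (φ z) 0 ≤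
      𝔼 z, (ν z - 1) * P.eval (φ z) + ε / 8 * 𝔼 z, (ν z + 1) := by
    rw [mul_expect, ← expect_add_distrib]
    refine expect_le_expect fun z _ => ?_
    have := (hP (φ z) (abs_le.1 (hφ1 z))).le
    have h4 : |(ν z - 1) * (max (φ z) 0 - P.eval (φ z))| ≤ (ν z + 1) * (ε / 8) := by
      rw [abs_mul, abs_sub_comm (max _ _)]
      refine mul_le_mul ?_ this (abs_nonneg _) (by linarith [hν0 z])
      rw [abs_le]
      constructor <;> linarith [hν0 z]
    nlinarith [(abs_le.1 h4).2]
  have h5 : 𝔼 z, (ν z - 1) * P.eval (φ z) ≤ ε / 2 := by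
    have e : 𝔼 z, (ν z - 1) * P.eval (φ z) =
        ∑ b ∈ range (P.natDegree + 1), P.coeff b * 𝔼 z, (ν z - 1) * (φ z ^ b * ([] : List (Z → ℝ)).prod z) := by
      simp only [mul_expect, Polynomial.eval_eq_sum_range]
      rw [← expect_sum_comm]
      refine expect_congr rfl fun z _ => ?_
      rw [mul_sum]
      refine sum_congr rfl fun b _ => ?_
      simp
      ring
    rw [e]
    have hle : ∑ b ∈ range (P.natDegree + 1), P.coeff b *
        𝔼 z, (ν z - 1) * (φ z ^ b * ([] : List (Z → ℝ)).prod z) ≤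
        ∑ b ∈ range (P.natDegree + 1), |P.coeff b| * (ε / (2 * (S + 1))) := by
      refine sum_le_sum fun b hb => ?_
      have := abs_expect_mul_pow_le H hφ b [] (by simp) (by simp at hb ⊢; omega)
      refine (le_abs_self _).trans ?_
      rw [abs_mul]
      exact mul_le_mul_of_nonneg_left (this.trans (min_le_right _ _)) (abs_nonneg _)
    refine hle.trans ?_
    rw [← sum_mul, ← hSdef]
    rw [← mul_div_assoc, div_le_div_iff₀ (by positivity) (by positivity)]
    nlinarith
  nlinarith

end

noncomputable section

/-- The linear forms condition on boxes of integers. -/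
def PseudoRandom (ν : ℤ → ℝ) (m A N : ℕ) (ε : ℝ) : Prop :=
  ∀ (V I : Type) [Fintype V] [DecidableEq V] [Fintype I] (L : I → V → ℤ) (a : V → ℕ),
    Fintype.card V ≤ m → Fintype.card I ≤ m → (∀ i v, |L i v| ≤ A) → (∀ i, ∃ v, L i v ≠ 0) →
    (∀ i i', i ≠ i' → ∃ v, ¬(L i v = 0 ↔ L i' v = 0)) → (∀ v, N ≤ a v) →
    |𝔼 x ∈ Fintype.piFinset fun v => Icc (-(a v : ℤ)) (a v), ∏ i, ν (∑ v, L i v * x v) - 1| ≤ ε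

/-- The integers of absolute value at most `M`. -/
abbrev Box (M : ℕ) : Type := ↥(Icc (-(M : ℤ)) M)

instance (M : ℕ) : Nonempty (Box M) := ⟨⟨0, by simp⟩⟩

lemma card_box (M : ℕ) : (Fintype.card (Box M) : ℝ) = 2 * M + 1 := by
  have : Fintype.card (Box M) = 2 * M + 1 := by
    rw [Fintype.card_coe, Int.card_Icc]
    omega
  rw [this]
  push_cast
  ring

lemma sum_box (M : ℕ) (F : ℤ → ℝ) : ∑ z : Box M, F z = ∑ z ∈ Icc (-(M : ℤ)) M, F z :=
  sum_coe_sort _ F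

lemma PseudoRandom.expect {ν : ℤ → ℝ} {m A N : ℕ} {ε : ℝ} (h : PseudoRandom ν m A N ε)
    {V I Ω : Type} [Fintype V] [DecidableEq V] [Fintype I] [Fintype Ω] (L : I → V → ℤ)
    (a : V → ℕ) (x : Ω → V → ℤ) (hx : Function.Injective x)
    (hr : ∀ y, y ∈ Set.range x ↔ ∀ v, |y v| ≤ a v)
    (h1 : Fintype.card V ≤ m) (h2 : Fintype.card I ≤ m) (h3 : ∀ i v, |L i v| ≤ A)
    (h4 : ∀ i, ∃ v, L i v ≠ 0) (h5 : ∀ i i', i ≠ i' → ∃ v, ¬(L i v = 0 ↔ L i' v = 0))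
    (h6 : ∀ v, N ≤ a v) : |𝔼 ω, ∏ i, ν (∑ v, L i v * x ω v) - 1| ≤ ε := by
  classical
  have e : Fintype.piFinset (fun v => Icc (-(a v : ℤ)) (a v)) = univ.image x := by
    ext y
    have := hr y
    simp only [Set.mem_range] at this
    simp [Fintype.mem_piFinset, ← abs_le, this]
  have := h V I L a h1 h2 h3 h4 h5 h6
  rwa [e, Finset.expect_image hx.injOn] at this

lemma PseudoRandom.single {ν : ℤ → ℝ} {m A N : ℕ} {ε : ℝ} (h : PseudoRandom ν m A N ε)
    (hm : 1 ≤ m) (hA : 1 ≤ A) {a : ℕ} (ha : N ≤ a) : |𝔼 z : Box a, ν z - 1| ≤ ε := by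
  have := h.expect (V := Unit) (I := Unit) (Ω := Box a) (fun _ _ => 1) (fun _ => a)
    (fun z _ => (z : ℤ)) (fun z z' hz => Subtype.ext (congrFun hz ()))
    (fun y => by
      constructor
      · rintro ⟨z, rfl⟩ v
        exact abs_le.2 (mem_Icc.1 z.2)
      · intro hy
        exact ⟨⟨y (), mem_Icc.2 (abs_le.1 (hy ()))⟩, rfl⟩)
    (by simpa using hm) (by simpa using hm) (by simpa using hA) (by simp)
    (fun i i' hi => (hi rfl).elim) (fun _ => ha)
  simpa using this

section Forms

variable {k : ℕ}

/-- The linear forms attached to progressions of length `k`. -/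
def psi (j : Fin k) (y : Fin k → ℤ) : ℤ :=
  ∑ i : Fin k, ((j : ℕ) - (i : ℕ) : ℤ) * y i

/-- The integer points of a cube. -/
def coeBox {M : ℕ} (x : Fin k → Box M) : Fin k → ℤ := fun i => x i

lemma indep_psi (j : Fin k) {M : ℕ} (F : ℤ → ℝ) :
    Indep j fun x : Fin k → Box M => F (psi j (coeBox x)) := by
  intro p q
  refine congrArg F ?_
  rw [psi, psi]
  refine sum_congr rfl fun i _ => ?_
  by_cases hi : i = j
  · subst hi; simp
  · simp [coeBox, hi]

/-- The two entries of the pairs in `p` as a point indexed by `Fin k × Bool`. -/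
def pairCoe {M : ℕ} (p : Fin k → Box M × Box M) : Fin k × Bool → ℤ :=
  fun v => if v.2 then ((p v.1).2 : ℤ) else (p v.1).1

lemma pairCoe_injective {M : ℕ} : Function.Injective (pairCoe (k := k) (M := M)) := by
  intro p q h
  funext i
  have h1 := congrFun h (i, false)
  have h2 := congrFun h (i, true)
  simp only [pairCoe] at h1 h2
  exact Prod.ext (Subtype.ext (by simpa using h1)) (Subtype.ext (by simpa using h2))

lemma mem_range_pairCoe {M : ℕ} (y : Fin k × Bool → ℤ) :
    y ∈ Set.range (pairCoe (k := k) (M := M)) ↔ ∀ v, |y v| ≤ M := by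
  constructor
  · rintro ⟨p, rfl⟩ v
    simp only [pairCoe]
    split_ifs
    · exact abs_le.2 (mem_Icc.1 (p v.1).2.2)
    · exact abs_le.2 (mem_Icc.1 (p v.1).1.2)
  · intro h
    refine ⟨fun i => (⟨y (i, false), mem_Icc.2 (abs_le.1 (h _))⟩,
      ⟨y (i, true), mem_Icc.2 (abs_le.1 (h _))⟩), ?_⟩
    funext ⟨i, b⟩
    cases b <;> simp [pairCoe]

lemma sum_pairCoe {M : ℕ} (c : Fin k → ℤ) (ω : Finset (Fin k)) (p : Fin k → Box M × Box M) :
    ∑ v : Fin k × Bool, (if v.2 = decide (v.1 ∈ ω) then c v.1 else 0) * pairCoe p v =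
      ∑ i, c i * coeBox (proj ω p) i := by
  rw [Fintype.sum_prod_type]
  refine sum_congr rfl fun i _ => ?_
  rw [Fintype.sum_bool]
  by_cases hi : i ∈ ω <;> simp [hi, pairCoe, coeBox, proj, flip]

lemma PseudoRandom.linForms {ν : ℤ → ℝ} {N : ℕ} {ε : ℝ} (hk : 3 ≤ k)
    (h : PseudoRandom ν (k * 2 ^ k) (k.factorial) N ε) {M : ℕ} (hM : N ≤ M) :
    LinForms (fun (j : Fin k) (x : Fin k → Box M) => ν (psi j (coeBox x))) ε := by
  intro E hE
  have key : ∀ (j : Fin k) (ω : Finset (Fin k)), j ∉ ω → ∀ v : Fin k × Bool,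
      (if v.2 = decide (v.1 ∈ ω) then ((j : ℕ) - (v.1 : ℕ) : ℤ) else 0) ≠ 0 ↔
        v.1 ≠ j ∧ v.2 = decide (v.1 ∈ ω) := by
    intro j ω _ v
    rw [Ne, ite_eq_right_iff]
    constructor
    · intro h
      push Not at h
      exact ⟨fun h' => h.2 (by rw [h']; omega), h.1⟩
    · rintro ⟨h1, h2⟩ h3
      have := h3 h2
      exact h1 (Fin.ext (by omega))
  have := h.expect (V := Fin k × Bool) (I := ↥E) (Ω := Fin k → Box M × Box M)
    (fun e v => if v.2 = decide (v.1 ∈ e.1.2) then ((e.1.1 : ℕ) - (v.1 : ℕ) : ℤ) else 0)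
    (fun _ => M) pairCoe pairCoe_injective mem_range_pairCoe
    (by
      rw [Fintype.card_prod, Fintype.card_fin, Fintype.card_bool]
      exact Nat.mul_le_mul_left k (by simpa using Nat.pow_le_pow_right (by norm_num : 0 < 2) (by omega : 1 ≤ k)))
    (by
      rw [Fintype.card_coe]
      refine (card_le_univ E).trans ?_
      rw [Fintype.card_prod, Fintype.card_finset, Fintype.card_fin])
    (by
      intro e v
      have hkf := Nat.self_le_factorial k
      have h1 := e.1.1.2
      have h2 := v.1.2
      split_ifs
      · rw [abs_le]
        constructor <;> omega
      · simp)
    (by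
      rintro ⟨⟨j, ω⟩, he⟩
      obtain ⟨i, hi⟩ : ∃ i : Fin k, i ≠ j := by
        have : Nontrivial (Fin k) := Fin.nontrivial_iff_two_le.2 (by omega)
        exact exists_ne j
      exact ⟨(i, decide (i ∈ ω)), (key j ω (hE _ he) _).2 ⟨hi, rfl⟩⟩)
    (by
      rintro ⟨⟨j, ω⟩, he⟩ ⟨⟨j', ω'⟩, he'⟩ hne
      by_contra hcon
      push Not at hcon
      have hj := hE _ he
      have hj' := hE _ he'
      dsimp only at hj hj'
      have hs : ∀ v : Fin k × Bool, (v.1 ≠ j ∧ v.2 = decide (v.1 ∈ ω)) ↔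
          (v.1 ≠ j' ∧ v.2 = decide (v.1 ∈ ω')) := fun v => by
        rw [← key j ω hj, ← key j' ω' hj']
        exact not_congr (hcon v)
      have hjj : j = j' := by
        by_contra hne'
        exact ((hs (j, decide (j ∈ ω'))).2 ⟨hne', rfl⟩).1 rfl
      subst hjj
      refine hne (Subtype.ext (Prod.ext rfl ?_))
      ext i
      by_cases hi : i = j
      · subst hi
        simp [hj, hj']
      · have := ((hs (i, decide (i ∈ ω))).1 ⟨hi, rfl⟩).2
        simpa using this)
    (fun _ => hM)
  have e1 : ∀ (e : ↥E) (p : Fin k → Box M × Box M),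
      ∑ v : Fin k × Bool, (if v.2 = decide (v.1 ∈ e.1.2) then ((e.1.1 : ℕ) - (v.1 : ℕ) : ℤ) else 0) *
        pairCoe p v = psi e.1.1 (coeBox (proj e.1.2 p)) := fun e p =>
    sum_pairCoe (fun i : Fin k => ((e.1.1 : ℕ) : ℤ) - ((i : ℕ) : ℤ)) e.1.2 p
  simp only [e1] at this
  have e2 : ∀ p : Fin k → Box M × Box M, ∏ e : ↥E, ν (psi e.1.1 (coeBox (proj e.1.2 p))) =
      ∏ e ∈ E, ν (psi e.1 (coeBox (proj e.2 p))) := fun p =>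
    prod_coe_sort E fun e => ν (psi e.1 (coeBox (proj e.2 p)))
  simpa only [e2] using this

/-- A point of a box together with pairs, as a point indexed by `Option (Fin k × Bool)`. -/
def optCoe {M M' : ℕ} (p : Box M' × (Fin k → Box M × Box M)) : Option (Fin k × Bool) → ℤ
  | none => p.1
  | some v => pairCoe p.2 v

lemma PseudoRandom.shifted {ν : ℤ → ℝ} {N : ℕ} {ε : ℝ} (hk : 3 ≤ k)
    (h : PseudoRandom ν (k * 2 ^ k) (k.factorial) N ε) {M M' : ℕ} (hM : N ≤ M) (hM' : N ≤ M')
    (T : Finset (Finset (Fin k))) :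
    |𝔼 p : Box M' × (Fin k → Box M × Box M),
      ∏ ω ∈ T, ν (p.1 + k.factorial * ∑ i, coeBox (proj ω p.2) i) - 1| ≤ ε := by
  have hf : (k.factorial : ℤ) ≠ 0 := by exact_mod_cast k.factorial_ne_zero
  have := h.expect (V := Option (Fin k × Bool)) (I := ↥T)
    (Ω := Box M' × (Fin k → Box M × Box M))
    (fun ω v => v.elim 1 fun v => if v.2 = decide (v.1 ∈ ω.1) then (k.factorial : ℤ) else 0)
    (fun v => v.elim M' fun _ => M) optCoe
    (by
      intro p q hpq
      refine Prod.ext (Subtype.ext (congrFun hpq none)) (pairCoe_injective ?_)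
      funext v
      exact congrFun hpq (some v))
    (by
      intro y
      constructor
      · rintro ⟨p, rfl⟩ (_ | v)
        · exact abs_le.2 (mem_Icc.1 p.1.2)
        · exact (mem_range_pairCoe _).1 ⟨p.2, rfl⟩ v
      · intro hy
        obtain ⟨q, hq⟩ := (mem_range_pairCoe (M := M) fun v => y (some v)).2 fun v => hy (some v)
        refine ⟨(⟨y none, mem_Icc.2 (abs_le.1 (hy none))⟩, q), ?_⟩
        funext v
        rcases v with _ | v
        · rfl
        · exact congrFun hq v)
    (by
      rw [Fintype.card_option, Fintype.card_prod, Fintype.card_fin, Fintype.card_bool]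
      have : 2 ^ 3 ≤ 2 ^ k := Nat.pow_le_pow_right (by norm_num) hk
      nlinarith)
    (by
      rw [Fintype.card_coe]
      refine (card_le_univ T).trans ?_
      rw [Fintype.card_finset, Fintype.card_fin]
      exact Nat.le_mul_of_pos_left _ (by omega))
    (by
      intro ω v
      have := Nat.factorial_pos k
      rcases v with _ | v
      · simp only [Option.elim_none, abs_one]
        exact_mod_cast this
      · simp only [Option.elim_some]
        split_ifs <;> simp)
    (fun ω => ⟨none, by simp⟩)
    (by
      rintro ⟨ω, hω⟩ ⟨ω', hω'⟩ hne
      by_contra hcon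
      push Not at hcon
      refine hne (Subtype.ext ?_)
      ext i
      have h1 := hcon (some (i, decide (i ∈ ω)))
      simp [hf] at h1
      tauto)
    (by
      rintro (_ | v)
      · exact hM'
      · exact hM)
  simp only [Fintype.sum_option, Option.elim_none, Option.elim_some, optCoe, one_mul,
    sum_pairCoe (fun _ => (k.factorial : ℤ)), ← mul_sum] at this
  have e2 : ∀ p : Box M' × (Fin k → Box M × Box M),
      ∏ ω : ↥T, ν (p.1 + k.factorial * ∑ i, coeBox (proj ω.1 p.2) i) =
      ∏ ω ∈ T, ν (p.1 + k.factorial * ∑ i, coeBox (proj ω p.2) i) := fun p =>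
    prod_coe_sort T fun ω => ν (p.1 + k.factorial * ∑ i, coeBox (proj ω p.2) i)
  simpa only [e2] using this

end Forms

end

noncomputable section

section Structured

variable {J Y : Type} [Fintype J] [DecidableEq J] [Fintype Y] [Nonempty Y]

/-- Correlation with `F` is controlled by `B` times correlation with products of bounded functions
each independent of one coordinate. -/
def Str (B : ℝ) (F : (J → Y) → ℝ) : Prop :=
  ∀ (G : (J → Y) → ℝ) (K : ℝ), (∀ U : J → (J → Y) → ℝ, (∀ i, Indep i (U i)) →
    (∀ i t, 0 ≤ U i t) → (∀ i t, U i t ≤ 1) → |𝔼 t, G t * ∏ i, U i t| ≤ K) →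
    |𝔼 t, G t * F t| ≤ B * K

lemma Str.one : Str 1 fun _ : J → Y => (1 : ℝ) := by
  intro G K h
  simpa using h (fun _ _ => 1) (fun _ _ _ => rfl) (fun _ _ => zero_le_one) fun _ _ => le_rfl

lemma Str.mul {B B' : ℝ} {F F' : (J → Y) → ℝ} (h : Str B F) (h' : Str B' F') :
    Str (B * B') fun t => F t * F' t := by
  intro G K hK
  have := h (fun t => G t * F' t) (B' * K) fun U hU h0 h1 => by
    have := h' (fun t => G t * ∏ i, U i t) K fun U' hU' h0' h1' => by
      have := hK (fun i t => U i t * U' i t) (fun i p q => by dsimp only; rw [hU i, hU' i])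
        (fun i t => mul_nonneg (h0 i t) (h0' i t))
        (fun i t => mul_le_one₀ (h1 i t) (h0' i t) (h1' i t))
      simpa only [prod_mul_distrib, mul_assoc] using this
    convert this using 3
    ring
  rw [mul_assoc]
  convert this using 3
  ring

lemma Str.mono {B B' : ℝ} {F : (J → Y) → ℝ} (h : Str B F) (hB : B ≤ B') : Str B' F := by
  intro G K hK
  have h0 : 0 ≤ K := (abs_nonneg _).trans
    (hK (fun _ _ => 1) (fun _ _ _ => rfl) (fun _ _ => zero_le_one) fun _ _ => le_rfl)
  exact (h G K hK).trans (mul_le_mul_of_nonneg_right hB h0)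

lemma Str.sum {σ : Type*} (S : Finset σ) {c : ℝ} (hc : 0 ≤ c) (U : σ → J → (J → Y) → ℝ)
    (hU : ∀ s i, Indep i (U s i)) (h0 : ∀ s i t, 0 ≤ U s i t) (h1 : ∀ s i t, U s i t ≤ 1) :
    Str (c * S.card) fun t => c * ∑ s ∈ S, ∏ i, U s i t := by
  intro G K hK
  have e : 𝔼 t, G t * (c * ∑ s ∈ S, ∏ i, U s i t) = c * ∑ s ∈ S, 𝔼 t, G t * ∏ i, U s i t := by
    rw [← expect_sum_comm, mul_expect]
    refine expect_congr rfl fun t _ => ?_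
    rw [← mul_sum]
    ring
  rw [e, abs_mul, abs_of_nonneg hc, mul_assoc]
  refine mul_le_mul_of_nonneg_left ((abs_sum_le_sum_abs _ _).trans ?_) hc
  rw [← nsmul_eq_mul]
  exact sum_le_card_nsmul _ _ _ fun s _ => hK (U s) (hU s) (h0 s) (h1 s)

lemma box_nonneg (j : J) (G : (J → Y) → ℝ) :
    0 ≤ 𝔼 p : J → Y × Y, ∏ ω ∈ univ.powerset, G (proj ω p) := by
  have hj : j ∉ univ.erase j := notMem_erase j univ
  rw [← expect_update j]
  refine expect_nonneg fun p _ => ?_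
  set A : Y → ℝ := fun y => ∏ ω ∈ (univ.erase j).powerset, G (Function.update (proj ω p) j y)
  have e : ∀ q : Y × Y, ∏ ω ∈ univ.powerset, G (proj ω (Function.update p j q)) =
      A q.1 * A q.2 := by
    intro q
    conv_lhs => rw [← insert_erase (mem_univ j)]
    rw [prod_powerset_insert hj]
    congr 1
    · refine prod_congr rfl fun ω hω => ?_
      have : j ∉ ω := fun h => hj (mem_powerset.1 hω h)
      rw [proj_update, if_neg this]
    · refine prod_congr rfl fun ω hω => ?_
      rw [proj_update, if_pos (mem_insert_self j ω)]
      congr 1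
      funext l
      by_cases hl : l = j
      · subst hl
        simp
      · simp [hl, proj, flip]
  simp only [e]
  rw [expect_prod' fun q : Y × Y => A q.1 * A q.2, ← Fintype.expect_mul_expect]
  exact mul_self_nonneg _

lemma Str.gowers [Nonempty J] {F : (J → Y) → ℝ} {B : ℝ} (h : Str B F) (G : (J → Y) → ℝ) :
    |𝔼 t, G t * F t| ^ 2 ^ Fintype.card J ≤
      (2 * |B|) ^ 2 ^ Fintype.card J * 𝔼 p, ∏ ω ∈ univ.powerset, G (proj ω p) := by
  obtain ⟨j⟩ := ‹Nonempty J›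
  set E := 𝔼 p : J → Y × Y, ∏ ω ∈ univ.powerset, G (proj ω p) with hE
  have hE0 : 0 ≤ E := box_nonneg j G
  have hn : (2 ^ Fintype.card J : ℕ) ≠ 0 := by positivity
  have hroot : (E ^ ((2 ^ Fintype.card J : ℕ) : ℝ)⁻¹) ^ 2 ^ Fintype.card J = E :=
    Real.rpow_inv_natCast_pow hE0 hn
  set e := E ^ ((2 ^ Fintype.card J : ℕ) : ℝ)⁻¹
  have he0 : 0 ≤ e := Real.rpow_nonneg hE0 _
  have key := h.mono (le_abs_self B) G (2 * e) fun U hU h0 h1 => by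
    have := gowers_cauchy_schwarz univ (fun p => G (proj ∅ p)) (fun i p => U i (proj ∅ p))
      (fun _ _ => 1) (fun i _ => indep₂_proj G (notMem_empty i)) (fun i _ => (hU i).proj ∅)
      (fun _ _ _ _ => rfl) (fun i _ l _ => indep₂_proj (U i) (notMem_empty l))
      (fun _ _ _ _ _ _ _ _ => rfl)
      (fun i _ p => abs_le.2 ⟨by linarith [h0 i (proj ∅ p)], h1 i (proj ∅ p)⟩)
      (fun i _ R _ _ => by simp)
    simp only [proj_flip, prod_const_one, mul_one, card_univ] at this
    rw [expect_proj_empty fun t => G t * ∏ i, U i t, ← hE, abs_of_nonneg hE0] at this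
    rw [← pow_le_pow_iff_left₀ (abs_nonneg _) (by positivity) hn, mul_pow, hroot]
    exact this
  calc |𝔼 t, G t * F t| ^ 2 ^ Fintype.card J ≤ (|B| * (2 * e)) ^ 2 ^ Fintype.card J :=
        pow_le_pow_left₀ (abs_nonneg _) key _
    _ = (2 * |B|) ^ 2 ^ Fintype.card J * e ^ 2 ^ Fintype.card J := by
        rw [← mul_pow]
        congr 1
        ring
    _ = _ := by rw [hroot]

end Structured

section StrFun

variable {k : ℕ}

/-- The points of a cube of integers. -/
def cube (k M : ℕ) : Finset (Fin k → ℤ) := Fintype.piFinset fun _ => Icc (-(M : ℤ)) M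

lemma mem_cube {M : ℕ} {y : Fin k → ℤ} : y ∈ cube k M ↔ ∀ i, |y i| ≤ M := by
  simp [cube, Fintype.mem_piFinset, abs_le]

lemma psi_add (j : Fin k) (y s : Fin k → ℤ) : psi j (y + s) = psi j y + psi j s := by
  simp only [psi, Pi.add_apply, mul_add, sum_add_distrib]

lemma card_filter_psi_le (hk : 2 ≤ k) (j : Fin k) (M : ℕ) (z : ℤ) :
    ((cube k M).filter fun y => psi j y = z).card ≤ (2 * M + 1) ^ (k - 1) := by
  have : Nontrivial (Fin k) := Fin.nontrivial_iff_two_le.2 hk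
  obtain ⟨l, hl⟩ := exists_ne j
  set S := Fintype.piFinset fun i : Fin k => if i = l then ({0} : Finset ℤ) else Icc (-(M : ℤ)) M
  have hS : S.card = (2 * M + 1) ^ (k - 1) := by
    rw [Fintype.card_piFinset, ← mul_prod_erase _ _ (mem_univ l), if_pos rfl, card_singleton,
      one_mul, prod_congr rfl (g := fun _ => 2 * M + 1), prod_const, card_erase_of_mem (mem_univ l),
      card_univ, Fintype.card_fin]
    intro i hi
    rw [if_neg (ne_of_mem_erase hi), Int.card_Icc]
    omega
  rw [← hS]
  refine card_le_card_of_injOn (fun y => Function.update y l 0) ?_ ?_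
  · intro y hy
    have hy := mem_cube.1 (mem_filter.1 hy).1
    refine Fintype.mem_piFinset.2 fun i => ?_
    by_cases hi : i = l
    · subst hi; simp
    · simpa [hi, abs_le] using hy i
  · intro y hy y' hy' h
    have h1 := (mem_filter.1 hy).2
    have h2 := (mem_filter.1 hy').2
    have ho : ∀ i, i ≠ l → y i = y' i := fun i hi => by
      simpa [hi] using congrFun h i
    have h3 : psi j y - psi j y' = ((j : ℕ) - (l : ℕ) : ℤ) * (y l - y' l) := by
      rw [psi, psi, ← sum_sub_distrib]
      rw [sum_eq_single l]
      · ring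
      · intro i _ hi
        rw [ho i hi, sub_self]
      · simp
    rw [h1, h2, sub_self] at h3
    funext i
    by_cases hi : i = l
    · subst hi
      rcases mul_eq_zero.1 h3.symm with h4 | h4
      · exact (hl (Fin.ext (by omega))).elim
      · linarith
    · exact ho i hi

/-- The normalised push-forward under `psi j` of a product of functions on the cube. -/
def strFun (M : ℕ) (j : Fin k) (V : Fin k → (Fin k → ℤ) → ℝ) (z : ℤ) : ℝ :=
  ((2 * M + 1 : ℝ) ^ (k - 1))⁻¹ *
    ∑ y ∈ (cube k M).filter (fun y => psi j y = z), ∏ i ∈ univ.erase j, V i y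

/-- The weights for which `strFun` is used as a test function. -/
structure Admissible (M : ℕ) (j : Fin k) (V : Fin k → (Fin k → ℤ) → ℝ) : Prop where
  indep : ∀ i p q, V i (Function.update p i q) = V i p
  nonneg : ∀ i y, 0 ≤ V i y
  le_one : ∀ i y, V i y ≤ 1
  mem : ∀ y, ∏ i ∈ univ.erase j, V i y ≠ 0 → y ∈ cube k M

lemma Admissible.strFun_nonneg {M : ℕ} {j : Fin k} {V : Fin k → (Fin k → ℤ) → ℝ}
    (h : Admissible M j V) (z : ℤ) : 0 ≤ strFun M j V z :=
  mul_nonneg (by positivity) (sum_nonneg fun y _ => prod_nonneg fun i _ => h.nonneg i y)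

lemma Admissible.strFun_le_one {M : ℕ} {j : Fin k} {V : Fin k → (Fin k → ℤ) → ℝ} (hk : 2 ≤ k)
    (h : Admissible M j V) (z : ℤ) : strFun M j V z ≤ 1 := by
  rw [strFun, inv_mul_le_one₀ (by positivity)]
  have h1 : ∑ y ∈ (cube k M).filter (fun y => psi j y = z), ∏ i ∈ univ.erase j, V i y ≤
      ((cube k M).filter fun y => psi j y = z).card := by
    refine (sum_le_card_nsmul _ _ 1 fun y _ => ?_).trans (by simp)
    exact prod_le_one (fun i _ => h.nonneg i y) fun i _ => h.le_one i y
  refine h1.trans ?_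
  exact_mod_cast card_filter_psi_le hk j M z

lemma abs_psi_le {M : ℕ} (j : Fin k) {y : Fin k → ℤ} (hy : y ∈ cube k M) :
    |psi j y| ≤ (k ^ 2 * M : ℕ) := by
  rw [mem_cube] at hy
  refine (abs_sum_le_sum_abs _ _).trans ?_
  have : ∀ i ∈ (univ : Finset (Fin k)), |((j : ℕ) - (i : ℕ) : ℤ) * y i| ≤ k * M := by
    intro i _
    rw [abs_mul]
    refine mul_le_mul ?_ (hy i) (abs_nonneg _) (by positivity)
    rw [abs_le]
    constructor <;> omega
  refine (sum_le_card_nsmul _ _ _ this).trans (le_of_eq ?_)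
  simp
  ring

lemma strFun_ne_zero {M : ℕ} {j : Fin k} {V : Fin k → (Fin k → ℤ) → ℝ} {z : ℤ}
    (h : strFun M j V z ≠ 0) : |z| ≤ (k ^ 2 * M : ℕ) := by
  obtain ⟨y, hy, -⟩ := exists_ne_zero_of_sum_ne_zero (right_ne_zero_of_mul h)
  rw [mem_filter] at hy
  rw [← hy.2]
  exact abs_psi_le j hy.1

lemma exists_shift (hk : 2 ≤ k) (j : Fin k) : ∃ s : (Fin k → ℤ) → Fin k → ℤ,
    (∀ t, psi j (s t) = k.factorial * ∑ i, t i) ∧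
    (∀ M : ℕ, ∀ t ∈ cube k M, s t ∈ cube k (2 * k.factorial * M)) ∧
    ∀ i, i ≠ j → ∀ t q, ∀ l, l ≠ i → s (Function.update t i q) l = s t l := by
  have : Nontrivial (Fin k) := Fin.nontrivial_iff_two_le.2 hk
  obtain ⟨l, hl⟩ := exists_ne j
  have hq : ∀ i : Fin k, ∃ q : ℤ, (i ≠ j → ((j : ℕ) - (i : ℕ) : ℤ) * q = k.factorial) ∧
      |q| ≤ k.factorial := by
    intro i
    by_cases hi : i = j
    · exact ⟨0, fun h => (h hi).elim, by simp⟩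
    · have hne : ((j : ℕ) - (i : ℕ) : ℤ) ≠ 0 := fun h => hi (Fin.ext (by omega))
      have hd : ((j : ℕ) - (i : ℕ) : ℤ) ∣ k.factorial := by
        rw [← Int.natAbs_dvd, Int.natCast_dvd_natCast]
        exact Nat.dvd_factorial (Int.natAbs_pos.2 hne) (by omega)
      obtain ⟨q, hq⟩ := hd
      refine ⟨q, fun _ => hq.symm, ?_⟩
      have : |(k.factorial : ℤ)| = |((j : ℕ) - (i : ℕ) : ℤ)| * |q| := by rw [hq, abs_mul]
      rw [Nat.abs_cast] at this
      rw [this]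
      exact le_mul_of_one_le_left (abs_nonneg _) (Int.one_le_abs hne)
  choose q hq1 hq2 using hq
  refine ⟨fun t i => if i = j then 0 else if i = l then q i * (t i + t j) else q i * t i,
    ?_, ?_, ?_⟩
  · intro t
    have e : ∀ i : Fin k, ((j : ℕ) - (i : ℕ) : ℤ) *
        (if i = j then 0 else if i = l then q i * (t i + t j) else q i * t i) =
        k.factorial * t i + (if i = l then k.factorial * t j else 0) -
          (if i = j then k.factorial * t j else 0) := by
      intro i
      by_cases hi : i = j
      · subst hi
        simp [hl.symm]
      · by_cases hil : i = l
        · subst hil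
          simp only [hi, if_false, if_true, ← mul_assoc, hq1 i hi]
          ring
        · simp only [hi, hil, if_false, ← mul_assoc, hq1 i hi]
          ring
    simp only [psi, e, sum_sub_distrib, sum_add_distrib, sum_ite_eq', mem_univ, if_true, mul_sum]
    ring
  · intro M t ht
    rw [mem_cube] at ht ⊢
    intro i
    have hM : (0 : ℤ) ≤ M := by positivity
    have hf : (0 : ℤ) ≤ k.factorial := by positivity
    push_cast
    split_ifs
    · simp
      positivity
    · rw [abs_mul]
      have : |t i + t j| ≤ 2 * M := (abs_add_le _ _).trans (by linarith [ht i, ht j])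
      calc |q i| * |t i + t j| ≤ k.factorial * (2 * M) :=
            mul_le_mul (hq2 i) this (abs_nonneg _) hf
        _ = _ := by ring
    · rw [abs_mul]
      calc |q i| * |t i| ≤ k.factorial * (2 * M) :=
            mul_le_mul (hq2 i) (by linarith [ht i]) (abs_nonneg _) hf
        _ = _ := by ring
  · intro i hi t r m hm
    simp [Function.update_of_ne hm, Function.update_of_ne hi.symm]

lemma Admissible.str {M : ℕ} {j : Fin k} {V : Fin k → (Fin k → ℤ) → ℝ} (hk : 2 ≤ k)
    (h : Admissible M j V) (z : ℤ) :
    Str ((2 * k.factorial + 1 : ℝ) ^ (k - 1)) fun t : Fin k → Box M =>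
      strFun M j V (z + k.factorial * ∑ i, coeBox t i) := by
  obtain ⟨s, hs1, hs2, hs3⟩ := exists_shift hk j
  set M' := (2 * k.factorial + 1) * M with hM'
  set S := (cube k M').filter fun y => psi j y = z
  set c := ((2 * M + 1 : ℝ) ^ (k - 1))⁻¹ with hc
  have e : ∀ t : Fin k → Box M, strFun M j V (z + k.factorial * ∑ i, coeBox t i) =
      c * ∑ y ∈ S, ∏ i, (if i = j then 1 else V i (y + s (coeBox t))) := by
    intro t
    rw [strFun]
    congr 1
    have e1 : ∀ y, ∏ i, (if i = j then 1 else V i (y + s (coeBox t))) =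
        ∏ i ∈ univ.erase j, V i (y + s (coeBox t)) := by
      intro y
      rw [← mul_prod_erase _ _ (mem_univ j), if_pos rfl, one_mul]
      exact prod_congr rfl fun i hi => if_neg (ne_of_mem_erase hi)
    simp only [e1]
    have e2 := sum_map S (addRightEmbedding (s (coeBox t))) fun y => ∏ i ∈ univ.erase j, V i y
    simp only [addRightEmbedding_apply] at e2
    rw [← e2]
    refine sum_subset_zero_on_sdiff ?_ ?_ fun _ _ => rfl
    · intro y hy
      rw [mem_filter] at hy
      rw [mem_map]
      refine ⟨y - s (coeBox t), ?_, by simp⟩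
      have ht : s (coeBox t) ∈ cube k (2 * k.factorial * M) :=
        hs2 M _ (mem_cube.2 fun i => abs_le.2 (mem_Icc.1 (t i).2))
      rw [mem_filter, mem_cube]
      constructor
      · intro i
        have h1 := mem_cube.1 hy.1 i
        have h2 := mem_cube.1 ht i
        rw [hM']
        push_cast at h1 h2 ⊢
        refine (abs_sub _ _).trans ?_
        linarith
      · have := psi_add j (y - s (coeBox t)) (s (coeBox t))
        rw [sub_add_cancel, hs1, hy.2] at this
        linarith
    · intro y hy
      rw [mem_sdiff, mem_map] at hy
      obtain ⟨⟨y', hy', rfl⟩, hy2⟩ := hy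
      by_contra hne
      refine hy2 (mem_filter.2 ⟨h.mem _ hne, ?_⟩)
      rw [addRightEmbedding_apply, psi_add, hs1, (mem_filter.1 hy').2]
  simp only [e]
  refine (Str.sum S (by positivity) (fun y i t => if i = j then 1 else V i (y + s (coeBox t)))
    ?_ ?_ ?_).mono ?_
  · intro y i p r
    dsimp only
    by_cases hi : i = j
    · simp [hi]
    · rw [if_neg hi, if_neg hi, ← h.indep i _ ((y + s (coeBox p)) i)]
      conv_rhs => rw [← h.indep i _ ((y + s (coeBox p)) i)]
      congr 1
      funext m
      by_cases hm : m = i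
      · subst hm; simp
      · rw [Function.update_of_ne hm, Function.update_of_ne hm, Pi.add_apply, Pi.add_apply]
        congr 1
        have : coeBox (Function.update p i r) = Function.update (coeBox p) i (r : ℤ) := by
          funext n
          by_cases hn : n = i
          · subst hn; simp [coeBox]
          · simp [coeBox, hn]
        rw [this, hs3 i hi _ _ m hm]
  · intro y i t
    split_ifs
    · exact zero_le_one
    · exact h.nonneg _ _
  · intro y i t
    split_ifs
    · exact le_rfl
    · exact h.le_one _ _
  · rw [hc, inv_mul_le_iff₀ (by positivity), ← mul_pow]
    have h1 : (S.card : ℝ) ≤ (2 * M' + 1) ^ (k - 1) := by exact_mod_cast card_filter_psi_le hk j M' z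
    refine h1.trans (pow_le_pow_left₀ (by positivity) ?_ _)
    rw [hM']
    push_cast
    have : (0 : ℝ) ≤ k.factorial := by positivity
    nlinarith

end StrFun

end

noncomputable section

lemma expect_pow_le {Ω : Type*} [Fintype Ω] [Nonempty Ω] {F : Ω → ℝ} (hF : ∀ x, 0 ≤ F x) (n : ℕ) :
    (𝔼 x, F x) ^ n ≤ 𝔼 x, F x ^ n := by
  have hc : (0 : ℝ) < Fintype.card Ω := by exact_mod_cast Fintype.card_pos
  have := Real.pow_arith_mean_le_arith_mean_pow univ (fun _ : Ω => (Fintype.card Ω : ℝ)⁻¹) F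
    (fun _ _ => by positivity) (by simp [hc.ne']) (fun x _ => hF x) n
  simpa only [Fintype.expect_eq_sum_div_card, div_eq_inv_mul, mul_sum] using this

variable {k : ℕ}

lemma exists_lift_prod (hk : 2 ≤ k) (M : ℕ) (l : List (Box (k ^ 2 * M) → ℝ))
    (hl : ∀ φ ∈ l, ∃ (j : Fin k) (V : Fin k → (Fin k → ℤ) → ℝ), Admissible M j V ∧
      φ = fun z : Box (k ^ 2 * M) => strFun M j V z) :
    ∃ F : ℤ → ℝ, (∀ z : Box (k ^ 2 * M), l.prod z = F z) ∧
      (∀ z : ℤ, Str (((2 * k.factorial + 1 : ℝ) ^ (k - 1)) ^ l.length) fun t : Fin k → Box M =>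
        F (z + k.factorial * ∑ i, coeBox t i)) ∧
      (l ≠ [] → ∀ z, F z ≠ 0 → |z| ≤ (k ^ 2 * M : ℕ)) := by
  induction l with
  | nil => exact ⟨fun _ => 1, fun _ => rfl, fun _ => by simpa using Str.one, by simp⟩
  | cons φ l ih =>
    obtain ⟨F, h1, h2, -⟩ := ih fun φ hφ => hl φ (List.mem_cons_of_mem _ hφ)
    obtain ⟨j, V, hV, rfl⟩ := hl φ List.mem_cons_self
    refine ⟨fun z => strFun M j V z * F z, fun z => by simp [h1], fun z => ?_, fun _ z hz => ?_⟩
    · rw [List.length_cons, pow_succ']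
      exact (hV.str hk z).mul (h2 z)
    · exact strFun_ne_zero (left_ne_zero_of_mul hz)

lemma sum_box_shift {M M' : ℕ} {H : ℤ → ℝ} {a : ℤ} (hH : ∀ z, H z ≠ 0 → |z| ≤ M)
    (ha : |a| + M ≤ M') : ∑ z : Box M', H (z + a) = ∑ z : Box M, H z := by
  rw [sum_box M' fun z => H (z + a), sum_box M H]
  have e := sum_map (Icc (-(M' : ℤ)) M') (addRightEmbedding a) H
  simp only [addRightEmbedding_apply] at e
  rw [← e]
  symm
  refine sum_subset_zero_on_sdiff ?_ ?_ fun _ _ => rfl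
  · intro z hz
    rw [mem_map]
    refine ⟨z - a, ?_, by simp⟩
    rw [mem_Icc, ← abs_le] at hz ⊢
    exact (abs_sub _ _).trans (by linarith)
  · intro z hz
    by_contra hne
    exact (mem_sdiff.1 hz).2 (mem_Icc.2 (abs_le.1 (hH z hne)))

lemma abs_sum_coeBox_le {M : ℕ} (t : Fin k → Box M) : |∑ i, coeBox t i| ≤ k * M := by
  refine (abs_sum_le_sum_abs _ _).trans ?_
  refine (sum_le_card_nsmul _ _ (M : ℤ) fun i _ => abs_le.2 (mem_Icc.1 (t i).2)).trans ?_
  simp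

theorem correlation (hk : 3 ≤ k) (n : ℕ) {η : ℝ} (hη : 0 < η) : ∃ ε > 0, ∀ (ν : ℤ → ℝ) (N : ℕ),
    PseudoRandom ν (k * 2 ^ k) k.factorial N ε → ∀ M, N ≤ M →
    ∀ l : List (Box (k ^ 2 * M) → ℝ), (∀ φ ∈ l, ∃ (j : Fin k) (V : Fin k → (Fin k → ℤ) → ℝ),
      Admissible M j V ∧ φ = fun z : Box (k ^ 2 * M) => strFun M j V z) → l.length ≤ n →
      |𝔼 z : Box (k ^ 2 * M), (ν z - 1) * l.prod z| ≤ η := by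
  have : NeZero k := ⟨by omega⟩
  set B : ℝ := ((2 * k.factorial + 1 : ℝ) ^ (k - 1)) ^ n with hB
  have hB1 : 1 ≤ (2 * k.factorial + 1 : ℝ) ^ (k - 1) :=
    one_le_pow₀ (by linarith [show (0 : ℝ) ≤ k.factorial by positivity])
  have hB0 : 0 < B := by positivity
  set c : ℝ := 1 + k * k.factorial with hc
  have hc0 : 0 < c := by positivity
  refine ⟨min η ((η / (4 * B * c)) ^ 2 ^ k), by positivity, ?_⟩
  intro ν N hν M hM l hl hln
  have hMk : N ≤ k ^ 2 * M := hM.trans (Nat.le_mul_of_pos_left _ (by positivity))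
  obtain ⟨F, hF1, hF2, hF3⟩ := exists_lift_prod (by omega) M l hl
  rcases eq_or_ne l [] with rfl | hne
  · have := (hν.single (by have := Nat.one_le_two_pow (n := k); nlinarith)
      (Nat.factorial_pos k) hMk).trans (min_le_left _ _)
    simp only [List.prod_nil, Pi.one_apply, mul_one]
    rwa [expect_sub_distrib, expect_const univ_nonempty (1 : ℝ)]
  have hF3 := hF3 hne
  set M' : ℕ := k ^ 2 * M + k * k.factorial * M with hM'
  set G : ℤ → ℝ := fun z => ν z - 1 with hG
  set D : Box M' → ℝ := fun z => 𝔼 t : Fin k → Box M,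
    G (z + k.factorial * ∑ i, coeBox t i) * F (z + k.factorial * ∑ i, coeBox t i) with hD
  have e1 : ∑ z : Box (k ^ 2 * M), G z * F z = ∑ z, D z := by
    rw [hD, ← expect_sum_comm]
    rw [expect_congr rfl fun t _ => sum_box_shift (M := k ^ 2 * M) (M' := M')
      (H := fun z => G z * F z) (fun z hz => hF3 z (right_ne_zero_of_mul hz)) ?_]
    · exact (expect_const univ_nonempty _).symm
    · rw [abs_mul, Nat.abs_cast, hM']
      have := abs_sum_coeBox_le t
      have h2 : (0 : ℤ) ≤ k.factorial := by positivity
      push_cast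
      nlinarith
  have e2 : |𝔼 z : Box (k ^ 2 * M), G z * F z| ≤ c * 𝔼 z, |D z| := by
    rw [Fintype.expect_eq_sum_div_card, e1, abs_div, abs_of_nonneg (by positivity :
      (0 : ℝ) ≤ (Fintype.card (Box (k ^ 2 * M)) : ℝ)), Fintype.expect_eq_sum_div_card, card_box,
      card_box, div_le_iff₀ (by positivity)]
    have h1 := abs_sum_le_sum_abs D univ
    have h2 : (2 * (M' : ℝ) + 1) ≤ c * (2 * (k ^ 2 * M : ℕ) + 1) := by
      rw [hM', hc]
      push_cast
      have h3 : (0 : ℝ) ≤ k * k.factorial := by positivity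
      have h4 : (M : ℝ) ≤ k ^ 2 * M := le_mul_of_one_le_left (by positivity)
        (one_le_pow₀ (by exact_mod_cast (by omega : 1 ≤ k)))
      nlinarith [mul_le_mul_of_nonneg_left h4 h3]
    have h3 : 0 ≤ ∑ z, |D z| := sum_nonneg fun _ _ => abs_nonneg _
    calc |∑ z, D z| ≤ ∑ z, |D z| := h1
      _ = (∑ z, |D z|) / (2 * M' + 1) * (2 * M' + 1) := by field_simp
      _ ≤ (∑ z, |D z|) / (2 * M' + 1) * (c * (2 * (k ^ 2 * M : ℕ) + 1)) := by gcongr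
      _ = _ := by ring
  have e3 : ∀ z, |D z| ^ 2 ^ k ≤ (2 * B) ^ 2 ^ k * 𝔼 p : Fin k → Box M × Box M,
      ∏ ω ∈ univ.powerset, G (z + k.factorial * ∑ i, coeBox (proj ω p) i) := by
    intro z
    have h1 : Str B _ := (hF2 z).mono (pow_le_pow_right₀ hB1 hln)
    have := h1.gowers fun t => G (z + k.factorial * ∑ i, coeBox t i)
    rwa [Fintype.card_fin, abs_of_pos hB0] at this
  have e4 : 𝔼 z : Box M', 𝔼 p : Fin k → Box M × Box M,
      ∏ ω ∈ univ.powerset, G (z + k.factorial * ∑ i, coeBox (proj ω p) i) ≤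
      2 ^ 2 ^ k * (η / (4 * B * c)) ^ 2 ^ k := by
    have := abs_expect_prod_sub_one_le (Y := Box M' × (Fin k → Box M × Box M))
      (K := (univ : Finset (Fin k)).powerset) ⟨∅, by simp⟩
      (fun ω p => ν (p.1 + k.factorial * ∑ i, coeBox (proj ω p.2) i)) (fun _ => 1)
      (ε := min η ((η / (4 * B * c)) ^ 2 ^ k)) (fun T _ => by
        simp only [mul_one]
        exact hν.shifted hk hM (hMk.trans (Nat.le_add_right _ _)) T)
    simp only [mul_one, card_powerset, card_univ, Fintype.card_fin] at this
    rw [← expect_prod' fun p : Box M' × (Fin k → Box M × Box M) =>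
      ∏ ω ∈ univ.powerset, G (p.1 + k.factorial * ∑ i, coeBox (proj ω p.2) i)]
    exact ((le_abs_self _).trans this).trans
      (mul_le_mul_of_nonneg_left (min_le_right _ _) (by positivity))
  have e5 : (𝔼 z, |D z|) ^ 2 ^ k ≤ (η / c) ^ 2 ^ k := by
    calc (𝔼 z, |D z|) ^ 2 ^ k ≤ 𝔼 z, |D z| ^ 2 ^ k := expect_pow_le (fun _ => abs_nonneg _) _
      _ ≤ (2 * B) ^ 2 ^ k * (2 ^ 2 ^ k * (η / (4 * B * c)) ^ 2 ^ k) := by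
          refine (expect_le_expect fun z _ => e3 z).trans ?_
          rw [← mul_expect]
          exact mul_le_mul_of_nonneg_left e4 (by positivity)
      _ = _ := by
          rw [← mul_pow, ← mul_pow]
          congr 1
          field_simp
          ring
  have e6 : 𝔼 z, |D z| ≤ η / c :=
    (pow_le_pow_iff_left₀ (expect_nonneg fun _ _ => abs_nonneg _) (by positivity)
      (by positivity : 2 ^ k ≠ 0)).1 e5
  simp only [hF1]
  refine e2.trans ?_
  rw [mul_comm]
  exact (le_div_iff₀ hc0).1 e6

theorem exists_dense_model (hk : 3 ≤ k) {η : ℝ} (hη : 0 < η) : ∃ ε > 0, ∀ (ν : ℤ → ℝ) (N : ℕ),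
    PseudoRandom ν (k * 2 ^ k) k.factorial N ε → ∀ M, N ≤ M → ∀ f : ℤ → ℝ, (∀ z, 0 ≤ f z) →
    (∀ z, f z ≤ ν z) → ∃ g : ℤ → ℝ, (∀ z, 0 ≤ g z) ∧ (∀ z, g z ≤ 1) ∧
      ∀ (j : Fin k) (V : Fin k → (Fin k → ℤ) → ℝ), Admissible M j V →
        |𝔼 z : Box (k ^ 2 * M), (f z - g z) * strFun M j V z| ≤ η := by
  obtain ⟨n, κ, hκ, h⟩ := dense_model hη
  obtain ⟨ε, hε, hc⟩ := correlation hk n hκ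
  refine ⟨ε, hε, fun ν N hν M hM f hf0 hfν => ?_⟩
  obtain ⟨g, hg0, hg1, hg⟩ := h (Box (k ^ 2 * M))
    {φ | ∃ (j : Fin k) (V : Fin k → (Fin k → ℤ) → ℝ), Admissible M j V ∧
      φ = fun z : Box (k ^ 2 * M) => strFun M j V z} (fun z => ν z) (fun z => f z)
    (by
      rintro _ ⟨j, V, hV, rfl⟩ z
      exact abs_le.2 ⟨by linarith [hV.strFun_nonneg z], hV.strFun_le_one (by omega) z⟩)
    (fun z => hf0 z) (fun z => hfν z) (fun l hl hln => hc ν N hν M hM l hl hln)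
  refine ⟨fun z => if hz : z ∈ Icc (-((k ^ 2 * M : ℕ) : ℤ)) (k ^ 2 * M : ℕ) then g ⟨z, hz⟩ else 0,
    fun z => ?_, fun z => ?_, fun j V hV => ?_⟩
  · dsimp only
    split_ifs
    · exact hg0 _
    · exact le_rfl
  · dsimp only
    split_ifs
    · exact hg1 _
    · exact zero_le_one
  · have := hg _ ⟨j, V, hV, rfl⟩
    convert this using 5 with z
    exact dif_pos z.2

end

noncomputable section

variable {k : ℕ}

lemma sum_coeBox (M : ℕ) (F : (Fin k → ℤ) → ℝ) :
    ∑ x : Fin k → Box M, F (coeBox x) = ∑ y ∈ cube k M, F y := by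
  refine sum_nbij coeBox (fun x _ => mem_cube.2 fun i => abs_le.2 (mem_Icc.1 (x i).2)) ?_ ?_
    fun _ _ => rfl
  · intro x _ y _ h
    funext i
    exact Subtype.ext (congrFun h i)
  · intro y hy
    rw [mem_coe, mem_cube] at hy
    exact ⟨fun i => ⟨y i, mem_Icc.2 (abs_le.1 (hy i))⟩, by simp, rfl⟩

lemma expect_coeBox (M : ℕ) (F : (Fin k → ℤ) → ℝ) :
    𝔼 x : Fin k → Box M, F (coeBox x) = (∑ y ∈ cube k M, F y) / (2 * M + 1) ^ k := by
  rw [Fintype.expect_eq_sum_div_card, sum_coeBox, Fintype.card_fun, Nat.cast_pow, card_box,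
    Fintype.card_fin]

lemma expect_psi_mul (hk : 1 ≤ k) (M : ℕ) (j : Fin k) (V : Fin k → (Fin k → ℤ) → ℝ) (H : ℤ → ℝ) :
    𝔼 x : Fin k → Box M, H (psi j (coeBox x)) * ∏ i ∈ univ.erase j, V i (coeBox x) =
      (2 * (k ^ 2 * M : ℕ) + 1) / (2 * M + 1) *
        𝔼 z : Box (k ^ 2 * M), H z * strFun M j V z := by
  rw [expect_coeBox M fun y => H (psi j y) * ∏ i ∈ univ.erase j, V i y,
    Fintype.expect_eq_sum_div_card, card_box, sum_box _ fun z => H z * strFun M j V z,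
    ← sum_fiberwise_of_maps_to (s := cube k M) (t := Icc (-((k ^ 2 * M : ℕ) : ℤ)) (k ^ 2 * M : ℕ))
      (g := psi j) fun y hy => mem_Icc.2 (abs_le.1 (abs_psi_le j hy))]
  have h1 : ∀ z, H z * strFun M j V z = ((2 * M + 1 : ℝ) ^ (k - 1))⁻¹ *
      ∑ y ∈ (cube k M).filter (fun y => psi j y = z), H (psi j y) * ∏ i ∈ univ.erase j, V i y := by
    intro z
    rw [strFun, mul_left_comm, mul_sum]
    congr 1
    exact sum_congr rfl fun y hy => by rw [(mem_filter.1 hy).2]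
  simp only [h1]
  rw [← mul_sum]
  have h2 : (2 * M + 1 : ℝ) ^ k = (2 * M + 1) ^ (k - 1) * (2 * M + 1) := by
    rw [← pow_succ, Nat.sub_add_cancel hk]
  have h3 : (0 : ℝ) < 2 * M + 1 := by positivity
  have h4 : (0 : ℝ) < 2 * (k ^ 2 * M : ℕ) + 1 := by positivity
  rw [h2]
  field_simp

lemma exists_two_ne (hk : 3 ≤ k) (j : Fin k) : ∃ a b : Fin k, a ≠ j ∧ b ≠ j ∧ a ≠ b := by
  have : 1 < (univ.erase j).card := by
    rw [card_erase_of_mem (mem_univ j), card_univ, Fintype.card_fin]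
    omega
  obtain ⟨a, ha, b, hb, hab⟩ := one_lt_card.1 this
  exact ⟨a, b, (mem_erase.1 ha).1, (mem_erase.1 hb).1, hab⟩

lemma mem_cube_of_update (hk : 3 ≤ k) {j : Fin k} {N : ℕ} {y : Fin k → ℤ}
    (h : ∀ i ≠ j, Function.update y i 0 ∈ cube k N) : y ∈ cube k N := by
  obtain ⟨a, b, ha, hb, hab⟩ := exists_two_ne hk j
  refine mem_cube.2 fun i => ?_
  by_cases hi : i = a
  · have := mem_cube.1 (h b hb) i
    rwa [Function.update_of_ne (by rw [hi]; exact hab)] at this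
  · have := mem_cube.1 (h a ha) i
    rwa [Function.update_of_ne hi] at this

lemma update_mem_cube {N : ℕ} {y : Fin k → ℤ} (h : y ∈ cube k N) (i : Fin k) :
    Function.update y i 0 ∈ cube k N := by
  refine mem_cube.2 fun i' => ?_
  rcases eq_or_ne i' i with rfl | hi
  · simp
  · rw [Function.update_of_ne hi]
    exact mem_cube.1 h i'

/-- Weights on a cube, extended to all integer points. -/
def extendWeight (M : ℕ) (u : Fin k → (Fin k → Box M) → ℝ) (i : Fin k) (y : Fin k → ℤ) : ℝ :=
  if h : Function.update y i 0 ∈ cube k M then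
    u i fun i' => ⟨Function.update y i 0 i', mem_Icc.2 (abs_le.1 (mem_cube.1 h i'))⟩
  else 0

lemma extendWeight_coeBox {M : ℕ} {u : Fin k → (Fin k → Box M) → ℝ} (hu : ∀ i, Indep i (u i))
    (i : Fin k) (x : Fin k → Box M) : extendWeight M u i (coeBox x) = u i x := by
  have h : coeBox x ∈ cube k M := mem_cube.2 fun i => abs_le.2 (mem_Icc.1 (x i).2)
  rw [extendWeight, dif_pos (update_mem_cube h i)]
  rw [← hu i x ⟨0, by simp⟩]
  congr 1
  funext i'
  rcases eq_or_ne i' i with rfl | hi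
  · simp
  · apply Subtype.ext
    simp [Function.update_of_ne hi, coeBox]

lemma admissible_extendWeight (hk : 3 ≤ k) {M : ℕ} (j : Fin k) {u : Fin k → (Fin k → Box M) → ℝ}
    (hu0 : ∀ i x, 0 ≤ u i x) (hu1 : ∀ i x, u i x ≤ 1) : Admissible M j (extendWeight M u) where
  indep i p q := by simp only [extendWeight, Function.update_idem]
  nonneg i y := by
    rw [extendWeight]
    split_ifs
    exacts [hu0 _ _, le_rfl]
  le_one i y := by
    rw [extendWeight]
    split_ifs
    exacts [hu1 _ _, zero_le_one]
  mem y hy := by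
    refine mem_cube_of_update hk (j := j) fun i hi => ?_
    by_contra hne
    refine (prod_ne_zero_iff.1 hy) i (mem_erase.2 ⟨hi, mem_univ i⟩) ?_
    rw [extendWeight, dif_neg hne]

lemma cutClose_of_strFun (hk : 3 ≤ k) {M : ℕ} {f g : ℤ → ℝ} {η : ℝ}
    (h : ∀ (j : Fin k) (V : Fin k → (Fin k → ℤ) → ℝ), Admissible M j V →
      |𝔼 z : Box (k ^ 2 * M), (f z - g z) * strFun M j V z| ≤ η) :
    CutClose (fun (j : Fin k) (x : Fin k → Box M) => f (psi j (coeBox x)))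
      (fun j x => g (psi j (coeBox x))) (k ^ 2 * η) := by
  intro j u hu hu0 hu1
  have e := expect_psi_mul (by omega) M j (extendWeight M u) fun z => f z - g z
  simp only [extendWeight_coeBox hu] at e
  rw [e, abs_mul, abs_of_nonneg (by positivity)]
  refine mul_le_mul ?_ (h j _ (admissible_extendWeight hk j hu0 hu1)) (abs_nonneg _) (by positivity)
  rw [div_le_iff₀ (by positivity)]
  push_cast
  have : (1 : ℝ) ≤ k ^ 2 := one_le_pow₀ (by exact_mod_cast (by omega : 1 ≤ k))
  linarith

/-- The point of `ℤ ^ (n + 2)` at which the forms `psi` form a progression, parametrised by its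
first term and all but one of the coordinates. -/
def point {n : ℕ} (a s : ℤ) (t : Fin n → ℤ) : Fin (n + 2) → ℤ :=
  Fin.cons s (Fin.cons (-a - ∑ i : Fin n, ((i : ℕ) + 2 : ℤ) * t i) t)

lemma psi_point {n : ℕ} (j : Fin (n + 2)) (a s : ℤ) (t : Fin n → ℤ) :
    psi j (point a s t) = a + (j : ℕ) *
      (s + (-a - ∑ i : Fin n, ((i : ℕ) + 2 : ℤ) * t i) + ∑ i, t i) := by
  simp only [psi, point, Fin.sum_univ_succ, Fin.cons_zero, Fin.cons_succ, Fin.val_zero,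
    Fin.val_succ, mul_add, mul_sum, sub_mul, sum_sub_distrib, add_mul]
  push_cast
  simp only [add_mul, sum_add_distrib, mul_sum, mul_sub, one_mul, ← sum_mul, ← mul_sum]
  ring

lemma point_inj {n : ℕ} {a a' s s' : ℤ} {t t' : Fin n → ℤ} (h : point a s t = point a' s' t') :
    a = a' ∧ s = s' ∧ t = t' := by
  rw [point, point, Fin.cons_inj, Fin.cons_inj] at h
  obtain ⟨h1, h2, rfl⟩ := h
  exact ⟨by linarith, h1, rfl⟩

lemma abs_sum_mul_le {n T : ℕ} {t : Fin n → ℤ} (ht : ∀ i, |t i| ≤ T) :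
    |∑ i : Fin n, ((i : ℕ) + 2 : ℤ) * t i| ≤ n * (n + 1) * T := by
  refine (abs_sum_le_sum_abs _ _).trans ?_
  refine (sum_le_card_nsmul _ _ ((n + 1 : ℤ) * T) fun i _ => ?_).trans (le_of_eq ?_)
  · rw [abs_mul]
    have : |((i : ℕ) + 2 : ℤ)| ≤ n + 1 := by
      rw [abs_of_nonneg (by positivity)]
      have := i.2
      omega
    exact mul_le_mul this (ht i) (abs_nonneg _) (by positivity)
  · simp
    ring

end

noncomputable section

/-- The indicator weights of a smaller cube. -/
def cubeWeight (k N : ℕ) (i : Fin k) (y : Fin k → ℤ) : ℝ :=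
  if Function.update y i 0 ∈ cube k N then 1 else 0

lemma prod_cubeWeight {k : ℕ} (hk : 3 ≤ k) (N : ℕ) (j : Fin k) (y : Fin k → ℤ) :
    ∏ i ∈ univ.erase j, cubeWeight k N i y = if y ∈ cube k N then 1 else 0 := by
  split_ifs with h
  · exact prod_eq_one fun i _ => if_pos (update_mem_cube h i)
  · by_contra hne
    refine h (mem_cube_of_update hk (j := j) fun i hi => ?_)
    by_contra h'
    exact prod_ne_zero_iff.1 hne i (mem_erase.2 ⟨hi, mem_univ i⟩) (if_neg h')

lemma cube_subset {k N M : ℕ} (h : N ≤ M) : cube k N ⊆ cube k M := fun _ hy =>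
  mem_cube.2 fun i => (mem_cube.1 hy i).trans (by exact_mod_cast h)

lemma admissible_cubeWeight {k : ℕ} (hk : 3 ≤ k) {N M : ℕ} (h : N ≤ M) (j : Fin k) :
    Admissible M j (cubeWeight k N) where
  indep i p q := by simp only [cubeWeight, Function.update_idem]
  nonneg i y := by
    rw [cubeWeight]
    split_ifs <;> norm_num
  le_one i y := by
    rw [cubeWeight]
    split_ifs <;> norm_num
  mem y hy := by
    rw [prod_cubeWeight hk] at hy
    by_contra hne
    exact hy (if_neg fun h' => hne (cube_subset h h'))

lemma strFun_cubeWeight {k : ℕ} (hk : 3 ≤ k) {N M : ℕ} (h : N ≤ M) (j : Fin k) (z : ℤ) :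
    strFun M j (cubeWeight k N) z = ((2 * M + 1 : ℝ) ^ (k - 1))⁻¹ *
      ((cube k N).filter fun y => psi j y = z).card := by
  rw [strFun]
  simp only [prod_cubeWeight hk]
  rw [← sum_filter, filter_comm, filter_mem_eq_inter, inter_eq_right.2 (cube_subset h)]
  simp

lemma le_card_filter_psi {n N T : ℕ} (hT : n * (n + 1) * T ≤ N) (hTN : T ≤ N) {z : ℤ} (hz : 0 ≤ z)
    (hzN : z ≤ N) :
    (T + 1) ^ (n + 1) ≤ ((cube (n + 2) N).filter fun y => psi 0 y = z).card := by
  have e : (Icc (-(T : ℤ)) 0 ×ˢ Fintype.piFinset fun _ : Fin n => Icc (-(T : ℤ)) 0).card =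
      (T + 1) ^ (n + 1) := by
    simp [card_product, Fintype.card_piFinset, pow_succ']
    norm_cast
    rw [add_comm]
  rw [← e]
  refine card_le_card_of_injOn (fun p => point z p.1 p.2) ?_ ?_
  · rintro ⟨s, t⟩ hp
    simp only [mem_coe, mem_product, mem_Icc, Fintype.mem_piFinset] at hp
    obtain ⟨hs, ht⟩ := hp
    refine mem_coe.2 (mem_filter.2 ⟨mem_cube.2 fun i => ?_, by simp [psi_point]⟩)
    have h1 : |∑ i : Fin n, ((i : ℕ) + 2 : ℤ) * t i| ≤ n * (n + 1) * T :=
      abs_sum_mul_le fun i => abs_le.2 ⟨(ht i).1, (ht i).2.trans (by positivity)⟩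
    have h2 : ∑ i : Fin n, ((i : ℕ) + 2 : ℤ) * t i ≤ 0 :=
      sum_nonpos fun i _ => mul_nonpos_of_nonneg_of_nonpos (by positivity) (ht i).2
    have h3 : (n * (n + 1) * T : ℤ) ≤ N := by exact_mod_cast hT
    have h4 : (T : ℤ) ≤ N := by exact_mod_cast hTN
    rw [abs_le] at h1 ⊢
    refine Fin.cases ?_ (fun i => Fin.cases ?_ (fun i => ?_) i) i
    · simp only [point, Fin.cons_zero]
      omega
    · simp only [point, Fin.cons_succ, Fin.cons_zero]
      constructor <;> linarith
    · simp only [point, Fin.cons_succ]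
      have := ht i
      omega
  · rintro ⟨s, t⟩ - ⟨s', t'⟩ - h
    obtain ⟨-, h1, h2⟩ := point_inj h
    exact Prod.ext h1 h2

lemma mass_le {n : ℕ} (hn : 1 ≤ n) {N : ℕ} (hN : 1 ≤ N) {f g : ℤ → ℝ} {δ η : ℝ} (hf0 : ∀ z, 0 ≤ f z)
    (hg0 : ∀ z, 0 ≤ g z) (hf : δ * N ≤ ∑ z ∈ Ico (0 : ℤ) N, f z)
    (h : |𝔼 z : Box ((n + 2) ^ 2 * (10 * (n + 2) ^ 2 * N)), (f z - g z) *
      strFun (10 * (n + 2) ^ 2 * N) (0 : Fin (n + 2)) (cubeWeight (n + 2) N) z| ≤ η) :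
    ((21 * (n + 2) ^ 4 : ℝ)⁻¹ ^ (n + 1) * δ - 21 * (n + 2) ^ 4 * η) * N ≤
      ∑ z ∈ Icc (-(((n + 2) ^ 2 * N : ℕ) : ℤ)) ((n + 2) ^ 2 * N : ℕ), g z := by
  set q : ℕ := (n + 2) ^ 2 with hq
  set M : ℕ := 10 * q * N with hM
  set W := strFun M (0 : Fin (n + 2)) (cubeWeight (n + 2) N) with hW
  have hq1 : 1 ≤ q := Nat.one_le_pow _ _ (by omega)
  have hNM : N ≤ M := Nat.le_mul_of_pos_left _ (by omega)
  have hA := admissible_cubeWeight (by omega : 3 ≤ n + 2) hNM 0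
  have hNr : (1 : ℝ) ≤ N := by exact_mod_cast hN
  have hqr : (1 : ℝ) ≤ q := by exact_mod_cast hq1
  have hqn : ((n : ℝ) + 2) ^ 4 = q ^ 2 := by
    rw [hq]
    push_cast
    ring
  have hqN : (1 : ℝ) ≤ q * N := by nlinarith
  have hMr : (2 * M + 1 : ℝ) ≤ 21 * q * N := by
    rw [hM]
    push_cast
    nlinarith
  have low : ∀ z ∈ Ico (0 : ℤ) N, (21 * q ^ 2 : ℝ)⁻¹ ^ (n + 1) ≤ W z := by
    intro z hz
    rw [mem_Ico] at hz
    have hdiv : q * (N / q) ≤ N := Nat.mul_div_le N q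
    have h1 : n * (n + 1) * (N / q) ≤ N := by
      refine le_trans (Nat.mul_le_mul_right _ ?_) hdiv
      rw [hq]
      nlinarith
    have h2 := le_card_filter_psi h1 (Nat.div_le_self _ _) hz.1 hz.2.le
    have h3 : (N : ℝ) / q ≤ (N / q : ℕ) + 1 := by
      rw [div_le_iff₀ (by positivity)]
      have := Nat.lt_mul_div_succ N (by omega : 0 < q)
      have h4 : (N : ℝ) ≤ q * ((N / q : ℕ) + 1) := by exact_mod_cast this.le
      linarith
    rw [hW, strFun_cubeWeight (by omega) hNM, show n + 2 - 1 = n + 1 by omega, ← inv_pow]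
    calc (21 * q ^ 2 : ℝ)⁻¹ ^ (n + 1) = ((21 * q * N : ℝ)⁻¹) ^ (n + 1) * (N / q) ^ (n + 1) := by
          rw [← mul_pow]
          congr 1
          field_simp
      _ ≤ (2 * M + 1 : ℝ)⁻¹ ^ (n + 1) * ((N / q : ℕ) + 1) ^ (n + 1) := by gcongr
      _ ≤ _ := by
          gcongr
          exact_mod_cast h2
  have hsub : Ico (0 : ℤ) N ⊆ Icc (-((q * M : ℕ) : ℤ)) (q * M : ℕ) := by
    intro z hz
    rw [mem_Ico] at hz
    rw [mem_Icc]
    have : (N : ℤ) ≤ (q * M : ℕ) := by exact_mod_cast hNM.trans (Nat.le_mul_of_pos_left _ (by omega))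
    omega
  have hfW : (21 * q ^ 2 : ℝ)⁻¹ ^ (n + 1) * δ * N ≤ ∑ z : Box (q * M), f z * W z := by
    rw [sum_box _ fun z => f z * W z]
    refine le_trans ?_ (sum_le_sum_of_subset_of_nonneg hsub fun z _ _ =>
      mul_nonneg (hf0 z) (hA.strFun_nonneg z))
    calc (21 * q ^ 2 : ℝ)⁻¹ ^ (n + 1) * δ * N ≤ (21 * q ^ 2 : ℝ)⁻¹ ^ (n + 1) *
          ∑ z ∈ Ico (0 : ℤ) N, f z := by
          rw [mul_assoc]
          gcongr
      _ ≤ _ := by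
          rw [mul_comm, sum_mul]
          exact sum_le_sum fun z hz => mul_le_mul_of_nonneg_left (low z hz) (hf0 z)
  have hgW : ∑ z : Box (q * M), g z * W z ≤ ∑ z ∈ Icc (-((q * N : ℕ) : ℤ)) (q * N : ℕ), g z := by
    rw [sum_box _ fun z => g z * W z]
    have : ∀ z ∈ Icc (-((q * M : ℕ) : ℤ)) (q * M : ℕ), z ∉ Icc (-((q * N : ℕ) : ℤ)) (q * N : ℕ) →
        g z * W z = 0 := by
      intro z _ hz
      by_contra hne
      have h1 := right_ne_zero_of_mul hne
      rw [hW, strFun_cubeWeight (by omega) hNM] at h1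
      have h2 := right_ne_zero_of_mul h1
      rw [Nat.cast_ne_zero, card_ne_zero] at h2
      obtain ⟨y, hy⟩ := h2
      rw [mem_filter] at hy
      refine hz (mem_Icc.2 (abs_le.1 ?_))
      rw [← hy.2]
      exact abs_psi_le 0 hy.1
    rw [← sum_subset (s₁ := Icc (-((q * N : ℕ) : ℤ)) (q * N : ℕ)) ?_ this]
    · exact sum_le_sum fun z _ => mul_le_of_le_one_right (hg0 z) (hA.strFun_le_one (by omega) z)
    · refine Icc_subset_Icc ?_ ?_
      · rw [neg_le_neg_iff]
        exact_mod_cast Nat.mul_le_mul_left q hNM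
      · exact_mod_cast Nat.mul_le_mul_left q hNM
  rw [Fintype.expect_eq_sum_div_card, card_box, abs_div, abs_of_nonneg (by positivity :
    (0 : ℝ) ≤ 2 * (q * M : ℕ) + 1), div_le_iff₀ (by positivity)] at h
  have h5 := (le_abs_self _).trans h
  simp only [sub_mul, sum_sub_distrib] at h5
  have hη : 0 ≤ η := by
    by_contra hneg
    push Not at hneg
    have h6 : 0 ≤ η * (2 * (q * M : ℕ) + 1) := (abs_nonneg _).trans h
    have h7 : (0 : ℝ) < 2 * (q * M : ℕ) + 1 := by positivity
    nlinarith
  have h6 : (2 * (q * M : ℕ) + 1 : ℝ) ≤ 21 * q ^ 2 * N := by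
    push_cast
    nlinarith
  have h7 := mul_le_mul_of_nonneg_left h6 hη
  rw [hqn]
  linarith

lemma progressions_le {n N : ℕ} (hN : 1 ≤ N) {g : ℤ → ℝ} (hg0 : ∀ z, 0 ≤ g z) {B : ℝ}
    (h : B ≤ ∑ p ∈ Icc (-2 * ((n + 2) ^ 2 * N : ℕ) : ℤ) (2 * ((n + 2) ^ 2 * N : ℕ)) ×ˢ
      Icc (-2 * ((n + 2) ^ 2 * N : ℕ) : ℤ) (2 * ((n + 2) ^ 2 * N : ℕ)),
      ∏ j : Fin (n + 1 + 1), g (p.1 + (j : ℕ) * p.2)) :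
    B * N ^ n ≤ (21 * (n + 2) ^ 2 * N) ^ (n + 2) *
      𝔼 x : Fin (n + 2) → Box (10 * (n + 2) ^ 2 * N), ∏ j, g (psi j (coeBox x)) := by
  set q : ℕ := (n + 2) ^ 2 with hq
  set M : ℕ := 10 * q * N with hM
  have hqr : (1 : ℝ) ≤ q := by exact_mod_cast Nat.one_le_pow _ _ (by omega)
  have hNr : (1 : ℝ) ≤ N := by exact_mod_cast hN
  have hqN : (1 : ℝ) ≤ q * N := by nlinarith
  have hMr : (2 * M + 1 : ℝ) ≤ 21 * q * N := by
    rw [hM]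
    push_cast
    nlinarith
  have hqn : ((n : ℝ) + 2) ^ 2 = q := by
    rw [hq]
    push_cast
    ring
  set S := Icc (-2 * (q * N : ℕ) : ℤ) (2 * (q * N : ℕ)) ×ˢ Icc (-2 * (q * N : ℕ) : ℤ) (2 * (q * N : ℕ))
    with hS
  rw [expect_coeBox M fun y => ∏ j, g (psi j y), hqn]
  set Φ : (ℤ × ℤ) × (Fin n → ℤ) → Fin (n + 2) → ℤ := fun r => point r.1.1
    (r.1.2 + r.1.1 + ∑ i : Fin n, ((i : ℕ) + 2 : ℤ) * r.2 i - ∑ i, r.2 i) r.2 with hΦ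
  have hpsi : ∀ r j, psi j (Φ r) = r.1.1 + (j : ℕ) * r.1.2 := by
    intro r j
    rw [hΦ, psi_point]
    ring
  have hinj : Function.Injective Φ := by
    rintro ⟨⟨a, d⟩, t⟩ ⟨⟨a', d'⟩, t'⟩ h
    obtain ⟨h1, h2, h3⟩ := point_inj h
    dsimp only at h1 h2 h3
    subst h1 h3
    have : d = d' := by linarith
    rw [this]
  have hmem : ∀ r ∈ S ×ˢ cube n N, Φ r ∈ cube (n + 2) M := by
    rintro ⟨⟨a, d⟩, t⟩ hr
    simp only [hS, mem_product, mem_Icc] at hr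
    obtain ⟨⟨ha, hd⟩, ht⟩ := hr
    have ht' := mem_cube.1 ht
    have h1 := abs_le.1 (abs_sum_mul_le ht')
    have h2 : |∑ i, t i| ≤ n * N := (abs_sum_le_sum_abs _ _).trans
      ((sum_le_card_nsmul _ _ (N : ℤ) fun i _ => ht' i).trans (by simp))
    rw [abs_le] at h2
    have h3 : (n * (n + 1) * N + n * N : ℤ) ≤ q * N := by
      rw [hq]
      push_cast
      nlinarith [mul_nonneg (Nat.cast_nonneg (α := ℤ) n) (Nat.cast_nonneg (α := ℤ) N)]
    have h4 : (0 : ℤ) ≤ n * N := by positivity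
    have h5 : (0 : ℤ) ≤ n * (n + 1) * N := by positivity
    have h6 : (N : ℤ) ≤ q * N := le_mul_of_one_le_left (by positivity)
      (by exact_mod_cast Nat.one_le_pow _ _ (by omega))
    have h7 : (M : ℤ) = 10 * (q * N) := by
      rw [hM]
      push_cast
      ring
    push_cast at ha hd
    refine mem_cube.2 fun i => abs_le.2 ?_
    rw [h7]
    refine Fin.cases ?_ (fun i => Fin.cases ?_ (fun i => ?_) i) i
    · simp only [hΦ, point, Fin.cons_zero]
      constructor <;> linarith
    · simp only [hΦ, point, Fin.cons_succ, Fin.cons_zero]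
      constructor <;> linarith
    · simp only [hΦ, point, Fin.cons_succ]
      have := abs_le.1 (ht' i)
      constructor <;> linarith
  have h1 : ∑ r ∈ S ×ˢ cube n N, ∏ j, g (psi j (Φ r)) ≤ ∑ y ∈ cube (n + 2) M, ∏ j, g (psi j y) := by
    rw [← sum_image (f := fun y => ∏ j, g (psi j y)) hinj.injOn]
    exact sum_le_sum_of_subset_of_nonneg (image_subset_iff.2 hmem) fun y _ _ =>
      prod_nonneg fun j _ => hg0 _
  have h2 : ∑ r ∈ S ×ˢ cube n N, ∏ j, g (psi j (Φ r)) =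
      (∑ p ∈ S, ∏ j : Fin (n + 1 + 1), g (p.1 + (j : ℕ) * p.2)) * (2 * N + 1) ^ n := by
    simp only [hpsi]
    rw [sum_product, sum_mul]
    refine sum_congr rfl fun p _ => ?_
    dsimp only
    rw [sum_const, nsmul_eq_mul, mul_comm]
    congr 1
    rw [cube, Fintype.card_piFinset]
    simp only [Int.card_Icc, prod_const, card_univ, Fintype.card_fin]
    push_cast
    congr 1
    have : ((N : ℤ) + 1 - -N).toNat = 2 * N + 1 := by omega
    rw [this]
    push_cast
    ring
  have h0 : 0 ≤ ∑ p ∈ S, ∏ j : Fin (n + 1 + 1), g (p.1 + (j : ℕ) * p.2) :=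
    sum_nonneg fun p _ => prod_nonneg fun j _ => hg0 _
  have h3 : 0 ≤ ∑ y ∈ cube (n + 2) M, ∏ j, g (psi j y) :=
    sum_nonneg fun p _ => prod_nonneg fun j _ => hg0 _
  calc B * N ^ n ≤ (∑ p ∈ S, ∏ j : Fin (n + 1 + 1), g (p.1 + (j : ℕ) * p.2)) * (2 * N + 1) ^ n := by
        gcongr
        linarith
    _ ≤ ∑ y ∈ cube (n + 2) M, ∏ j, g (psi j y) := h2 ▸ h1
    _ = (2 * M + 1 : ℝ) ^ (n + 2) * ((∑ y ∈ cube (n + 2) M, ∏ j, g (psi j y)) /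
        (2 * M + 1) ^ (n + 2)) := by field_simp
    _ ≤ _ := by gcongr

theorem relative_szemeredi {n : ℕ} (hn : 1 ≤ n) {δ : ℝ} (hδ : 0 < δ) :
    ∃ ε > 0, ∃ c > 0, ∃ N₀ : ℕ, ∀ N, N₀ ≤ N → ∀ ν f : ℤ → ℝ,
      PseudoRandom ν ((n + 2) * 2 ^ (n + 2)) (n + 2).factorial N ε → (∀ z, 0 ≤ f z) →
      (∀ z, f z ≤ ν z) → δ * N ≤ ∑ z ∈ Ico (0 : ℤ) N, f z →
      c ≤ 𝔼 x : Fin (n + 2) → Box (10 * (n + 2) ^ 2 * N), ∏ j, f (psi j (coeBox x)) := by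
  set Q : ℝ := 21 * (n + 2) ^ 4 with hQ
  have hQ0 : 0 < Q := by positivity
  set c₀ : ℝ := Q⁻¹ ^ (n + 1) * δ with hc₀
  have hc₀0 : 0 < c₀ := by positivity
  obtain ⟨c, hc, N₁, hS⟩ := szemeredi (n + 1) (δ := c₀ / 2 / (n + 2) ^ 2) (by positivity)
  set c' : ℝ := c / (21 * (n + 2) ^ 2) ^ (n + 2) with hc'
  have hc'0 : 0 < c' := by positivity
  obtain ⟨ε₁, hε₁, hcount⟩ := counting (Fin (n + 2)) univ (c' / 2) (by positivity)
  obtain ⟨ε₂, hε₂, hmodel⟩ := exists_dense_model (k := n + 2) (by omega)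
    (η := min (c₀ / (2 * Q)) (ε₁ / ((n + 2 : ℕ) : ℝ) ^ 2)) (by positivity)
  refine ⟨min ε₁ ε₂, by positivity, c' / 2, by positivity, N₁ + 1, ?_⟩
  intro N hN ν f hν hf0 hfν hf
  have hN1 : 1 ≤ N := by omega
  have hNr : (1 : ℝ) ≤ N := by exact_mod_cast hN1
  have hp1 : 1 ≤ (n + 2) ^ 2 := Nat.one_le_pow _ _ (by omega)
  have hNM : N ≤ 10 * (n + 2) ^ 2 * N := Nat.le_mul_of_pos_left _ (by omega)
  obtain ⟨g, hg0, hg1, hg⟩ := hmodel ν N (fun V I _ _ _ L a h1 h2 h3 h4 h5 h6 =>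
    (hν V I L a h1 h2 h3 h4 h5 h6).trans (min_le_right _ _)) _ hNM f hf0 hfν
  have hν' : PseudoRandom ν ((n + 2) * 2 ^ (n + 2)) (n + 2).factorial N ε₁ :=
    fun V I _ _ _ L a h1 h2 h3 h4 h5 h6 =>
      (hν V I L a h1 h2 h3 h4 h5 h6).trans (min_le_left _ _)
  have hmass := mass_le hn hN1 hf0 hg0 hf ((hg 0 _ (admissible_cubeWeight (by omega) hNM 0)).trans
    (min_le_left _ _))
  have hmass' : c₀ / 2 / (n + 2) ^ 2 * ((n + 2) ^ 2 * N : ℕ) ≤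
      ∑ z ∈ Icc (-(((n + 2) ^ 2 * N : ℕ) : ℤ)) ((n + 2) ^ 2 * N : ℕ), g z := by
    refine le_trans (le_of_eq ?_) hmass
    push_cast
    rw [← hQ, ← hc₀]
    field_simp
    ring
  have hsz := hS ((n + 2) ^ 2 * N) ((by omega : N₁ ≤ N).trans (Nat.le_mul_of_pos_left _ hp1)) g hg0
    hg1 hmass'
  have hap := progressions_le (n := n) hN1 hg0 (hsz.trans (sum_le_sum fun p _ =>
    prod_le_prod (fun j _ => by split_ifs; exacts [hg0 _, le_rfl]) fun j _ => by
      split_ifs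
      exacts [le_rfl, hg0 _]))
  have hgc : c' ≤ 𝔼 x : Fin (n + 2) → Box (10 * (n + 2) ^ 2 * N), ∏ j, g (psi j (coeBox x)) := by
    rw [hc', div_le_iff₀ (by positivity)]
    have h1 : c * (N : ℝ) ^ (n + 2) ≤ c * (((n + 2) ^ 2 * N : ℕ) : ℝ) ^ 2 * N ^ n := by
      have : (N : ℝ) ≤ ((n + 2) ^ 2 * N : ℕ) := by
        exact_mod_cast Nat.le_mul_of_pos_left N hp1
      calc c * (N : ℝ) ^ (n + 2) = c * N ^ 2 * N ^ n := by ring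
        _ ≤ _ := by gcongr
    have h2 := h1.trans hap
    rw [mul_pow] at h2
    have h3 : (0 : ℝ) < (N : ℝ) ^ (n + 2) := by positivity
    refine le_of_mul_le_mul_right ?_ h3
    linarith
  have hcut := cutClose_of_strFun (by omega) fun j V hV =>
    (hg j V hV).trans (min_le_right _ _)
  have hfin := hcount (Box (10 * (n + 2) ^ 2 * N)) (fun j x => ν (psi j (coeBox x)))
    (fun j x => f (psi j (coeBox x))) (fun j x => g (psi j (coeBox x)))
    (fun _ _ => (hf0 _).trans (hfν _)) (hν'.linForms (by omega) hNM) (fun j => indep_psi j ν)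
    (fun j => indep_psi j f) (fun j => indep_psi j g) (fun _ _ => hf0 _) (fun _ _ => hfν _)
    (fun _ _ => hg0 _) (fun _ _ => hg1 _) (fun i hi => absurd (mem_univ i) hi) (by
      convert hcut using 1
      field_simp)
  linarith [(abs_le.1 hfin).1]

end

noncomputable section

/-- Euler's totient of the product of a set of primes. -/
def phi (s : Finset ℕ) : ℝ := ∏ p ∈ s, ((p : ℝ) - 1)

/-- The normalising factor of the Selberg sieve. -/
def sieveSum (P : Finset ℕ) (R : ℕ) : ℝ :=
  ∑ s ∈ P.powerset.filter (fun s => ∏ p ∈ s, p ≤ R), (phi s)⁻¹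

/-- The diagonalised Selberg weights. -/
def diagWeight (P : Finset ℕ) (R : ℕ) (s : Finset ℕ) : ℝ :=
  if ∏ p ∈ s, p ≤ R then (sieveSum P R * phi s)⁻¹ else 0

/-- The Selberg weights, indexed by sets of primes. -/
def selberg (P : Finset ℕ) (R : ℕ) (D : Finset ℕ) : ℝ :=
  (-1) ^ D.card * (∏ p ∈ D, (p : ℝ)) * ∑ s ∈ P.powerset.filter (fun s => D ⊆ s), diagWeight P R s

variable {P : Finset ℕ} {R : ℕ}

lemma one_le_phi {s : Finset ℕ} (hs : ∀ p ∈ s, p.Prime) : 1 ≤ phi s := by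
  refine (prod_const_one (s := s)).symm.trans_le
    (prod_le_prod (fun _ _ => zero_le_one) fun p hp => ?_)
  have : (2 : ℝ) ≤ p := by exact_mod_cast (hs p hp).two_le
  linarith

lemma phi_pos {s : Finset ℕ} (hs : ∀ p ∈ s, p.Prime) : 0 < phi s :=
  zero_lt_one.trans_le (one_le_phi hs)

lemma prod_mono_primes {s t : Finset ℕ} (ht : ∀ p ∈ t, p.Prime) (h : s ⊆ t) :
    ∏ p ∈ s, p ≤ ∏ p ∈ t, p :=
  prod_le_prod_of_subset_of_one_le' h fun p hp _ => (ht p hp).one_le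

lemma phi_mono {s t : Finset ℕ} (ht : ∀ p ∈ t, p.Prime) (h : s ⊆ t) : phi s ≤ phi t := by
  rw [phi, phi, ← prod_sdiff h]
  refine le_mul_of_one_le_left (phi_pos fun p hp => ht p (h hp)).le ?_
  exact one_le_phi fun p hp => ht p (mem_sdiff.1 hp).1

lemma one_le_sieveSum (hP : ∀ p ∈ P, p.Prime) (hR : 1 ≤ R) : 1 ≤ sieveSum P R := by
  have h : (phi ∅)⁻¹ ≤ sieveSum P R := by
    refine single_le_sum (f := fun s => (phi s)⁻¹) (fun s hs => ?_) (by simpa using hR)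
    rw [mem_filter, mem_powerset] at hs
    exact (inv_pos.2 (phi_pos fun p hp => hP p (hs.1 hp))).le
  simpa [phi] using h

lemma card_filter_prod_le (hP : ∀ p ∈ P, p.Prime) :
    (P.powerset.filter fun s => ∏ p ∈ s, p ≤ R).card ≤ R := by
  have := card_le_card_of_injOn (s := P.powerset.filter fun s => ∏ p ∈ s, p ≤ R) (t := Icc 1 R)
    (fun s => ∏ p ∈ s, p) ?_ ?_
  · simpa using this
  · intro s hs
    rw [mem_coe, mem_filter, mem_powerset] at hs
    exact mem_coe.2 (mem_Icc.2 ⟨Nat.one_le_iff_ne_zero.2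
      (prod_ne_zero_iff.2 fun p hp => (hP p (hs.1 hp)).ne_zero), hs.2⟩)
  · intro s hs t ht h
    rw [mem_coe, mem_filter, mem_powerset] at hs ht
    rw [← Nat.primeFactors_prod fun p hp => hP p (hs.1 hp),
      ← Nat.primeFactors_prod fun p hp => hP p (ht.1 hp)]
    exact congrArg Nat.primeFactors h

lemma sieveSum_le (hP : ∀ p ∈ P, p.Prime) : sieveSum P R ≤ R := by
  refine (sum_le_card_nsmul _ _ 1 fun s hs => ?_).trans ?_
  · rw [mem_filter, mem_powerset] at hs
    exact inv_le_one_of_one_le₀ (one_le_phi fun p hp => hP p (hs.1 hp))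
  · simpa using card_filter_prod_le hP

lemma diagWeight_nonneg (hP : ∀ p ∈ P, p.Prime) (hR : 1 ≤ R) {s : Finset ℕ} (hs : s ⊆ P) :
    0 ≤ diagWeight P R s := by
  rw [diagWeight]
  split_ifs
  · have := one_le_sieveSum hP hR
    have := phi_pos fun p hp => hP p (hs hp)
    positivity
  · exact le_rfl

lemma sum_diagWeight (hP : ∀ p ∈ P, p.Prime) (hR : 1 ≤ R) :
    ∑ s ∈ P.powerset, diagWeight P R s = 1 := by
  have h := one_le_sieveSum hP hR
  simp only [diagWeight, ← sum_filter, mul_inv, ← mul_sum]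
  exact inv_mul_cancel₀ (by linarith)

lemma selberg_empty (hP : ∀ p ∈ P, p.Prime) (hR : 1 ≤ R) : selberg P R ∅ = 1 := by
  simp [selberg, sum_diagWeight hP hR]

lemma selberg_eq_zero (hP : ∀ p ∈ P, p.Prime) {D : Finset ℕ} (hD : R < ∏ p ∈ D, p) :
    selberg P R D = 0 := by
  rw [selberg, sum_eq_zero, mul_zero]
  intro s hs
  rw [mem_filter, mem_powerset] at hs
  exact if_neg (not_le.2 (hD.trans_le (prod_mono_primes (fun p hp => hP p (hs.1 hp)) hs.2)))

lemma abs_selberg_le (hP : ∀ p ∈ P, p.Prime) (hR : 1 ≤ R) (D : Finset ℕ) :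
    |selberg P R D| ≤ R := by
  rcases lt_or_ge R (∏ p ∈ D, p) with h | h
  · rw [selberg_eq_zero hP h, abs_zero]
    positivity
  · have h1 : 0 ≤ ∑ s ∈ P.powerset.filter (fun s => D ⊆ s), diagWeight P R s :=
      sum_nonneg fun s hs => diagWeight_nonneg hP hR (mem_powerset.1 (mem_filter.1 hs).1)
    have h2 : ∑ s ∈ P.powerset.filter (fun s => D ⊆ s), diagWeight P R s ≤ 1 := by
      rw [← sum_diagWeight hP hR]
      exact sum_le_sum_of_subset_of_nonneg (filter_subset _ _) fun s hs _ =>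
        diagWeight_nonneg hP hR (mem_powerset.1 hs)
    have h3 : (0 : ℝ) ≤ ∏ p ∈ D, (p : ℝ) := by positivity
    have h4 : ∏ p ∈ D, (p : ℝ) ≤ R := by
      rw [← Nat.cast_prod]
      exact_mod_cast h
    rw [selberg, abs_mul, abs_mul, abs_pow, abs_neg, abs_one, one_pow, one_mul, abs_of_nonneg h1,
      abs_of_nonneg h3]
    nlinarith

lemma prod_union_inv {U s t : Finset ℕ} (hU : ∀ p ∈ U, p.Prime) (hs : s ⊆ U) :
    ∏ p ∈ s ∪ t, (p : ℝ)⁻¹ = ∑ r ∈ U.powerset, phi r *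
      ((if r ⊆ s then ∏ p ∈ s, (p : ℝ)⁻¹ else 0) * if r ⊆ t then ∏ p ∈ t, (p : ℝ)⁻¹ else 0) := by
  have h1 : ∏ p ∈ s ∩ t, (p : ℝ) = ∑ r ∈ (s ∩ t).powerset, phi r := by
    have := prod_add_one (s := s ∩ t) (f := fun p : ℕ => (p : ℝ) - 1)
    simpa [phi] using this
  have h2 : ∏ p ∈ s ∪ t, (p : ℝ)⁻¹ =
      (∏ p ∈ s ∩ t, (p : ℝ)) * ((∏ p ∈ s, (p : ℝ)⁻¹) * ∏ p ∈ t, (p : ℝ)⁻¹) := by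
    rw [← prod_union_inter, mul_comm, mul_assoc, ← prod_mul_distrib, prod_eq_one (s := s ∩ t),
      mul_one]
    intro p hp
    refine inv_mul_cancel₀ ?_
    exact_mod_cast (hU p (hs (mem_inter.1 hp).1)).ne_zero
  have h3 : (s ∩ t).powerset = U.powerset.filter fun r => r ⊆ s ∧ r ⊆ t := by
    ext r
    simp only [mem_powerset, mem_filter, subset_inter_iff]
    exact ⟨fun h => ⟨h.1.trans hs, h⟩, fun h => h.2⟩
  rw [h2, h1, h3, sum_filter, sum_mul]
  refine sum_congr rfl fun r _ => ?_
  by_cases h4 : r ⊆ s <;> by_cases h5 : r ⊆ t <;> simp [h4, h5]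

lemma sum_neg_one_pow_eq_zero {s q r a : Finset ℕ} (h : ¬ s ⊆ q ∪ r) :
    ∑ D ∈ s.powerset.filter (fun D => D ∩ q = a ∧ r ⊆ D), (-1 : ℝ) ^ D.card = 0 := by
  obtain ⟨x, hx, hxq⟩ := not_subset.1 h
  rw [mem_union, not_or] at hxq
  refine sum_involution (fun D _ => if x ∈ D then D.erase x else insert x D) ?_ ?_ ?_ ?_
  · intro D _
    split_ifs with hD
    · have := card_erase_add_one hD
      rw [← this, pow_succ]
      ring
    · rw [card_insert_of_notMem hD, pow_succ]
      ring
  · intro D _ _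
    split_ifs with hD
    · exact fun h => (notMem_erase x D) (h.symm ▸ hD)
    · exact fun h => hD (h ▸ mem_insert_self x D)
  · intro D hD
    simp only [mem_filter, mem_powerset] at hD ⊢
    obtain ⟨h1, h2, h3⟩ := hD
    split_ifs with hD
    · refine ⟨(erase_subset _ _).trans h1, ?_, fun y hy => mem_erase.2 ⟨?_, h3 hy⟩⟩
      · rw [erase_inter, h2, erase_eq_of_notMem]
        rw [← h2]
        exact fun h => hxq.1 (mem_inter.1 h).2
      · rintro rfl
        exact hxq.2 hy
    · refine ⟨insert_subset hx h1, ?_, h3.trans (subset_insert _ _)⟩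
      rw [insert_inter_of_notMem hxq.1, h2]
  · intro D _
    by_cases hD : x ∈ D
    · simp [hD]
    · simp [hD]

lemma filter_inter_subset {s q r a : Finset ℕ} (h : s ⊆ q ∪ r) :
    s.powerset.filter (fun D => D ∩ q = a ∧ r ⊆ D) ⊆ {a ∪ r} := by
  intro D hD
  simp only [mem_filter, mem_powerset] at hD
  obtain ⟨h1, h2, h3⟩ := hD
  rw [mem_singleton]
  ext x
  rw [mem_union, ← h2, mem_inter]
  constructor
  · intro hx
    rcases mem_union.1 (h (h1 hx)) with hq | hr
    exacts [Or.inl ⟨hx, hq⟩, Or.inr hr]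
  · rintro (hx | hx)
    exacts [hx.1, h3 hx]

lemma abs_sum_neg_one_pow_le {s q r a : Finset ℕ} :
    |∑ D ∈ s.powerset.filter (fun D => D ∩ q = a ∧ r ⊆ D), (-1 : ℝ) ^ D.card| ≤
      if a ∪ r ⊆ s ∧ s ⊆ q ∪ r then 1 else 0 := by
  split_ifs with h
  · refine (abs_sum_le_sum_abs _ _).trans ?_
    refine (sum_le_sum_of_subset_of_nonneg (filter_inter_subset h.2)
      fun _ _ _ => abs_nonneg _).trans ?_
    simp
  · refine le_of_eq (abs_eq_zero.2 ?_)
    by_cases hs : s ⊆ q ∪ r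
    · rw [filter_eq_empty_iff.2, sum_empty]
      rintro D hD ⟨h2, h3⟩
      refine h ⟨union_subset ?_ (h3.trans (mem_powerset.1 hD)), hs⟩
      rw [← h2]
      exact inter_subset_left.trans (mem_powerset.1 hD)
    · exact sum_neg_one_pow_eq_zero hs

/-- The diagonal coordinates of the Selberg weights over the sets with a given trace on `q`. -/
def diagCoord (P : Finset ℕ) (R : ℕ) (q r a : Finset ℕ) : ℝ :=
  ∑ D ∈ P.powerset.filter (fun D => D ∩ q = a), selberg P R D *
    if r ⊆ D \ q then ∏ p ∈ D \ q, (p : ℝ)⁻¹ else 0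

lemma diagCoord_eq (hP : ∀ p ∈ P, p.Prime) {q r a : Finset ℕ} (hr : r ⊆ P \ q) :
    diagCoord P R q r a = (∏ p ∈ a, (p : ℝ)) * ∑ s ∈ P.powerset, diagWeight P R s *
      ∑ D ∈ s.powerset.filter (fun D => D ∩ q = a ∧ r ⊆ D), (-1 : ℝ) ^ D.card := by
  have h1 : ∀ D ∈ P.powerset.filter (fun D => D ∩ q = a), (selberg P R D *
      if r ⊆ D \ q then ∏ p ∈ D \ q, (p : ℝ)⁻¹ else 0) = (∏ p ∈ a, (p : ℝ)) *
      ∑ s ∈ P.powerset, diagWeight P R s *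
        if D ⊆ s ∧ r ⊆ D then (-1 : ℝ) ^ D.card else 0 := by
    intro D hD
    rw [mem_filter, mem_powerset] at hD
    have hrD : r ⊆ D \ q ↔ r ⊆ D := ⟨fun h => h.trans sdiff_subset, fun h x hx =>
      mem_sdiff.2 ⟨h hx, (mem_sdiff.1 (hr hx)).2⟩⟩
    by_cases hD' : r ⊆ D
    · have h2 : (∏ p ∈ D, (p : ℝ)) * ∏ p ∈ D \ q, (p : ℝ)⁻¹ = ∏ p ∈ a, (p : ℝ) := by
        rw [← hD.2, ← prod_inter_mul_prod_sdiff D q, mul_assoc, ← prod_mul_distrib,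
          prod_eq_one (s := D \ q), mul_one]
        intro p hp
        refine mul_inv_cancel₀ ?_
        exact_mod_cast (hP p (hD.1 (mem_sdiff.1 hp).1)).ne_zero
      simp only [hrD, hD', if_true, and_true, mul_ite, mul_zero]
      rw [← sum_filter, ← sum_mul, selberg, ← h2]
      ring
    · simp [hrD, hD']
  rw [diagCoord, sum_congr rfl h1, ← mul_sum, sum_comm]
  congr 1
  refine sum_congr rfl fun s hs => ?_
  rw [← mul_sum, ← sum_filter, filter_filter]
  congr 1
  refine sum_congr ?_ fun _ _ => rfl
  ext D
  simp only [mem_filter, mem_powerset]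
  exact ⟨fun h => ⟨h.2.2.1, h.2.1, h.2.2.2⟩, fun h =>
    ⟨h.1.trans (mem_powerset.1 hs), h.2.1, h.1, h.2.2⟩⟩

lemma abs_diagCoord_le (hP : ∀ p ∈ P, p.Prime) (hR : 1 ≤ R) {q r a : Finset ℕ} (hq : q ⊆ P)
    (hr : r ⊆ P \ q) (ha : a ⊆ q) : |diagCoord P R q r a| ≤ 4 ^ q.card * diagWeight P R r := by
  rw [diagCoord_eq hP hr, abs_mul, abs_of_nonneg (by positivity)]
  have hrP : r ⊆ P := hr.trans sdiff_subset
  have hG := one_le_sieveSum hP hR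
  have h1 : |∑ s ∈ P.powerset, diagWeight P R s *
      ∑ D ∈ s.powerset.filter (fun D => D ∩ q = a ∧ r ⊆ D), (-1 : ℝ) ^ D.card| ≤
      ∑ s ∈ P.powerset.filter (fun s => a ∪ r ⊆ s ∧ s ⊆ q ∪ r), diagWeight P R s := by
    refine (abs_sum_le_sum_abs _ _).trans ?_
    rw [sum_filter]
    refine sum_le_sum fun s hs => ?_
    have h0 := diagWeight_nonneg hP hR (mem_powerset.1 hs)
    rw [abs_mul, abs_of_nonneg h0]
    refine (mul_le_mul_of_nonneg_left abs_sum_neg_one_pow_le h0).trans (le_of_eq ?_)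
    split_ifs <;> simp
  have h2 : ∀ s ∈ P.powerset.filter (fun s => a ∪ r ⊆ s ∧ s ⊆ q ∪ r),
      (∏ p ∈ a, (p : ℝ)) * diagWeight P R s ≤ 2 ^ q.card * diagWeight P R r := by
    intro s hs
    rw [mem_filter, mem_powerset] at hs
    obtain ⟨hsP, hars, -⟩ := hs
    have hsp : ∀ p ∈ s, p.Prime := fun p hp => hP p (hsP hp)
    have har : Disjoint a r := disjoint_of_subset_left ha
      (disjoint_of_subset_right hr disjoint_sdiff)
    have h3 : phi a * phi r ≤ phi s := by
      rw [phi, phi, ← prod_union har]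
      exact phi_mono hsp hars
    have h4 : (∏ p ∈ a, (p : ℝ)) ≤ 2 ^ q.card * phi a := by
      have h5 : (∏ p ∈ a, (p : ℝ)) ≤ ∏ p ∈ a, (2 * ((p : ℝ) - 1)) :=
        prod_le_prod (fun _ _ => by positivity) fun p hp => by
          have : (2 : ℝ) ≤ p := by exact_mod_cast (hP p (hq (ha hp))).two_le
          linarith
      rw [prod_mul_distrib, prod_const] at h5
      refine h5.trans (mul_le_mul_of_nonneg_right ?_ (phi_pos fun p hp => hP p (hq (ha hp))).le)
      exact pow_le_pow_right₀ (by norm_num) (card_le_card ha)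
    have h6 := phi_pos fun p hp => hP p (hrP hp)
    have h7 := phi_pos hsp
    by_cases hsR : ∏ p ∈ s, p ≤ R
    · have hrR : ∏ p ∈ r, p ≤ R := (prod_mono_primes hsp (subset_union_right.trans hars)).trans hsR
      rw [diagWeight, if_pos hsR, diagWeight, if_pos hrR, ← div_eq_mul_inv, ← div_eq_mul_inv,
        div_le_div_iff₀ (by positivity) (by positivity)]
      calc (∏ p ∈ a, (p : ℝ)) * (sieveSum P R * phi r) ≤
            2 ^ q.card * phi a * (sieveSum P R * phi r) := by gcongr
        _ = 2 ^ q.card * sieveSum P R * (phi a * phi r) := by ring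
        _ ≤ 2 ^ q.card * sieveSum P R * phi s := by gcongr
        _ = _ := by ring
    · rw [diagWeight, if_neg hsR, mul_zero]
      exact mul_nonneg (by positivity) (diagWeight_nonneg hP hR hrP)
  have h3 : (P.powerset.filter (fun s => a ∪ r ⊆ s ∧ s ⊆ q ∪ r)).card ≤ 2 ^ q.card := by
    rw [← card_powerset]
    refine card_le_card_of_injOn (fun s => s ∩ q) (fun s _ => mem_coe.2
      (mem_powerset.2 inter_subset_right)) ?_
    intro s hs t ht hst
    simp only [mem_coe, mem_filter, mem_powerset] at hs ht
    have key : ∀ s : Finset ℕ, a ∪ r ⊆ s → s ⊆ q ∪ r → s = s ∩ q ∪ r := by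
      intro s h1 h2
      ext x
      simp only [mem_union, mem_inter]
      constructor
      · intro hx
        rcases mem_union.1 (h2 hx) with h | h
        exacts [Or.inl ⟨hx, h⟩, Or.inr h]
      · rintro (h | h)
        exacts [h.1, h1 (mem_union_right _ h)]
    rw [key s hs.2.1 hs.2.2, key t ht.2.1 ht.2.2]
    exact congrArg (· ∪ r) hst
  calc (∏ p ∈ a, (p : ℝ)) * _ ≤ (∏ p ∈ a, (p : ℝ)) * ∑ s ∈ P.powerset.filter
        (fun s => a ∪ r ⊆ s ∧ s ⊆ q ∪ r), diagWeight P R s := by gcongr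
    _ ≤ (P.powerset.filter (fun s => a ∪ r ⊆ s ∧ s ⊆ q ∪ r)).card •
        (2 ^ q.card * diagWeight P R r) := by
        rw [mul_sum]
        exact sum_le_card_nsmul _ _ _ h2
    _ ≤ 2 ^ q.card * (2 ^ q.card * diagWeight P R r) := by
        rw [nsmul_eq_mul]
        refine mul_le_mul_of_nonneg_right (by exact_mod_cast h3) ?_
        exact mul_nonneg (by positivity) (diagWeight_nonneg hP hR hrP)
    _ = _ := by
        rw [← mul_assoc, ← mul_pow]
        norm_num

lemma diagCoord_empty (hP : ∀ p ∈ P, p.Prime) {r : Finset ℕ} (hr : r ⊆ P) :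
    diagCoord P R ∅ r ∅ = (-1) ^ r.card * diagWeight P R r := by
  rw [diagCoord_eq hP (by simpa using hr), prod_empty, one_mul,
    sum_eq_single_of_mem r (mem_powerset.2 hr)]
  · have : r.powerset.filter (fun D => D ∩ ∅ = ∅ ∧ r ⊆ D) = {r} := by
      ext D
      simp only [mem_filter, mem_powerset, inter_empty, true_and, mem_singleton]
      exact ⟨fun h => h.1.antisymm h.2, fun h => by simp [h]⟩
    rw [this, sum_singleton, mul_comm]
  · intro s _ hsr
    have := abs_sum_neg_one_pow_le (s := s) (q := ∅) (r := r) (a := ∅)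
    rw [if_neg] at this
    · rw [abs_nonpos_iff.1 this, mul_zero]
    · rintro ⟨h1, h2⟩
      simp only [empty_union] at h1 h2
      exact hsr (h2.antisymm h1)

/-- The part of the quadratic form of the sieve with given traces on `q`. -/
def quadForm (P : Finset ℕ) (R : ℕ) (q a a' : Finset ℕ) : ℝ :=
  ∑ D ∈ P.powerset.filter (fun D => D ∩ q = a), ∑ D' ∈ P.powerset.filter (fun D => D ∩ q = a'),
    selberg P R D * selberg P R D' * ∏ p ∈ (D ∪ D') \ q, (p : ℝ)⁻¹

lemma quadForm_eq (hP : ∀ p ∈ P, p.Prime) (q a a' : Finset ℕ) :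
    quadForm P R q a a' = ∑ r ∈ (P \ q).powerset,
      phi r * (diagCoord P R q r a * diagCoord P R q r a') := by
  have h1 : ∀ r, phi r * (diagCoord P R q r a * diagCoord P R q r a') =
      ∑ D ∈ P.powerset.filter (fun D => D ∩ q = a), ∑ D' ∈ P.powerset.filter (fun D => D ∩ q = a'),
      selberg P R D * selberg P R D' * (phi r * ((if r ⊆ D \ q then ∏ p ∈ D \ q, (p : ℝ)⁻¹ else 0) *
        if r ⊆ D' \ q then ∏ p ∈ D' \ q, (p : ℝ)⁻¹ else 0)) := by
    intro r
    rw [diagCoord, diagCoord, sum_mul_sum, mul_sum]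
    refine sum_congr rfl fun D _ => ?_
    rw [mul_sum]
    refine sum_congr rfl fun D' _ => ?_
    ring
  rw [sum_congr rfl fun r _ => h1 r, sum_comm, quadForm]
  refine sum_congr rfl fun D hD => ?_
  rw [sum_comm]
  refine sum_congr rfl fun D' _ => ?_
  rw [← mul_sum, union_sdiff_distrib, prod_union_inv (U := P \ q)
    (fun p hp => hP p (mem_sdiff.1 hp).1)
    (sdiff_subset_sdiff (mem_powerset.1 (mem_filter.1 hD).1) subset_rfl)]

lemma sum_phi_mul_diagWeight_sq (hP : ∀ p ∈ P, p.Prime) (hR : 1 ≤ R) :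
    ∑ r ∈ P.powerset, phi r * diagWeight P R r ^ 2 = (sieveSum P R)⁻¹ := by
  have hG := one_le_sieveSum hP hR
  have h1 : ∀ r ∈ P.powerset, phi r * diagWeight P R r ^ 2 =
      (sieveSum P R)⁻¹ * diagWeight P R r := by
    intro r hr
    have := phi_pos fun p hp => hP p (mem_powerset.1 hr hp)
    rw [diagWeight]
    split_ifs
    · field_simp
    · simp
  rw [sum_congr rfl h1, ← mul_sum, sum_diagWeight hP hR, mul_one]

lemma abs_quadForm_le (hP : ∀ p ∈ P, p.Prime) (hR : 1 ≤ R) {q a a' : Finset ℕ} (hq : q ⊆ P)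
    (ha : a ⊆ q) (ha' : a' ⊆ q) : |quadForm P R q a a'| ≤ 16 ^ q.card * (sieveSum P R)⁻¹ := by
  rw [quadForm_eq hP, ← sum_phi_mul_diagWeight_sq hP hR, mul_sum]
  refine (abs_sum_le_sum_abs _ _).trans ((sum_le_sum fun r hr => ?_).trans
    (sum_le_sum_of_subset_of_nonneg (powerset_mono.2 (sdiff_subset (t := q))) fun r hr _ => ?_))
  · rw [mem_powerset] at hr
    have h0 := phi_pos fun p hp => hP p ((hr.trans sdiff_subset) hp)
    have h1 := abs_diagCoord_le hP hR hq hr ha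
    have h2 := abs_diagCoord_le hP hR hq hr ha'
    rw [abs_mul, abs_mul, abs_of_pos h0]
    calc phi r * (|diagCoord P R q r a| * |diagCoord P R q r a'|) ≤
          phi r * ((4 ^ q.card * diagWeight P R r) * (4 ^ q.card * diagWeight P R r)) := by
          gcongr
          exact (abs_nonneg _).trans h1
      _ = (4 ^ q.card * 4 ^ q.card) * (phi r * diagWeight P R r ^ 2) := by ring
      _ = _ := by
        rw [← mul_pow]
        norm_num
  · have h0 := phi_pos fun p hp => hP p (mem_powerset.1 hr hp)
    positivity

lemma quadForm_empty (hP : ∀ p ∈ P, p.Prime) (hR : 1 ≤ R) :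
    quadForm P R ∅ ∅ ∅ = (sieveSum P R)⁻¹ := by
  rw [quadForm_eq hP, ← sum_phi_mul_diagWeight_sq hP hR, sdiff_empty]
  refine sum_congr rfl fun r hr => ?_
  rw [diagCoord_empty hP (mem_powerset.1 hr)]
  have : ((-1 : ℝ) ^ r.card) * (-1) ^ r.card = 1 := by
    rw [← mul_pow]
    simp
  linear_combination (phi r * diagWeight P R r ^ 2) * this

end

noncomputable section

variable {P : Finset ℕ} {R : ℕ}

/-- The pairs of sets of primes. -/
def pairs (P : Finset ℕ) : Finset (Finset ℕ × Finset ℕ) := P.powerset ×ˢ P.powerset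

/-- The weight of a pair of sets of primes, the primes of `q` being removed. -/
def pairWeight (P : Finset ℕ) (R : ℕ) (q : Finset ℕ) (x : Finset ℕ × Finset ℕ) : ℝ :=
  selberg P R x.1 * selberg P R x.2 * ∏ p ∈ (x.1 ∪ x.2) \ q, (p : ℝ)⁻¹

/-- The quadratic form of the sieve restricted to the pairs whose union has a given trace. -/
def traceSum (P : Finset ℕ) (R : ℕ) (q A : Finset ℕ) : ℝ :=
  ∑ x ∈ (pairs P).filter (fun x => (x.1 ∪ x.2) ∩ q = A), pairWeight P R q x

lemma traceSum_eq (q A : Finset ℕ) : traceSum P R q A =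
    ∑ a ∈ (q.powerset ×ˢ q.powerset).filter (fun a => a.1 ∪ a.2 = A),
      quadForm P R q a.1 a.2 := by
  rw [traceSum, ← sum_fiberwise_of_maps_to (t := (q.powerset ×ˢ q.powerset).filter
    (fun a => a.1 ∪ a.2 = A)) (g := fun x : Finset ℕ × Finset ℕ => (x.1 ∩ q, x.2 ∩ q))]
  · refine sum_congr rfl fun a ha => ?_
    rw [quadForm, ← sum_product']
    refine sum_congr ?_ fun _ _ => rfl
    ext x
    rw [mem_filter] at ha
    simp only [mem_filter, mem_product, pairs, Prod.ext_iff]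
    constructor
    · rintro ⟨⟨⟨h1, h2⟩, -⟩, h4, h5⟩
      exact ⟨⟨h1, h4⟩, h2, h5⟩
    · rintro ⟨⟨h1, h4⟩, h2, h5⟩
      exact ⟨⟨⟨h1, h2⟩, by rw [union_inter_distrib_right, h4, h5, ha.2]⟩, h4, h5⟩
  · intro x hx
    rw [mem_filter] at hx ⊢
    exact ⟨mem_product.2 ⟨mem_powerset.2 inter_subset_right, mem_powerset.2 inter_subset_right⟩,
      by rw [← union_inter_distrib_right, hx.2]⟩

lemma abs_traceSum_le (hP : ∀ p ∈ P, p.Prime) (hR : 1 ≤ R) {q : Finset ℕ} (hq : q ⊆ P)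
    (A : Finset ℕ) : |traceSum P R q A| ≤ 64 ^ q.card * (sieveSum P R)⁻¹ := by
  have hG := one_le_sieveSum hP hR
  rw [traceSum_eq]
  refine (abs_sum_le_sum_abs _ _).trans ((sum_le_sum_of_subset_of_nonneg (filter_subset _ _)
    fun _ _ _ => abs_nonneg _).trans ?_)
  refine (sum_le_card_nsmul _ _ (16 ^ q.card * (sieveSum P R)⁻¹) fun a ha => ?_).trans
    (le_of_eq ?_)
  · rw [mem_product, mem_powerset, mem_powerset] at ha
    exact abs_quadForm_le hP hR hq ha.1 ha.2
  · rw [card_product, card_powerset, nsmul_eq_mul]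
    push_cast
    rw [← mul_assoc, ← mul_pow, ← mul_pow]
    norm_num

lemma traceSum_empty (hP : ∀ p ∈ P, p.Prime) (hR : 1 ≤ R) :
    traceSum P R ∅ ∅ = (sieveSum P R)⁻¹ := by
  rw [traceSum_eq, ← quadForm_empty hP hR]
  simp [filter_singleton]

variable {I : Type*} [Fintype I] [DecidableEq I]

/-- The indices of the pairs in which a prime occurs. -/
def occ (e : I → Finset ℕ × Finset ℕ) (p : ℕ) : Finset I :=
  univ.filter fun i => p ∈ (e i).1 ∪ (e i).2

/-- The sieve sum with local factors `α`. -/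
def localSum (I : Type*) [Fintype I] [DecidableEq I] (P : Finset ℕ) (R : ℕ)
    (α : ℕ → Finset I → ℝ) : ℝ :=
  ∑ e ∈ Fintype.piFinset fun _ : I => pairs P,
    (∏ i, selberg P R (e i).1 * selberg P R (e i).2) * ∏ p ∈ P, α p (occ e p)

lemma localSum_eq (α : ℕ → Finset I → ℝ) : localSum I P R α = ∑ q ∈ P.powerset,
    ∑ A ∈ Fintype.piFinset fun _ : I => q.powerset,
      (∏ p ∈ q, (α p (univ.filter fun i => p ∈ A i) -
        (p : ℝ)⁻¹ ^ (univ.filter fun i => p ∈ A i).card)) * ∏ i, traceSum P R q (A i) := by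
  have h1 : ∀ e ∈ Fintype.piFinset fun _ : I => pairs P, ∏ p ∈ P, α p (occ e p) =
      ∑ q ∈ P.powerset, (∏ p ∈ q, (α p (occ e p) - (p : ℝ)⁻¹ ^ (occ e p).card)) *
        ∏ i, ∏ p ∈ ((e i).1 ∪ (e i).2) \ q, (p : ℝ)⁻¹ := by
    intro e he
    have h2 : ∀ p : ℕ, α p (occ e p) = (α p (occ e p) - (p : ℝ)⁻¹ ^ (occ e p).card) +
        (p : ℝ)⁻¹ ^ (occ e p).card := fun p => by ring
    rw [prod_congr rfl fun p _ => h2 p, prod_add]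
    refine sum_congr rfl fun q _ => ?_
    congr 1
    have h3 : ∀ p : ℕ, (p : ℝ)⁻¹ ^ (occ e p).card =
        ∏ i, if p ∈ (e i).1 ∪ (e i).2 then (p : ℝ)⁻¹ else 1 := by
      intro p
      rw [prod_ite, prod_const_one, mul_one, prod_const, occ]
    rw [prod_congr rfl fun p _ => h3 p, prod_comm]
    refine prod_congr rfl fun i _ => ?_
    rw [← prod_filter]
    refine prod_congr ?_ fun _ _ => rfl
    ext p
    have := mem_product.1 (Fintype.mem_piFinset.1 he i)
    rw [mem_powerset, mem_powerset] at this
    rw [mem_filter, mem_sdiff, mem_sdiff]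
    exact ⟨fun h => ⟨h.2, h.1.2⟩, fun h => ⟨⟨union_subset this.1 this.2 h.1, h.2⟩, h.1⟩⟩
  rw [localSum, sum_congr rfl fun e he => by rw [h1 e he, mul_sum], sum_comm]
  refine sum_congr rfl fun q _ => ?_
  rw [← sum_fiberwise_of_maps_to (t := Fintype.piFinset fun _ : I => q.powerset)
    (g := fun (e : I → Finset ℕ × Finset ℕ) i => ((e i).1 ∪ (e i).2) ∩ q)
    fun e _ => Fintype.mem_piFinset.2 fun i => mem_powerset.2 inter_subset_right]
  refine sum_congr rfl fun A _ => ?_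
  have h4 : ((Fintype.piFinset fun _ : I => pairs P).filter
      fun e => (fun i => ((e i).1 ∪ (e i).2) ∩ q) = A) =
      Fintype.piFinset fun i => (pairs P).filter fun x => (x.1 ∪ x.2) ∩ q = A i := by
    ext e
    simp only [mem_filter, Fintype.mem_piFinset, funext_iff]
    exact ⟨fun h i => ⟨h.1 i, h.2 i⟩, fun h => ⟨fun i => (h i).1, fun i => (h i).2⟩⟩
  rw [h4]
  simp only [traceSum]
  rw [prod_univ_sum, mul_sum]
  refine sum_congr rfl fun e he => ?_
  have h5 : ∀ p ∈ q, occ e p = univ.filter fun i => p ∈ A i := by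
    intro p hp
    refine filter_congr fun i _ => ?_
    rw [← (mem_filter.1 (Fintype.mem_piFinset.1 he i)).2, mem_inter]
    exact ⟨fun h => ⟨h, hp⟩, fun h => h.1⟩
  have h6 : ∏ p ∈ q, (α p (occ e p) - (p : ℝ)⁻¹ ^ (occ e p).card) =
      ∏ p ∈ q, (α p (univ.filter fun i => p ∈ A i) -
        (p : ℝ)⁻¹ ^ (univ.filter fun i => p ∈ A i).card) :=
    prod_congr rfl fun p hp => by rw [h5 p hp]
  have h7 : ∏ i, pairWeight P R q (e i) = (∏ i, selberg P R (e i).1 * selberg P R (e i).2) *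
      ∏ i, ∏ p ∈ ((e i).1 ∪ (e i).2) \ q, (p : ℝ)⁻¹ := prod_mul_distrib
  rw [h6, h7]
  ring

theorem abs_localSum_sub_le (hP : ∀ p ∈ P, p.Prime) (hR : 1 ≤ R) {α : ℕ → Finset I → ℝ}
    (hα : ∀ p ∈ P, ∀ B, |α p B - (p : ℝ)⁻¹ ^ B.card| ≤ ((p : ℝ) ^ 2)⁻¹) :
    |localSum I P R α - (sieveSum P R)⁻¹ ^ Fintype.card I| ≤
      (sieveSum P R)⁻¹ ^ Fintype.card I *
        (∏ p ∈ P, (1 + 128 ^ Fintype.card I * ((p : ℝ) ^ 2)⁻¹) - 1) := by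
  set m := Fintype.card I with hm
  set G := sieveSum P R with hG
  have hG1 : 1 ≤ G := one_le_sieveSum hP hR
  have h0 : ∀ q ∈ P.powerset, |∑ A ∈ Fintype.piFinset fun _ : I => q.powerset,
      (∏ p ∈ q, (α p (univ.filter fun i => p ∈ A i) -
        (p : ℝ)⁻¹ ^ (univ.filter fun i => p ∈ A i).card)) * ∏ i, traceSum P R q (A i)| ≤
      G⁻¹ ^ m * ∏ p ∈ q, (128 ^ m * ((p : ℝ) ^ 2)⁻¹) := by
    intro q hq
    rw [mem_powerset] at hq
    refine (abs_sum_le_sum_abs _ _).trans ((sum_le_card_nsmul _ _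
      ((∏ p ∈ q, ((p : ℝ) ^ 2)⁻¹) * (64 ^ q.card * G⁻¹) ^ m) fun A _ => ?_).trans (le_of_eq ?_))
    · rw [abs_mul, abs_prod, abs_prod]
      refine mul_le_mul (prod_le_prod (fun _ _ => abs_nonneg _) fun p hp => hα p (hq hp) _) ?_
        (prod_nonneg fun _ _ => abs_nonneg _) (prod_nonneg fun _ _ => by positivity)
      refine (prod_le_prod (fun _ _ => abs_nonneg _) fun i _ =>
        abs_traceSum_le hP hR hq (A i)).trans (le_of_eq ?_)
      rw [prod_const, card_univ]
    · rw [Fintype.card_piFinset, prod_const, card_univ, card_powerset, nsmul_eq_mul,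
        prod_mul_distrib, prod_const, mul_pow, ← hm]
      push_cast
      have : (128 : ℝ) = 2 * 64 := by norm_num
      rw [this, mul_pow, mul_pow, ← pow_mul, ← pow_mul, ← pow_mul, ← pow_mul, mul_comm m]
      ring
  have h1 : localSum I P R α - G⁻¹ ^ m = ∑ q ∈ P.powerset.erase ∅,
      ∑ A ∈ Fintype.piFinset fun _ : I => q.powerset,
      (∏ p ∈ q, (α p (univ.filter fun i => p ∈ A i) -
        (p : ℝ)⁻¹ ^ (univ.filter fun i => p ∈ A i).card)) * ∏ i, traceSum P R q (A i) := by
    rw [localSum_eq, ← add_sum_erase _ _ (empty_mem_powerset P)]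
    have : (Fintype.piFinset fun _ : I => (∅ : Finset ℕ).powerset) = {fun _ => ∅} := by
      ext A
      simp [Fintype.mem_piFinset, funext_iff]
    rw [this, sum_singleton, prod_empty, one_mul, prod_const, traceSum_empty hP hR, card_univ]
    ring
  have h2 : ∏ p ∈ P, (1 + 128 ^ m * ((p : ℝ) ^ 2)⁻¹) - 1 =
      ∑ q ∈ P.powerset.erase ∅, ∏ p ∈ q, (128 ^ m * ((p : ℝ) ^ 2)⁻¹) := by
    rw [prod_one_add, ← add_sum_erase _ _ (empty_mem_powerset P), prod_empty]
    ring
  rw [h1, h2, mul_sum]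
  exact (abs_sum_le_sum_abs _ _).trans (sum_le_sum fun q hq => h0 q (mem_erase.1 hq).2)

end

noncomputable section

variable {V : Type} [Fintype V] [DecidableEq V]

/-- The vectors of residues modulo `q`. -/
def residues (V : Type) [Fintype V] [DecidableEq V] (q : ℕ) : Finset (V → ℤ) :=
  Fintype.piFinset fun _ => Ico 0 (q : ℤ)

/-- Functions on integer vectors which only depend on residues modulo `q`. -/
def PeriodicMod (q : ℕ) (f : (V → ℤ) → ℝ) : Prop :=
  ∀ y y', (∀ v, (q : ℤ) ∣ y v - y' v) → f y = f y'

lemma card_residues (q : ℕ) : (residues V q).card = q ^ Fintype.card V := by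
  rw [residues, Fintype.card_piFinset, prod_const, card_univ, Int.card_Ico, sub_zero,
    Int.toNat_natCast]

lemma mem_residues {q : ℕ} {y : V → ℤ} : y ∈ residues V q ↔ ∀ v, 0 ≤ y v ∧ y v < q := by
  simp [residues, Fintype.mem_piFinset]

lemma eq_of_mem_residues {q : ℕ} {y y' : V → ℤ} (hy : y ∈ residues V q) (hy' : y' ∈ residues V q)
    {v : V} (h : (q : ℤ) ∣ y v - y' v) : y v = y' v := by
  have h1 := mem_residues.1 hy v
  have h2 := mem_residues.1 hy' v
  have := Int.eq_zero_of_abs_lt_dvd h (abs_lt.2 ⟨by linarith, by linarith⟩)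
  linarith

lemma emod_mem_residues {q : ℕ} (hq : 1 ≤ q) (y : V → ℤ) : (fun v => y v % q) ∈ residues V q :=
  mem_residues.2 fun v => ⟨Int.emod_nonneg _ (by omega), Int.emod_lt_of_pos _ (by omega)⟩

lemma PeriodicMod.emod {q : ℕ} {f : (V → ℤ) → ℝ} (hf : PeriodicMod q f) (y : V → ℤ) :
    f y = f fun v => y v % q :=
  hf _ _ fun _ => Int.dvd_self_sub_emod

lemma PeriodicMod.of_dvd {q q' : ℕ} {f : (V → ℤ) → ℝ} (hf : PeriodicMod q f) (h : q ∣ q') :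
    PeriodicMod q' f :=
  fun y y' hy => hf y y' fun v => (Int.natCast_dvd_natCast.2 h).trans (hy v)

lemma expect_residues_mul {p q : ℕ} (hp : 1 ≤ p) (hq : 1 ≤ q) (hpq : p.Coprime q)
    {f g : (V → ℤ) → ℝ} (hf : PeriodicMod p f) (hg : PeriodicMod q g) :
    𝔼 y ∈ residues V (p * q), f y * g y = (𝔼 y ∈ residues V p, f y) * 𝔼 y ∈ residues V q, g y := by
  have h1 : ∑ y ∈ residues V (p * q), f y * g y =
      ∑ z ∈ residues V p ×ˢ residues V q, f z.1 * g z.2 := by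
    have hmap : Set.MapsTo (fun (y : V → ℤ) => ((fun v => y v % p : V → ℤ), (fun v => y v % q : V → ℤ)))
        (residues V (p * q)) ((residues V p ×ˢ residues V q : Finset _) : Set _) := fun y _ =>
      mem_coe.2 (mem_product.2 ⟨emod_mem_residues hp y, emod_mem_residues hq y⟩)
    have hinj : Set.InjOn (fun (y : V → ℤ) =>
        ((fun v => y v % p : V → ℤ), (fun v => y v % q : V → ℤ))) (residues V (p * q)) := by
      intro y hy y' hy' h
      rw [Prod.mk.injEq, funext_iff, funext_iff] at h
      funext v
      refine eq_of_mem_residues hy hy' ?_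
      have h2 : (p : ℤ) ∣ y v - y' v := Int.ModEq.dvd (h.1 v).symm
      have h3 : (q : ℤ) ∣ y v - y' v := Int.ModEq.dvd (h.2 v).symm
      push_cast
      exact (Nat.isCoprime_iff_coprime.2 hpq).mul_dvd h2 h3
    refine sum_nbij _ (fun y hy => hmap hy) hinj
      (surjOn_of_injOn_of_card_le _ hmap hinj ?_) fun y _ => ?_
    · rw [card_product, card_residues, card_residues, card_residues, mul_pow]
    · rw [hf.emod, hg.emod]
  rw [expect_eq_sum_div_card, expect_eq_sum_div_card, expect_eq_sum_div_card, h1, sum_product,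
    ← sum_mul_sum, card_residues, card_residues, card_residues]
  push_cast
  rw [mul_pow, div_mul_div_comm]

lemma expect_residues_prod {T : Finset ℕ} (hT : ∀ p ∈ T, p.Prime) {f : ℕ → (V → ℤ) → ℝ}
    (hf : ∀ p ∈ T, PeriodicMod p (f p)) :
    𝔼 y ∈ residues V (∏ p ∈ T, p), ∏ p ∈ T, f p y = ∏ p ∈ T, 𝔼 y ∈ residues V p, f p y := by
  induction T using Finset.induction_on with
  | empty =>
    simp only [prod_empty]
    refine expect_const ?_ _
    exact ⟨_, emod_mem_residues le_rfl 0⟩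
  | insert p T hp ih =>
    have hT' : ∀ r ∈ T, r.Prime := fun r hr => hT r (mem_insert_of_mem hr)
    have hpp := hT p (mem_insert_self _ _)
    simp only [prod_insert hp]
    rw [expect_residues_mul hpp.one_le (prod_pos fun r hr => (hT' r hr).pos)
      (Nat.Coprime.prod_right fun r hr => (Nat.coprime_primes hpp (hT' r hr)).2
        fun h => hp (h ▸ hr)) (hf p (mem_insert_self _ _)) ?_,
      ih hT' fun r hr => hf r (mem_insert_of_mem hr)]
    intro y y' h
    refine prod_congr rfl fun r hr => ?_
    exact ((hf r (mem_insert_of_mem hr)).of_dvd (dvd_prod_of_mem _ hr)) y y' h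

lemma abs_card_filter_modEq_sub_le {q : ℕ} (hq : 1 ≤ q) (a : ℕ) (r : ℤ) :
    |(((Icc (-(a : ℤ)) a).filter fun z => z ≡ r [ZMOD q]).card : ℝ) - (2 * a + 1) / q| ≤ 1 := by
  have h0 : Icc (-(a : ℤ)) a = Ioc (-(a : ℤ) - 1) a := by
    ext z
    rw [mem_Icc, mem_Ioc]
    constructor <;> rintro ⟨h1, h2⟩ <;> exact ⟨by omega, h2⟩
  have hq0 : (0 : ℚ) < q := by exact_mod_cast hq
  have h := Int.Ioc_filter_modEq_card (-(a : ℤ) - 1) a (r := q) (by omega) r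
  rw [← h0] at h
  have key : |(((Icc (-(a : ℤ)) a).filter fun z => z ≡ r [ZMOD q]).card : ℚ) -
      (2 * a + 1) / q| ≤ 1 := by
    have h' : (((Icc (-(a : ℤ)) a).filter fun z => z ≡ r [ZMOD q]).card : ℚ) =
        max ((⌊(((a : ℤ) : ℚ) - r) / ((q : ℤ) : ℚ)⌋ : ℚ) -
          ⌊(((-(a : ℤ) - 1 : ℤ) : ℚ) - r) / ((q : ℤ) : ℚ)⌋) 0 := by
      exact_mod_cast congrArg (fun z : ℤ => (z : ℚ)) h
    set u := (((a : ℤ) : ℚ) - r) / ((q : ℤ) : ℚ)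
    set w := (((-(a : ℤ) - 1 : ℤ) : ℚ) - r) / ((q : ℤ) : ℚ)
    have e : u - w = (2 * a + 1) / q := by
      simp only [u, w]
      push_cast
      ring
    have h1 := Int.floor_le u
    have h2 := Int.lt_floor_add_one u
    have h3 := Int.floor_le w
    have h4 := Int.lt_floor_add_one w
    have h5 : 0 ≤ u - w := e ▸ by positivity
    rw [h', ← e, abs_le]
    have h6 := le_max_left ((⌊u⌋ : ℚ) - ⌊w⌋) 0
    refine ⟨by linarith, ?_⟩
    have : max ((⌊u⌋ : ℚ) - ⌊w⌋) 0 ≤ u - w + 1 := max_le (by linarith) (by linarith)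
    linarith
  have := (Rat.cast_le (K := ℝ)).2 key
  push_cast at this
  exact this

lemma abs_expect_box_sub_le {q N : ℕ} (hq : 1 ≤ q) {f : (V → ℤ) → ℝ} (hf : PeriodicMod q f)
    (h1 : ∀ y, |f y| ≤ 1) {a : V → ℕ} (ha : ∀ v, N ≤ a v) (hN : Fintype.card V * q ≤ N)
    (hN0 : 1 ≤ N) :
    |𝔼 x ∈ Fintype.piFinset fun v => Icc (-(a v : ℤ)) (a v), f x - 𝔼 y ∈ residues V q, f y| ≤
      2 * (Fintype.card V * q / N) := by
  set n : V → ℤ → ℝ := fun v r => ((Icc (-(a v : ℤ)) (a v)).filter fun z => z ≡ r [ZMOD q]).card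
    with hn
  have hq0 : (0 : ℝ) < q := by exact_mod_cast hq
  have hN1 : (0 : ℝ) < N := by exact_mod_cast hN0
  have hs : ∑ x ∈ Fintype.piFinset fun v => Icc (-(a v : ℤ)) (a v), f x =
      ∑ y ∈ residues V q, f y * ∏ v, n v (y v) := by
    rw [← sum_fiberwise_of_maps_to (t := residues V q) (g := fun x v => x v % q)
      fun x _ => emod_mem_residues hq x]
    refine sum_congr rfl fun y hy => ?_
    have e : (Fintype.piFinset fun v => Icc (-(a v : ℤ)) (a v)).filter
        (fun x => (fun v => x v % (q : ℤ)) = y) =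
        Fintype.piFinset fun v => (Icc (-(a v : ℤ)) (a v)).filter fun z => z ≡ y v [ZMOD q] := by
      ext x
      have h : ∀ v (z : ℤ), z % q = y v ↔ z ≡ y v [ZMOD q] := fun v z => by
        rw [Int.ModEq, Int.emod_eq_of_lt (mem_residues.1 hy v).1 (mem_residues.1 hy v).2]
      simp only [mem_filter, Fintype.mem_piFinset, funext_iff, h]
      exact ⟨fun h v => ⟨h.1 v, h.2 v⟩, fun h => ⟨fun v => (h v).1, fun v => (h v).2⟩⟩
    rw [sum_congr rfl (g := fun _ => f y), sum_const, nsmul_eq_mul, mul_comm, e,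
      Fintype.card_piFinset]
    · push_cast
      rfl
    · intro x hx
      rw [hf.emod, (mem_filter.1 hx).2]
  have hc : ((Fintype.piFinset fun v => Icc (-(a v : ℤ)) (a v)).card : ℝ) =
      ∏ v, (2 * (a v : ℝ) + 1) := by
    rw [Fintype.card_piFinset]
    push_cast
    refine prod_congr rfl fun v _ => ?_
    rw [Int.card_Icc, show ((a v : ℤ) + 1 - -(a v : ℤ)).toNat = 2 * a v + 1 by omega]
    push_cast
    ring
  have h2 : ∀ y : V → ℤ, |(∏ v, n v (y v)) / (∏ v, (2 * (a v : ℝ) + 1)) * (q : ℝ) ^ Fintype.card V - 1| ≤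
      2 * (Fintype.card V * q / N) := by
    intro y
    have e1 : (∏ v, n v (y v)) / (∏ v, (2 * (a v : ℝ) + 1)) * (q : ℝ) ^ Fintype.card V =
        ∏ v, (1 + (n v (y v) - (2 * a v + 1) / q) * (q / (2 * a v + 1))) := by
      rw [← card_univ, ← prod_const, ← prod_div_distrib, ← prod_mul_distrib]
      refine prod_congr rfl fun v _ => ?_
      have : (2 * (a v : ℝ) + 1) ≠ 0 := by positivity
      field_simp
      ring
    have e2 : ∑ v, ‖(n v (y v) - (2 * a v + 1) / q) * (q / (2 * (a v : ℝ) + 1))‖ ≤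
        Fintype.card V * q / N := by
      refine (sum_le_card_nsmul _ _ ((q : ℝ) / N) fun v _ => ?_).trans (le_of_eq ?_)
      · rw [Real.norm_eq_abs, abs_mul, abs_of_nonneg (a := (q : ℝ) / (2 * a v + 1)) (by positivity)]
        refine (mul_le_of_le_one_left (by positivity)
          (abs_card_filter_modEq_sub_le hq (a v) (y v))).trans ?_
        have : (N : ℝ) ≤ a v := by exact_mod_cast ha v
        gcongr
        linarith
      · rw [card_univ, nsmul_eq_mul]
        ring
    rw [e1, ← Real.norm_eq_abs]
    refine (norm_prod_one_add_sub_one_le _ _).trans ?_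
    have h3 : (Fintype.card V * q / N : ℝ) ≤ 1 := by
      rw [div_le_one hN1]
      exact_mod_cast hN
    have h4 : (0 : ℝ) ≤ Fintype.card V * q / N := by positivity
    have h5 := Real.abs_exp_sub_one_le (x := Fintype.card V * q / N) (by rwa [abs_of_nonneg h4])
    rw [abs_of_nonneg h4] at h5
    have := Real.exp_le_exp.2 e2
    linarith [le_abs_self (Real.exp (Fintype.card V * q / N) - 1)]
  have h3 : 𝔼 x ∈ Fintype.piFinset fun v => Icc (-(a v : ℤ)) (a v), f x - 𝔼 y ∈ residues V q, f y =
      𝔼 y ∈ residues V q, f y *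
        ((∏ v, n v (y v)) / (∏ v, (2 * (a v : ℝ) + 1)) * (q : ℝ) ^ Fintype.card V - 1) := by
    rw [expect_eq_sum_div_card, hs, hc, expect_eq_sum_div_card, expect_eq_sum_div_card,
      card_residues, sum_div, sum_div, sum_div, ← sum_sub_distrib]
    refine sum_congr rfl fun y _ => ?_
    push_cast
    field_simp
  rw [h3]
  refine (abs_expect_le _ _).trans (expect_le ⟨_, emod_mem_residues hq 0⟩ fun y _ => ?_)
  rw [abs_mul]
  exact (mul_le_of_le_one_left (abs_nonneg _) (h1 y)).trans (h2 y)

end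

noncomputable section

variable {V I : Type} [Fintype V] [DecidableEq V]

/-- The indicator function of the divisibility by `p` of the forms in `B`. -/
def hit (W b : ℤ) (L : I → V → ℤ) (p : ℕ) (B : Finset I) (y : V → ℤ) : ℝ :=
  if ∀ i ∈ B, (p : ℤ) ∣ W * ∑ v, L i v * y v + b then 1 else 0

/-- The density of the solutions modulo `p`. -/
def localDensity (W b : ℤ) (L : I → V → ℤ) (p : ℕ) (B : Finset I) : ℝ :=
  𝔼 y ∈ residues V p, hit W b L p B y

variable {W b : ℤ} {L : I → V → ℤ} {p : ℕ} {B : Finset I}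

lemma hit_nonneg (y : V → ℤ) : 0 ≤ hit W b L p B y := by
  rw [hit]; split_ifs <;> norm_num

lemma hit_le_one (y : V → ℤ) : hit W b L p B y ≤ 1 := by
  rw [hit]; split_ifs <;> norm_num

lemma dvd_form_sub {y y' : V → ℤ} (i : I) (h : ∀ v, (p : ℤ) ∣ y v - y' v) :
    (p : ℤ) ∣ (W * ∑ v, L i v * y v + b) - (W * ∑ v, L i v * y' v + b) := by
  have : (W * ∑ v, L i v * y v + b) - (W * ∑ v, L i v * y' v + b) =
      W * ∑ v, L i v * (y v - y' v) := by
    simp only [mul_sub, sum_sub_distrib]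
    ring
  rw [this]
  exact (dvd_sum fun v _ => (h v).mul_left _).mul_left _

lemma periodicMod_hit : PeriodicMod p (hit W b L p B) := by
  intro y y' h
  rw [hit, hit]
  congr 1
  refine propext (forall₂_congr fun i _ => ?_)
  exact (dvd_iff_dvd_of_dvd_sub (dvd_form_sub i h))

lemma card_le_of_determined {q : ℕ} {S : Finset (V → ℤ)} (hS : S ⊆ residues V q) (U : Finset V)
    (h : ∀ y ∈ S, ∀ y' ∈ S, (∀ v, v ∉ U → y v = y' v) → y = y') :
    S.card ≤ q ^ (Fintype.card V - U.card) := by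
  have := card_le_card_of_injOn (s := S)
    (t := Fintype.piFinset fun _ : ↥(Uᶜ) => Ico 0 (q : ℤ)) (fun y w => y w) ?_ ?_
  · rwa [Fintype.card_piFinset, prod_const, card_univ, Fintype.card_coe, card_compl, Int.card_Ico,
      sub_zero, Int.toNat_natCast] at this
  · intro y hy
    refine mem_coe.2 (Fintype.mem_piFinset.2 fun w => mem_Ico.2 (mem_residues.1 (hS hy) w))
  · intro y hy y' hy' e
    exact h y hy y' hy' fun v hv => congrFun e ⟨v, mem_compl.2 hv⟩

lemma eq_of_dvd_forms (hp : p.Prime) (hW : ¬ (p : ℤ) ∣ W) {i : I} {c : ℤ} {u : V}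
    (hu : ¬ (p : ℤ) ∣ L i u) {y y' : V → ℤ} (hy : y ∈ residues V p) (hy' : y' ∈ residues V p)
    (h : (p : ℤ) ∣ W * ∑ v, L i v * y v + c) (h' : (p : ℤ) ∣ W * ∑ v, L i v * y' v + c)
    (hv : ∀ v, v ≠ u → L i v * y v = L i v * y' v) : y u = y' u := by
  have hpp : Prime (p : ℤ) := Nat.prime_iff_prime_int.1 hp
  refine eq_of_mem_residues hy hy' ?_
  have h1 := dvd_sub h h'
  have h2 : (W * ∑ v, L i v * y v + c) - (W * ∑ v, L i v * y' v + c) =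
      W * (L i u * (y u - y' u)) := by
    have : ∑ v, L i v * y v - ∑ v, L i v * y' v = L i u * (y u - y' u) := by
      rw [← sum_sub_distrib, sum_eq_single u (fun v _ hvu => by rw [hv v hvu, sub_self])
        fun h => absurd (mem_univ u) h]
      ring
    rw [← this]
    ring
  rw [h2] at h1
  exact (hpp.dvd_or_dvd ((hpp.dvd_or_dvd h1).resolve_left hW)).resolve_left hu

lemma localDensity_empty (hp : 1 ≤ p) : localDensity W b L p ∅ = 1 := by
  rw [localDensity, expect_congr rfl (g := fun _ => 1) fun y _ => by simp [hit]]
  exact expect_const ⟨_, emod_mem_residues hp 0⟩ _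

lemma localDensity_singleton (hp : p.Prime) (hW : ¬ (p : ℤ) ∣ W) {i : I} {u : V}
    (hu : ¬ (p : ℤ) ∣ L i u) : localDensity W b L p {i} = (p : ℝ)⁻¹ := by
  have hp0 : (0 : ℤ) < p := by exact_mod_cast hp.pos
  set S : ℤ → Finset (V → ℤ) := fun c =>
    (residues V p).filter fun y => (p : ℤ) ∣ W * ∑ v, L i v * y v + c with hS
  have h1 : ∀ c ∈ Ico b (b + p), (S c).card ≤ p ^ (Fintype.card V - 1) := by
    intro c _
    refine card_le_of_determined (filter_subset _ _) {u} fun y hy y' hy' h => ?_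
    rw [mem_filter] at hy hy'
    funext v
    by_cases hv : v = u
    · rw [hv]
      exact eq_of_dvd_forms hp hW hu hy.1 hy'.1 hy.2 hy'.2
        fun v hv => by rw [h v (by simpa using hv)]
    · exact h v (by simpa using hv)
  have h2 : ∑ c ∈ Ico b (b + p), (S c).card = p ^ Fintype.card V := by
    rw [← card_residues (V := V) p, ← card_biUnion]
    · congr 1
      ext y
      simp only [mem_biUnion, hS, mem_filter]
      refine ⟨fun ⟨c, _, h, _⟩ => h, fun h => ?_⟩
      refine ⟨b + (-(W * ∑ v, L i v * y v) - b) % p, mem_Ico.2 ⟨?_, ?_⟩, h, ?_⟩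
      · linarith [Int.emod_nonneg (-(W * ∑ v, L i v * y v) - b) hp0.ne']
      · linarith [Int.emod_lt_of_pos (-(W * ∑ v, L i v * y v) - b) hp0]
      · have : (p : ℤ) ∣ (-(W * ∑ v, L i v * y v) - b) - (-(W * ∑ v, L i v * y v) - b) % p :=
          Int.dvd_self_sub_emod
        rw [← dvd_neg] at this
        have e : ∀ X r : ℤ, -(-X - b - r) = X + (b + r) := fun X r => by ring
        rwa [e] at this
    · intro c hc c' hc' hcc
      rw [Function.onFun, disjoint_left]
      intro y hy hy'
      rw [mem_filter] at hy hy'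
      have h3 : (p : ℤ) ∣ c - c' := by
        have := dvd_sub hy.2 hy'.2
        rwa [add_sub_add_left_eq_sub] at this
      rw [mem_coe, mem_Ico] at hc hc'
      exact hcc (sub_eq_zero.1 (Int.eq_zero_of_abs_lt_dvd h3
        (abs_lt.2 ⟨by linarith, by linarith⟩)))
  have hV : 1 ≤ Fintype.card V := Fintype.card_pos_iff.2 ⟨u⟩
  have h3 : (S b).card = p ^ (Fintype.card V - 1) := by
    refine (sum_eq_sum_iff_of_le h1).1 ?_ b (mem_Ico.2 ⟨le_rfl, by linarith⟩)
    rw [h2, sum_const, Int.card_Ico, add_sub_cancel_left, Int.toNat_natCast, smul_eq_mul,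
      ← pow_succ', Nat.sub_add_cancel hV]
  have hpr : (p : ℝ) ≠ 0 := by exact_mod_cast hp.ne_zero
  have h4 : ∑ y ∈ residues V p, hit W b L p {i} y = (S b).card := by
    simp only [hit, mem_singleton, forall_eq, hS]
    rw [sum_boole]
  rw [localDensity, expect_eq_sum_div_card, h4, h3, card_residues]
  push_cast
  obtain ⟨k, hk⟩ := Nat.exists_eq_add_of_le hV
  rw [hk, Nat.add_sub_cancel_left, pow_add, pow_one]
  field_simp

lemma localDensity_nonneg : 0 ≤ localDensity W b L p B := expect_nonneg fun y _ => hit_nonneg y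

lemma localDensity_le (hp : p.Prime) (hW : ¬ (p : ℤ) ∣ W) {i i' : I} (hi : i ∈ B) (hi' : i' ∈ B)
    {u u' : V} (hu : ¬ (p : ℤ) ∣ L i u) (hu' : ¬ (p : ℤ) ∣ L i' u') (h0 : L i' u = 0) :
    localDensity W b L p B ≤ ((p : ℝ) ^ 2)⁻¹ := by
  have huu : u ≠ u' := by
    rintro rfl
    exact hu' (h0 ▸ dvd_zero _)
  set S := (residues V p).filter fun y => ∀ i ∈ B, (p : ℤ) ∣ W * ∑ v, L i v * y v + b with hS
  have h1 : S.card ≤ p ^ (Fintype.card V - 2) := by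
    rw [← card_pair huu]
    refine card_le_of_determined (filter_subset _ _) _ fun y hy y' hy' h => ?_
    rw [mem_filter] at hy hy'
    have e1 : y u' = y' u' := by
      refine eq_of_dvd_forms hp hW hu' hy.1 hy'.1 (hy.2 i' hi') (hy'.2 i' hi') fun v hv => ?_
      by_cases hvu : v = u
      · rw [hvu, h0, zero_mul, zero_mul]
      · rw [h v (by simp [hv, hvu])]
    have e2 : y u = y' u := by
      refine eq_of_dvd_forms hp hW hu hy.1 hy'.1 (hy.2 i hi) (hy'.2 i hi) fun v hv => ?_
      by_cases hvu : v = u'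
      · rw [hvu, e1]
      · rw [h v (by simp [hv, hvu])]
    funext v
    by_cases hv : v = u
    · rw [hv, e2]
    · by_cases hv' : v = u'
      · rw [hv', e1]
      · exact h v (by simp [hv, hv'])
  have hV : 2 ≤ Fintype.card V := by
    rw [← card_pair huu]
    exact card_le_univ _
  have hpr : (0 : ℝ) < p := by exact_mod_cast hp.pos
  have h4 : ∑ y ∈ residues V p, hit W b L p B y = S.card := by
    simp only [hit, hS]
    rw [sum_boole]
  have h5 : (S.card : ℝ) ≤ (p : ℝ) ^ (Fintype.card V - 2) := by exact_mod_cast h1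
  rw [localDensity, expect_eq_sum_div_card, h4, card_residues]
  obtain ⟨k, hk⟩ := Nat.exists_eq_add_of_le hV
  rw [hk, Nat.add_sub_cancel_left] at h5
  rw [hk]
  push_cast
  rw [pow_add, div_le_iff₀ (by positivity), inv_mul_cancel_left₀ (by positivity)]
  exact h5

theorem abs_localDensity_sub_le (hp : p.Prime) (hW : ¬ (p : ℤ) ∣ W) {A : ℕ} (hA : A < p)
    (hL : ∀ i v, |L i v| ≤ A) (h0 : ∀ i, ∃ v, L i v ≠ 0)
    (h1 : ∀ i i', i ≠ i' → ∃ v, ¬ (L i v = 0 ↔ L i' v = 0)) (B : Finset I) :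
    |localDensity W b L p B - (p : ℝ)⁻¹ ^ B.card| ≤ ((p : ℝ) ^ 2)⁻¹ := by
  have hpr : (1 : ℝ) ≤ p := by exact_mod_cast hp.one_le
  have hdvd : ∀ i v, L i v ≠ 0 → ¬ (p : ℤ) ∣ L i v := fun i v h hd =>
    h (Int.eq_zero_of_abs_lt_dvd hd ((hL i v).trans_lt (by exact_mod_cast hA)))
  rcases lt_or_ge B.card 2 with hB | hB
  · have : localDensity W b L p B = (p : ℝ)⁻¹ ^ B.card := by
      interval_cases h : B.card
      · rw [card_eq_zero.1 h, localDensity_empty hp.one_le, pow_zero]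
      · obtain ⟨i, rfl⟩ := card_eq_one.1 h
        obtain ⟨v, hv⟩ := h0 i
        rw [localDensity_singleton hp hW (hdvd i v hv), pow_one]
    rw [this, sub_self, abs_zero]
    positivity
  · obtain ⟨i, hi, i', hi', hii⟩ := one_lt_card.1 hB
    have h2 : localDensity W b L p B ≤ ((p : ℝ) ^ 2)⁻¹ := by
      obtain ⟨u, hu⟩ := h1 i i' hii
      by_cases hz : L i u = 0
      · have hz' : L i' u ≠ 0 := fun h => hu (by simp [hz, h])
        obtain ⟨v, hv⟩ := h0 i
        exact localDensity_le hp hW hi' hi (hdvd _ _ hz') (hdvd _ _ hv) hz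
      · have hz' : L i' u = 0 := by
          by_contra h
          exact hu (by simp [hz, h])
        obtain ⟨v, hv⟩ := h0 i'
        exact localDensity_le hp hW hi hi' (hdvd _ _ hz) (hdvd _ _ hv) hz'
    have h3 : (p : ℝ)⁻¹ ^ B.card ≤ ((p : ℝ) ^ 2)⁻¹ := by
      rw [← inv_pow]
      exact pow_le_pow_of_le_one (by positivity) (inv_le_one_of_one_le₀ hpr) hB
    have h4 : 0 ≤ localDensity W b L p B := localDensity_nonneg
    have h5 : 0 ≤ (p : ℝ)⁻¹ ^ B.card := by positivity
    rw [abs_le]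
    constructor <;> linarith

end

noncomputable section

/-- The majorant given by the Selberg sieve along the progression `W * n + b`. -/
def sieveWeight (P : Finset ℕ) (R : ℕ) (W b n : ℤ) : ℝ :=
  sieveSum P R * (∑ D ∈ P.powerset.filter (fun D : Finset ℕ => ∀ p ∈ D, (p : ℤ) ∣ W * n + b),
    selberg P R D) ^ 2

variable {P : Finset ℕ} {R : ℕ} {V I : Type} [Fintype V] [DecidableEq V] [Fintype I]
  [DecidableEq I] {W b : ℤ} {L : I → V → ℤ}

lemma sieveWeight_nonneg (hP : ∀ p ∈ P, p.Prime) (hR : 1 ≤ R) (n : ℤ) :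
    0 ≤ sieveWeight P R W b n :=
  mul_nonneg (zero_le_one.trans (one_le_sieveSum hP hR)) (sq_nonneg _)

lemma sieveWeight_eq (n : ℤ) : sieveWeight P R W b n = sieveSum P R * ∑ x ∈ pairs P,
    if ∀ p ∈ x.1 ∪ x.2, (p : ℤ) ∣ W * n + b then selberg P R x.1 * selberg P R x.2 else 0 := by
  rw [sieveWeight, sq, sum_mul_sum, pairs, sum_product, sum_filter]
  congr 1
  refine sum_congr rfl fun D _ => ?_
  rw [sum_filter]
  split_ifs with h
  · refine sum_congr rfl fun D' _ => ?_
    refine if_congr ?_ rfl rfl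
    simp only [mem_union]
    exact ⟨fun h' p hp => hp.elim (h p) (h' p), fun h' p hp => h' p (Or.inr hp)⟩
  · refine (sum_eq_zero fun D' _ => if_neg fun h' => h fun p hp => h' p ?_).symm
    exact mem_union_left _ hp

lemma prod_sieveWeight (x : V → ℤ) : ∏ i, sieveWeight P R W b (∑ v, L i v * x v) =
    sieveSum P R ^ Fintype.card I * ∑ e ∈ Fintype.piFinset fun _ : I => pairs P,
      (∏ i, selberg P R (e i).1 * selberg P R (e i).2) * ∏ p ∈ P, hit W b L p (occ e p) x := by
  simp only [sieveWeight_eq]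
  rw [prod_mul_distrib, prod_const, card_univ, prod_univ_sum]
  congr 1
  refine sum_congr rfl fun e he => ?_
  simp only [hit]
  rw [prod_ite_zero]
  have hm := Fintype.mem_piFinset.1 he
  simp only [pairs, mem_product, mem_powerset] at hm
  split_ifs with h
  · rw [prod_eq_one (s := P), mul_one]
    refine fun p _ => if_pos fun i hi => ?_
    rw [occ, mem_filter] at hi
    exact h i (mem_univ i) p hi.2
  · push Not at h
    obtain ⟨i, -, p, hp, hd⟩ := h
    rw [prod_eq_zero (union_subset (hm i).1 (hm i).2 hp), mul_zero]
    exact if_neg fun h => hd (h i (mem_filter.2 ⟨mem_univ i, hp⟩))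

lemma abs_expect_hit_sub_le (hP : ∀ p ∈ P, p.Prime) {m N : ℕ} (hV : Fintype.card V ≤ m)
    (hI : Fintype.card I ≤ m) (hR : 1 ≤ R) (hN : m * R ^ (2 * m) ≤ N) (hN0 : 1 ≤ N) {a : V → ℕ}
    (ha : ∀ v, N ≤ a v) {e : I → Finset ℕ × Finset ℕ}
    (he : e ∈ Fintype.piFinset fun _ : I => pairs P)
    (h0 : ∏ i, selberg P R (e i).1 * selberg P R (e i).2 ≠ 0) :
    |𝔼 x ∈ Fintype.piFinset fun v => Icc (-(a v : ℤ)) (a v), ∏ p ∈ P, hit W b L p (occ e p) x -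
      ∏ p ∈ P, localDensity W b L p (occ e p)| ≤ 2 * (m * R ^ (2 * m) / N) := by
  set T := P.filter fun p => (occ e p).Nonempty with hT
  have hTP : ∀ p ∈ T, p.Prime := fun p hp => hP p (mem_filter.1 hp).1
  have hq1 : 1 ≤ ∏ p ∈ T, p := prod_pos fun p hp => (hTP p hp).pos
  have hemp : ∀ p ∈ P, p ∉ T → occ e p = ∅ := fun p hp h =>
    not_nonempty_iff_eq_empty.1 fun h' => h (mem_filter.2 ⟨hp, h'⟩)
  have e1 : ∀ x, ∏ p ∈ P, hit W b L p (occ e p) x = ∏ p ∈ T, hit W b L p (occ e p) x := fun x =>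
    (prod_subset (filter_subset _ _) fun p hp h => by rw [hemp p hp h]; simp [hit]).symm
  have e2 : ∏ p ∈ P, localDensity W b L p (occ e p) =
      ∏ p ∈ T, localDensity W b L p (occ e p) :=
    (prod_subset (filter_subset _ _) fun p hp h => by
      rw [hemp p hp h, localDensity_empty (hP p hp).one_le]).symm
  have hm := Fintype.mem_piFinset.1 he
  simp only [pairs, mem_product, mem_powerset] at hm
  have hle : ∀ D, selberg P R D ≠ 0 → ∏ p ∈ D, p ≤ R := fun D hD => by
    by_contra h
    exact hD (selberg_eq_zero hP (not_le.1 h))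
  have hq : ∏ p ∈ T, p ≤ R ^ (2 * m) := by
    have hd : ∏ p ∈ T, p ∣ ∏ i, ((∏ p ∈ (e i).1, p) * ∏ p ∈ (e i).2, p) := by
      refine prod_primes_dvd _ (fun p hp => (hTP p hp).prime) fun p hp => ?_
      obtain ⟨i, hi⟩ := (mem_filter.1 hp).2
      refine dvd_trans ?_ (dvd_prod_of_mem _ (mem_univ i))
      rcases mem_union.1 (mem_filter.1 hi).2 with h | h
      · exact (dvd_prod_of_mem (fun p => p) h).mul_right _
      · exact (dvd_prod_of_mem (fun p => p) h).mul_left _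
    have hpos : 0 < ∏ i, ((∏ p ∈ (e i).1, p) * ∏ p ∈ (e i).2, p) :=
      prod_pos fun i _ => mul_pos (prod_pos fun p hp => (hP p ((hm i).1 hp)).pos)
        (prod_pos fun p hp => (hP p ((hm i).2 hp)).pos)
    refine (Nat.le_of_dvd hpos hd).trans ?_
    have : ∏ i : I, ((∏ p ∈ (e i).1, p) * ∏ p ∈ (e i).2, p) ≤ ∏ i : I, R ^ 2 := by
      refine prod_le_prod' fun i _ => ?_
      have := prod_ne_zero_iff.1 h0 i (mem_univ i)
      rw [sq]
      exact Nat.mul_le_mul (hle _ (left_ne_zero_of_mul this)) (hle _ (right_ne_zero_of_mul this))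
    refine this.trans ?_
    rw [prod_const, card_univ, ← pow_mul]
    exact Nat.pow_le_pow_right hR (by omega)
  have hper : PeriodicMod (∏ p ∈ T, p) fun x : V → ℤ => ∏ p ∈ T, hit W b L p (occ e p) x :=
    fun y y' h => prod_congr rfl fun p hp =>
      (periodicMod_hit.of_dvd (dvd_prod_of_mem (fun p => p) hp)) y y' h
  have key := abs_expect_box_sub_le hq1 hper (fun y => ?_) ha
    ((Nat.mul_le_mul hV hq).trans hN) hN0
  · rw [expect_residues_prod hTP fun p _ => periodicMod_hit] at key
    rw [e2, expect_congr rfl fun x _ => e1 x]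
    refine key.trans ?_
    have h1 : ((∏ p ∈ T, p : ℕ) : ℝ) ≤ (R : ℝ) ^ (2 * m) := by exact_mod_cast hq
    have h2 : (Fintype.card V : ℝ) ≤ m := by exact_mod_cast hV
    gcongr
  · rw [abs_of_nonneg (prod_nonneg fun _ _ => hit_nonneg _)]
    exact prod_le_one (fun _ _ => hit_nonneg _) fun _ _ => hit_le_one _

lemma sum_abs_selberg_le (hP : ∀ p ∈ P, p.Prime) (hR : 1 ≤ R) :
    ∑ e ∈ Fintype.piFinset fun _ : I => pairs P,
      |∏ i, selberg P R (e i).1 * selberg P R (e i).2| ≤ (R : ℝ) ^ (4 * Fintype.card I) := by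
  have h1 : ∑ D ∈ P.powerset, |selberg P R D| ≤ (R : ℝ) ^ 2 := by
    rw [← sum_filter_add_sum_filter_not P.powerset (fun s => ∏ p ∈ s, p ≤ R),
      sum_eq_zero (s := P.powerset.filter fun s => ¬ ∏ p ∈ s, p ≤ R), add_zero]
    · refine (sum_le_card_nsmul _ _ (R : ℝ) fun D _ => abs_selberg_le hP hR D).trans ?_
      rw [nsmul_eq_mul, sq]
      gcongr
      exact_mod_cast card_filter_prod_le hP
    · intro D hD
      rw [selberg_eq_zero hP (not_le.1 (mem_filter.1 hD).2), abs_zero]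
  simp only [abs_prod, abs_mul]
  rw [← prod_univ_sum (fun _ : I => pairs P)
    fun _ x => |selberg P R x.1| * |selberg P R x.2|, prod_const, card_univ]
  have h2 : ∑ x ∈ pairs P, |selberg P R x.1| * |selberg P R x.2| ≤ (R : ℝ) ^ 4 := by
    rw [pairs, sum_product]
    dsimp only
    rw [← sum_mul_sum, show 4 = 2 + 2 from rfl, pow_add]
    exact mul_le_mul h1 h1 (sum_nonneg fun _ _ => abs_nonneg _) (by positivity)
  rw [pow_mul]
  exact pow_le_pow_left₀ (sum_nonneg fun _ _ => by positivity) h2 _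

theorem pseudoRandom_sieveWeight (hP : ∀ p ∈ P, p.Prime) (hR : 1 ≤ R) {m A N : ℕ}
    (hW : ∀ p ∈ P, ¬ (p : ℤ) ∣ W) (hA : ∀ p ∈ P, A < p) (hN : m * R ^ (2 * m) ≤ N) (hN0 : 1 ≤ N) :
    PseudoRandom (sieveWeight P R W b) m A N
      (∏ p ∈ P, (1 + 128 ^ m * ((p : ℝ) ^ 2)⁻¹) - 1 + 2 * (m * R ^ (7 * m) / N)) := by
  intro V I _ _ _ L a hV hI hL h0 h1 ha
  classical
  set G := sieveSum P R with hG
  have hG1 : 1 ≤ G := one_le_sieveSum hP hR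
  have hGR : G ≤ R := sieveSum_le hP
  have hR1 : (1 : ℝ) ≤ R := by exact_mod_cast hR
  have hN1 : (1 : ℝ) ≤ N := by exact_mod_cast hN0
  set c : (I → Finset ℕ × Finset ℕ) → ℝ := fun e =>
    ∏ i, selberg P R (e i).1 * selberg P R (e i).2 with hc
  set X := Fintype.piFinset fun v => Icc (-(a v : ℤ)) (a v)
  have e1 : 𝔼 x ∈ X, ∏ i, sieveWeight P R W b (∑ v, L i v * x v) = G ^ Fintype.card I *
      ∑ e ∈ Fintype.piFinset fun _ : I => pairs P,
        c e * 𝔼 x ∈ X, ∏ p ∈ P, hit W b L p (occ e p) x := by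
    rw [expect_congr rfl fun x _ => prod_sieveWeight x, ← mul_expect, expect_sum_comm]
    congr 1
    exact sum_congr rfl fun e _ => (mul_expect _ _ _).symm
  have e2 : |𝔼 x ∈ X, ∏ i, sieveWeight P R W b (∑ v, L i v * x v) -
      G ^ Fintype.card I * localSum I P R (localDensity W b L)| ≤ 2 * (m * R ^ (7 * m) / N) := by
    rw [e1, localSum, ← mul_sub, ← sum_sub_distrib, abs_mul, abs_of_nonneg (by positivity)]
    have h2 : |∑ e ∈ Fintype.piFinset fun _ : I => pairs P,
        (c e * 𝔼 x ∈ X, ∏ p ∈ P, hit W b L p (occ e p) x -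
        c e * ∏ p ∈ P, localDensity W b L p (occ e p))| ≤
        R ^ (4 * m) * (2 * (m * R ^ (2 * m) / N)) := by
      refine (abs_sum_le_sum_abs _ _).trans ((sum_le_sum (g := fun e =>
        |c e| * (2 * (m * R ^ (2 * m) / N))) fun e he => ?_).trans ?_)
      · rw [← mul_sub, abs_mul]
        by_cases hce : c e = 0
        · simp [hce]
        · exact mul_le_mul_of_nonneg_left
            (abs_expect_hit_sub_le hP hV hI hR hN hN0 ha he hce) (abs_nonneg _)
      · rw [← sum_mul]
        refine mul_le_mul_of_nonneg_right ((sum_abs_selberg_le hP hR).trans ?_) (by positivity)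
        exact pow_le_pow_right₀ hR1 (by omega)
    have h3 : G ^ Fintype.card I ≤ (R : ℝ) ^ m :=
      (pow_le_pow_left₀ (by positivity) hGR _).trans (pow_le_pow_right₀ hR1 hI)
    refine (mul_le_mul h3 h2 (abs_nonneg _) (by positivity)).trans (le_of_eq ?_)
    have : 7 * m = m + 4 * m + 2 * m := by ring
    rw [this, pow_add, pow_add]
    ring
  have e3 : |G ^ Fintype.card I * localSum I P R (localDensity W b L) - 1| ≤
      ∏ p ∈ P, (1 + 128 ^ m * ((p : ℝ) ^ 2)⁻¹) - 1 := by
    have h2 := abs_localSum_sub_le (I := I) hP hR (α := localDensity W b L) fun p hp B =>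
      abs_localDensity_sub_le (hP p hp) (hW p hp) (hA p hp) hL h0 h1 B
    have hGp : (0 : ℝ) < G ^ Fintype.card I := by positivity
    have h3 : G ^ Fintype.card I * localSum I P R (localDensity W b L) - 1 = G ^ Fintype.card I *
        (localSum I P R (localDensity W b L) - G⁻¹ ^ Fintype.card I) := by
      rw [mul_sub, inv_pow, mul_inv_cancel₀ hGp.ne']
    rw [h3, abs_mul, abs_of_pos hGp]
    refine (mul_le_mul_of_nonneg_left h2 hGp.le).trans ?_
    rw [← hG, ← mul_assoc, inv_pow, mul_inv_cancel₀ hGp.ne', one_mul]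
    refine sub_le_sub_right (prod_le_prod (fun _ _ => by positivity) fun p _ => ?_) _
    gcongr
    norm_num
  have := abs_sub_le (𝔼 x ∈ X, ∏ i, sieveWeight P R W b (∑ v, L i v * x v))
    (G ^ Fintype.card I * localSum I P R (localDensity W b L)) 1
  linarith

end

noncomputable section

/-- The primes in `(w, R]`. -/
def primesIoc (w R : ℕ) : Finset ℕ := (Ioc w R).filter Nat.Prime

/-- The product of the primes up to `w`. -/
def smallProd (w : ℕ) : ℕ := ∏ p ∈ primesIoc 0 w, p

/-- The density of the integers coprime to all primes up to `w`. -/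
def kappa (w : ℕ) : ℝ := ∏ p ∈ primesIoc 0 w, (1 - (p : ℝ)⁻¹)

lemma mem_primesIoc {w R p : ℕ} : p ∈ primesIoc w R ↔ (w < p ∧ p ≤ R) ∧ p.Prime := by
  simp [primesIoc]

lemma prime_of_mem_primesIoc {w R : ℕ} : ∀ p ∈ primesIoc w R, p.Prime :=
  fun _ hp => (mem_primesIoc.1 hp).2

lemma one_sub_inv_pos {p : ℕ} (hp : p.Prime) : (0 : ℝ) < 1 - (p : ℝ)⁻¹ := by
  have : (1 : ℝ) < p := by exact_mod_cast hp.one_lt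
  have := inv_lt_one_of_one_lt₀ this
  linarith

lemma kappa_pos (w : ℕ) : 0 < kappa w :=
  prod_pos fun p hp => one_sub_inv_pos (prime_of_mem_primesIoc p hp)

lemma kappa_le_one (w : ℕ) : kappa w ≤ 1 :=
  prod_le_one (fun p hp => (one_sub_inv_pos (prime_of_mem_primesIoc p hp)).le) fun p _ => by
    have : (0 : ℝ) ≤ (p : ℝ)⁻¹ := by positivity
    linarith

lemma smallProd_pos (w : ℕ) : 0 < smallProd w :=
  prod_pos fun p hp => (prime_of_mem_primesIoc p hp).pos

lemma totient_smallProd (w : ℕ) : ((smallProd w).totient : ℝ) = smallProd w * kappa w := by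
  have h := Nat.totient_eq_mul_prod_factors (smallProd w)
  rw [smallProd, Nat.primeFactors_prod prime_of_mem_primesIoc, ← smallProd] at h
  have h' := congrArg (fun q : ℚ => (q : ℝ)) h
  push_cast at h'
  exact h'

lemma sum_inv_le_of_factored {F U : Finset ℕ} (hU : ∀ p ∈ U, p.Prime)
    (hF : ∀ n ∈ F, n ∈ Nat.factoredNumbers U) :
    ∑ n ∈ F, (n : ℝ)⁻¹ ≤ ∏ p ∈ U, (1 - (p : ℝ)⁻¹)⁻¹ := by
  classical
  let f : ℕ →* ℝ := ⟨⟨fun n => (n : ℝ)⁻¹, by simp⟩, fun a b => by push_cast; rw [mul_inv]⟩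
  have hf : ∀ {p : ℕ}, p.Prime → ‖f p‖ < 1 := by
    intro p hp
    have : (1 : ℝ) < p := by exact_mod_cast hp.one_lt
    have h := inv_lt_one_of_one_lt₀ this
    simpa [f] using h
  have h := (EulerProduct.summable_and_hasSum_factoredNumbers_prod_filter_prime_geometric hf U).2
  have h2 := sum_le_hasSum (F.subtype (· ∈ Nat.factoredNumbers U))
    (fun i _ => (by simp [f] : 0 ≤ f i)) h
  rw [filter_true_of_mem hU] at h2
  rwa [sum_subtype_of_mem (fun n : ℕ => f n) hF] at h2

lemma sum_inv_fiber_le {w R : ℕ} {D : Finset ℕ} (hD : D ⊆ primesIoc w R) :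
    ∑ n ∈ (Icc 1 R).filter (fun n => n.primeFactors ∩ primesIoc w R = D), (n : ℝ)⁻¹
      ≤ (phi D)⁻¹ * (kappa w)⁻¹ := by
  have hDp : ∀ p ∈ D, p.Prime := fun p hp => prime_of_mem_primesIoc p (hD hp)
  set S := (Icc 1 R).filter (fun n => n.primeFactors ∩ primesIoc w R = D) with hS
  set q := ∏ p ∈ D, p with hq
  have hq0 : 0 < q := prod_pos fun p hp => (hDp p hp).pos
  have hdvd : ∀ n ∈ S, q ∣ n := by
    intro n hn
    rw [mem_filter, mem_Icc] at hn
    refine (prod_dvd_prod_of_subset _ _ _ ?_).trans (Nat.prod_primeFactors_dvd n)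
    rw [← hn.2]; exact inter_subset_left
  have hinj : Set.InjOn (fun n : ℕ => n / q) S := by
    intro a ha b hb hab
    dsimp only at hab
    rw [← Nat.div_mul_cancel (hdvd a ha), hab, Nat.div_mul_cancel (hdvd b hb)]
  have hdisj : Disjoint (primesIoc 0 w) D := by
    rw [disjoint_left]
    intro p hp hp'
    have h1 := mem_primesIoc.1 hp
    have h2 := mem_primesIoc.1 (hD hp')
    omega
  have h1 : ∑ n ∈ S, (n : ℝ)⁻¹ = (q : ℝ)⁻¹ * ∑ x ∈ S.image (fun n => n / q), (x : ℝ)⁻¹ := by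
    rw [sum_image hinj, mul_sum]
    refine sum_congr rfl fun n hn => ?_
    rw [← mul_inv, ← Nat.cast_mul, Nat.mul_div_cancel' (hdvd n hn)]
  have h2 : ∑ x ∈ S.image (fun n => n / q), (x : ℝ)⁻¹ ≤
      ∏ p ∈ primesIoc 0 w ∪ D, (1 - (p : ℝ)⁻¹)⁻¹ := by
    refine sum_inv_le_of_factored (fun p hp => ?_) fun x hx => ?_
    · rcases mem_union.1 hp with h | h
      · exact prime_of_mem_primesIoc p h
      · exact hDp p h
    · obtain ⟨n, hn, rfl⟩ := mem_image.1 hx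
      have hn' := (mem_filter.1 hn)
      rw [mem_Icc] at hn'
      refine Nat.mem_factoredNumbers_of_primeFactors_subset ?_ fun p hp => ?_
      · exact (Nat.div_pos (Nat.le_of_dvd (by omega) (hdvd n hn)) hq0).ne'
      · have hpn : p ∈ n.primeFactors :=
          Nat.primeFactors_mono (Nat.div_dvd_of_dvd (hdvd n hn)) (by omega) hp
        have hpp := Nat.prime_of_mem_primeFactors hpn
        have hpR := (Nat.le_of_mem_primeFactors hpn).trans hn'.1.2
        rw [mem_union]
        by_cases h : p ≤ w
        · exact Or.inl (mem_primesIoc.2 ⟨⟨hpp.pos, h⟩, hpp⟩)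
        · right
          rw [← hn'.2, mem_inter]
          exact ⟨hpn, mem_primesIoc.2 ⟨⟨by omega, hpR⟩, hpp⟩⟩
  rw [h1]
  refine (mul_le_mul_of_nonneg_left h2 (by positivity)).trans_eq ?_
  rw [prod_union hdisj, kappa, ← prod_inv_distrib, phi, ← prod_inv_distrib, hq, Nat.cast_prod,
    ← prod_inv_distrib, mul_left_comm, ← prod_mul_distrib, mul_comm]
  congr 1
  refine prod_congr rfl fun p hp => ?_
  have : (p : ℝ) ≠ 0 := by exact_mod_cast (hDp p hp).ne_zero
  rw [← mul_inv, mul_sub, mul_inv_cancel₀ this, mul_one]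

lemma kappa_mul_log_le_sieveSum (w R : ℕ) :
    kappa w * Real.log R ≤ sieveSum (primesIoc w R) R := by
  rcases Nat.eq_zero_or_pos R with rfl | hR
  · simp only [CharP.cast_eq_zero, Real.log_zero, mul_zero, sieveSum]
    refine sum_nonneg fun s hs => (inv_pos.2 (phi_pos fun p hp => ?_)).le
    exact prime_of_mem_primesIoc p (mem_powerset.1 (mem_filter.1 hs).1 hp)
  have h1 : Real.log R ≤ ∑ n ∈ Icc 1 R, (n : ℝ)⁻¹ := by
    have h := log_add_one_le_harmonic R
    rw [harmonic_eq_sum_Icc] at h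
    push_cast at h
    refine (Real.log_le_log (by positivity) ?_).trans h
    linarith
  have hmaps : ∀ n ∈ Icc 1 R, n.primeFactors ∩ primesIoc w R ∈
      (primesIoc w R).powerset.filter (fun s => ∏ p ∈ s, p ≤ R) := by
    intro n hn
    rw [mem_Icc] at hn
    rw [mem_filter, mem_powerset]
    refine ⟨inter_subset_right, le_trans (Nat.le_of_dvd (by omega) ?_) hn.2⟩
    exact (prod_dvd_prod_of_subset _ _ _ inter_subset_left).trans (Nat.prod_primeFactors_dvd n)
  rw [← sum_fiberwise_of_maps_to hmaps] at h1
  have h2 : Real.log R ≤ sieveSum (primesIoc w R) R * (kappa w)⁻¹ := by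
    refine h1.trans ?_
    rw [sieveSum, sum_mul]
    exact sum_le_sum fun D hD => sum_inv_fiber_le (mem_powerset.1 (mem_filter.1 hD).1)
  rwa [← div_eq_mul_inv, le_div_iff₀ (kappa_pos w), mul_comm] at h2

end

noncomputable section

/-- The normalised indicator of the primes exceeding `R` along `W * z + b`. -/
def primeWeight (w R b : ℕ) (z : ℤ) : ℝ :=
  if (smallProd w * z + b : ℤ).toNat.Prime ∧ R < (smallProd w * z + b : ℤ).toNat then
    kappa w * Real.log R else 0

lemma primeWeight_nonneg (w R b : ℕ) (z : ℤ) : 0 ≤ primeWeight w R b z := by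
  rw [primeWeight]
  split_ifs
  · exact mul_nonneg (kappa_pos w).le (Real.log_natCast_nonneg R)
  · rfl

lemma primeWeight_le_log (w R b : ℕ) (z : ℤ) : primeWeight w R b z ≤ Real.log R := by
  have := Real.log_natCast_nonneg R
  rw [primeWeight]
  split_ifs
  · exact mul_le_of_le_one_left this (kappa_le_one w)
  · exact this

lemma primeWeight_le_sieveWeight {w R : ℕ} (hR : 1 ≤ R) (b : ℕ) (z : ℤ) :
    primeWeight w R b z ≤ sieveWeight (primesIoc w R) R (smallProd w) b z := by
  rw [primeWeight]
  split_ifs with h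
  · have hf : (primesIoc w R).powerset.filter
        (fun D : Finset ℕ => ∀ p ∈ D, (p : ℤ) ∣ (smallProd w : ℤ) * z + (b : ℤ)) = {∅} := by
      ext D
      simp only [mem_filter, mem_powerset, mem_singleton]
      constructor
      · rintro ⟨hD, hd⟩
        refine eq_empty_of_forall_notMem fun p hp => ?_
        have h1 := mem_primesIoc.1 (hD hp)
        have h2 := hd p hp
        rw [← Int.toNat_of_nonneg (a := (smallProd w : ℤ) * z + b) (by omega),
          Int.natCast_dvd_natCast, Nat.prime_dvd_prime_iff_eq h1.2 h.1] at h2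
        omega
      · rintro rfl
        simp
    rw [sieveWeight, hf, sum_singleton, selberg_empty prime_of_mem_primesIoc hR, one_pow, mul_one]
    exact kappa_mul_log_le_sieveSum w R
  · exact sieveWeight_nonneg prime_of_mem_primesIoc hR z

lemma div_four_le_primeCounting_mul_log {n : ℕ} (hn : 4 ≤ n) :
    (n : ℝ) / 4 ≤ n.primeCounting * Real.log n := by
  have h1 := Chebyshev.psi_ge n
  have h2 := Chebyshev.psi_le_primeCounting_mul_log n
  have h3 : Real.log ((n : ℝ) + 1) ≤ ((n : ℝ) + 1) / 8 - 1 + 3 * Real.log 2 := by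
    have e : (n : ℝ) + 1 = ((n : ℝ) + 1) / 8 * 2 ^ 3 := by ring
    have := Real.log_le_sub_one_of_pos (show 0 < ((n : ℝ) + 1) / 8 by positivity)
    rw [e, Real.log_mul (by positivity) (by positivity), Real.log_pow, ← e]
    push_cast
    linarith
  have h4 := Real.log_two_gt_d9
  have h5 : (4 : ℝ) ≤ n := by exact_mod_cast hn
  nlinarith

/-- The number of `z < N` for which `W * z + b` is a prime exceeding `R`. -/
def primeCount (w R N b : ℕ) : ℕ :=
  ((range N).filter fun z => (smallProd w * z + b).Prime ∧ R < smallProd w * z + b).card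

lemma sum_primeWeight (w R N b : ℕ) :
    ∑ z ∈ Ico (0 : ℤ) N, primeWeight w R b z = primeCount w R N b * (kappa w * Real.log R) := by
  have h : Ico (0 : ℤ) N = (range N).image (fun n : ℕ => (n : ℤ)) := by
    ext z
    simp only [mem_Ico, mem_image, mem_range]
    constructor
    · rintro ⟨h0, h1⟩
      exact ⟨z.toNat, by omega, by omega⟩
    · rintro ⟨n, hn, rfl⟩
      omega
  rw [h, sum_image (fun a _ b _ h => by exact_mod_cast h), primeCount, ← nsmul_eq_mul,
    ← sum_const, sum_filter]
  refine sum_congr rfl fun z _ => ?_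
  have e : ((smallProd w : ℤ) * (z : ℤ) + (b : ℤ)).toNat = smallProd w * z + b := by
    rw [← Nat.cast_mul, ← Nat.cast_add, Int.toNat_natCast]
  rw [primeWeight, e]

lemma coprime_smallProd {w q : ℕ} (hq : q.Prime) (hw : w < q) : (smallProd w).Coprime q := by
  refine Nat.Coprime.prod_left fun p hp => ?_
  have := mem_primesIoc.1 hp
  rw [Nat.coprime_primes this.2 hq]
  omega

lemma exists_primeCount_ge {w R : ℕ} (hwR : w ≤ R) (N : ℕ) :
    ∃ b : ℕ, (smallProd w * N).primeCounting ≤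
      R + 2 + (smallProd w).totient * primeCount w R N b := by
  set W := smallProd w with hW
  have hW0 : 0 < W := smallProd_pos w
  set T := (range (W * N)).filter fun q => q.Prime ∧ R < q with hT
  have h1 : (W * N).primeCounting ≤ R + 2 + T.card := by
    rw [← Nat.primesLE_card_eq_primeCounting]
    have hsub : Nat.primesLE (W * N) ⊆ (insert (W * N) (range (R + 1))) ∪ T := by
      intro q hq
      rw [Nat.mem_primesLE] at hq
      simp only [mem_union, mem_insert, mem_range, hT, mem_filter]
      by_cases h : q ≤ R
      · exact Or.inl (Or.inr (by omega))
      · by_cases h' : q = W * N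
        · exact Or.inl (Or.inl h')
        · exact Or.inr ⟨by omega, hq.2, by omega⟩
    have := (card_le_card hsub).trans (card_union_le _ _)
    have h2 := card_insert_le (W * N) (range (R + 1))
    rw [card_range] at h2
    omega
  set B := (range W).filter fun b => W.Coprime b with hB
  have hmaps : ∀ q ∈ T, q % W ∈ B := by
    intro q hq
    rw [mem_filter] at hq
    rw [mem_filter, mem_range]
    refine ⟨Nat.mod_lt _ hW0, ?_⟩
    rw [Nat.coprime_iff_gcd_eq_one, Nat.gcd_comm, ← Nat.gcd_rec]
    exact coprime_smallProd hq.2.1 (by omega)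
  have h2 : ∀ b ∈ B, (T.filter fun q => q % W = b).card ≤ primeCount w R N b := by
    intro b hb
    refine card_le_card_of_injOn (fun q => q / W) ?_ ?_
    · intro q hq
      simp only [coe_filter, mem_filter, hT, mem_range, Set.mem_ofPred_eq] at hq ⊢
      have e : W * (q / W) + b = q := by rw [← hq.2]; exact Nat.div_add_mod q W
      rw [← hW, e]
      exact ⟨Nat.div_lt_of_lt_mul hq.1.1, hq.1.2⟩
    · intro q hq q' hq' h
      simp only [coe_filter, Set.mem_ofPred_eq] at hq hq'
      dsimp only at h
      rw [← Nat.div_add_mod q W, ← Nat.div_add_mod q' W, h, hq.2, hq'.2]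
  have h3 := card_eq_sum_card_fiberwise hmaps
  have hBne : B.Nonempty := by
    rw [← card_pos, hB, ← Nat.totient_eq_card_coprime]
    exact Nat.totient_pos.2 hW0
  obtain ⟨b, hb, hmax⟩ := exists_max_image B (primeCount w R N) hBne
  refine ⟨b, h1.trans (Nat.add_le_add_left ?_ _)⟩
  rw [h3, Nat.totient_eq_card_coprime, ← hB, ← smul_eq_mul, ← sum_const]
  exact sum_le_sum fun i hi => (h2 i hi).trans (hmax i hi)

lemma exists_sum_primeWeight_ge {w R K : ℕ} (hK : 3 ≤ K) (hwR : w ≤ R) (hW : smallProd w ≤ R)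
    (hR : 16 * (K + 1) ≤ R) :
    ∃ b : ℕ, 1 / (8 * ((K : ℝ) + 1)) * ((R ^ K : ℕ) : ℝ) ≤
      ∑ z ∈ Ico (0 : ℤ) ((R ^ K : ℕ) : ℤ), primeWeight w R b z := by
  obtain ⟨b, hb⟩ := exists_primeCount_ge hwR (R ^ K)
  refine ⟨b, ?_⟩
  rw [sum_primeWeight]
  set W := smallProd w with hWdef
  set N := R ^ K with hN
  have hW0 : 0 < W := smallProd_pos w
  have hRN : R ^ 3 ≤ N := Nat.pow_le_pow_right (by omega) hK
  have hX4 : 4 ≤ W * N := by nlinarith [Nat.le_self_pow (show 3 ≠ 0 by norm_num) R]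
  have h1 := div_four_le_primeCounting_mul_log hX4
  have hR1 : (1 : ℝ) < R := by exact_mod_cast (show 1 < R by omega)
  have hL : 0 < Real.log R := Real.log_pos hR1
  have hLR : Real.log R ≤ R := (Real.log_le_sub_one_of_pos (by linarith)).trans (by linarith)
  have hlog : Real.log ((W * N : ℕ) : ℝ) ≤ ((K : ℝ) + 1) * Real.log R := by
    have : ((W * N : ℕ) : ℝ) ≤ (R : ℝ) ^ (K + 1) := by
      rw [pow_succ']
      exact_mod_cast Nat.mul_le_mul_right N hW
    refine (Real.log_le_log (by positivity) this).trans_eq ?_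
    rw [Real.log_pow]
    push_cast
    rfl
  have hb' : ((W * N).primeCounting : ℝ) ≤ R + 2 + W * kappa w * primeCount w R N b := by
    rw [← totient_smallProd]
    exact_mod_cast hb
  have hWr : (1 : ℝ) ≤ W := by exact_mod_cast hW0
  have hRNr : (R : ℝ) ^ 3 ≤ N := by exact_mod_cast hRN
  have hRr : 16 * ((K : ℝ) + 1) ≤ R := by exact_mod_cast hR
  set L := Real.log R
  set c := (primeCount w R N b : ℝ)
  set κ := kappa w
  set k := (K : ℝ) + 1
  have hk : 0 < k := by positivity
  have h2 : (W : ℝ) * N ≤ 4 * k * (R + 2 + W * κ * c) * L := by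
    have : ((W * N : ℕ) : ℝ) / 4 ≤ (R + 2 + W * κ * c) * (k * L) :=
      h1.trans (mul_le_mul hb' hlog (Real.log_natCast_nonneg _) ((Nat.cast_nonneg _).trans hb'))
    push_cast at this
    linarith
  have h3 : 4 * k * ((R : ℝ) + 2) * L ≤ W * N / 2 := by
    have a1 : ((R : ℝ) + 2) ≤ 2 * R := by linarith [show (2 : ℝ) ≤ R by exact_mod_cast (show 2 ≤ R by omega)]
    calc 4 * k * ((R : ℝ) + 2) * L ≤ 4 * k * (2 * R) * R := by gcongr
      _ = 16 * k * R ^ 2 / 2 := by ring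
      _ ≤ R * R ^ 2 / 2 := by gcongr
      _ = R ^ 3 / 2 := by ring
      _ ≤ N / 2 := by gcongr
      _ ≤ W * N / 2 := by
        gcongr
        exact le_mul_of_one_le_left (Nat.cast_nonneg _) hWr
  have h4 : (W : ℝ) * N ≤ W * (8 * k * (c * (κ * L))) := by nlinarith
  have h5 := le_of_mul_le_mul_left h4 (by linarith)
  rw [one_div, inv_mul_le_iff₀ (by positivity)]
  exact h5

end

noncomputable section

lemma card_filter_sum_eq_zero_le (n M : ℕ) :
    (univ.filter fun x : Fin (n + 1) → Box M => ∑ i, coeBox x i = 0).card ≤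
      Fintype.card (Fin n → Box M) := by
  rw [← card_univ]
  refine card_le_card_of_injOn (fun x => Fin.tail x) (fun _ _ => mem_coe.2 (mem_univ _)) ?_
  intro x hx y hy h
  simp only [coe_filter, mem_univ, true_and, Set.mem_ofPred_eq, Fin.sum_univ_succ] at hx hy
  have ht : ∀ i : Fin n, x i.succ = y i.succ := fun i => congrFun h i
  have hs : ∑ i : Fin n, coeBox x i.succ = ∑ i : Fin n, coeBox y i.succ :=
    sum_congr rfl fun i _ => by rw [coeBox, coeBox, ht i]
  funext i
  refine Fin.cases ?_ ht i
  refine Subtype.ext ?_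
  have : coeBox x 0 = coeBox y 0 := by linarith
  exact this

lemma exists_sum_ne_zero {n M : ℕ} {F : ℤ → ℝ} {L c : ℝ} (hF : ∀ z, 0 ≤ F z) (hL : ∀ z, F z ≤ L)
    (hc : c ≤ 𝔼 x : Fin (n + 1) → Box M, ∏ j, F (psi j (coeBox x)))
    (h : L ^ (n + 1) / (2 * M + 1) < c) :
    ∃ x : Fin (n + 1) → ℤ, ∑ i, x i ≠ 0 ∧ ∀ j, F (psi j x) ≠ 0 := by
  by_contra! hne
  refine (h.trans_le hc).not_ge ?_
  have hL0 : 0 ≤ L := (hF 0).trans (hL 0)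
  rw [Fintype.expect_eq_sum_div_card, Fintype.card_fun, Nat.cast_pow, card_box, Fintype.card_fin]
  have h1 : ∑ x : Fin (n + 1) → Box M, ∏ j, F (psi j (coeBox x)) ≤
      (2 * (M : ℝ) + 1) ^ n * L ^ (n + 1) := by
    calc ∑ x : Fin (n + 1) → Box M, ∏ j, F (psi j (coeBox x))
        ≤ ∑ x : Fin (n + 1) → Box M, if ∑ i, coeBox x i = 0 then L ^ (n + 1) else 0 := by
          refine sum_le_sum fun x _ => ?_
          split_ifs with h0
          · refine (prod_le_prod (fun j _ => hF _) fun j _ => hL _).trans_eq ?_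
            simp
          · obtain ⟨j, hj⟩ := hne (coeBox x) h0
            exact (prod_eq_zero (mem_univ j) hj).le
      _ = (univ.filter fun x : Fin (n + 1) → Box M => ∑ i, coeBox x i = 0).card *
          L ^ (n + 1) := by
          rw [← sum_filter, sum_const, nsmul_eq_mul]
      _ ≤ (Fintype.card (Fin n → Box M) : ℝ) * L ^ (n + 1) := by
          gcongr
          exact card_filter_sum_eq_zero_le n M
      _ = _ := by rw [Fintype.card_fun, Nat.cast_pow, card_box, Fintype.card_fin]
  rw [div_le_div_iff₀ (by positivity) (by positivity)]
  calc _ ≤ (2 * (M : ℝ) + 1) ^ n * L ^ (n + 1) * (2 * M + 1) := by gcongr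
    _ = _ := by ring

lemma psi_eq_add {k : ℕ} (j : Fin k) (x : Fin k → ℤ) :
    psi j x = -∑ i : Fin k, ((i : ℕ) : ℤ) * x i + (j : ℕ) * ∑ i, x i := by
  rw [psi, mul_sum, ← sum_neg_distrib, ← sum_add_distrib]
  exact sum_congr rfl fun i _ => by ring

lemma exists_progression_of_int {n R : ℕ} {Q D : ℤ} (hD : D ≠ 0)
    (h : ∀ j : ℕ, j ≤ n → (Q + j * D).toNat.Prime ∧ R < (Q + j * D).toNat) :
    ∃ a d : ℕ, R < a ∧ 1 ≤ d ∧ ∀ i : ℕ, i ≤ n → (a + i * d).Prime := by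
  rcases lt_or_gt_of_ne hD with hD | hD
  · refine ⟨(Q + n * D).toNat, (-D).toNat, (h n le_rfl).2, by omega, fun i hi => ?_⟩
    have h1 := (h (n - i) (by omega)).1
    have h2 := (h n le_rfl).2
    have h3 := (h (n - i) (by omega)).2
    have e : ((n - i : ℕ) : ℤ) = n - i := by omega
    have : (Q + n * D).toNat + i * (-D).toNat = (Q + (n - i : ℕ) * D).toNat := by
      zify
      rw [Int.toNat_of_nonneg (by omega), Int.toNat_of_nonneg (by omega),
        Int.toNat_of_nonneg (by omega), e]
      ring
    rwa [this]
  · have h0 := (h 0 (by omega)).2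
    refine ⟨(Q + (0 : ℕ) * D).toNat, D.toNat, h0, by omega, fun i hi => ?_⟩
    have h1 := (h i hi).1
    have h3 := (h i hi).2
    have : (Q + (0 : ℕ) * D).toNat + i * D.toNat = (Q + i * D).toNat := by
      zify
      rw [Int.toNat_of_nonneg (by omega), Int.toNat_of_nonneg (by omega),
        Int.toNat_of_nonneg (by omega)]
      ring
    rwa [this]

lemma prod_one_add_le_exp {w R : ℕ} (hw : w ≠ 0) {C : ℝ} (hC : 0 ≤ C) :
    ∏ p ∈ primesIoc w R, (1 + C * ((p : ℝ) ^ 2)⁻¹) ≤ Real.exp (C / w) := by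
  have h1 : ∑ p ∈ primesIoc w R, ((p : ℝ) ^ 2)⁻¹ ≤ (w : ℝ)⁻¹ := by
    rcases le_or_gt w R with h | h
    · refine (sum_le_sum_of_subset_of_nonneg (filter_subset _ _) fun _ _ _ => by positivity).trans
        ((sum_Ioc_inv_sq_le_sub hw h).trans ?_)
      have : (0 : ℝ) ≤ (R : ℝ)⁻¹ := by positivity
      linarith
    · rw [primesIoc, Ioc_eq_empty (by omega)]
      simp
  calc ∏ p ∈ primesIoc w R, (1 + C * ((p : ℝ) ^ 2)⁻¹)
      ≤ ∏ p ∈ primesIoc w R, Real.exp (C * ((p : ℝ) ^ 2)⁻¹) :=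
        prod_le_prod (fun _ _ => by positivity) fun p _ => by
          rw [add_comm]; exact Real.add_one_le_exp _
    _ = Real.exp (C * ∑ p ∈ primesIoc w R, ((p : ℝ) ^ 2)⁻¹) := by rw [← Real.exp_sum, mul_sum]
    _ ≤ Real.exp (C / w) := by
        rw [div_eq_mul_inv]
        gcongr

lemma eventually_exp_div_le (C : ℝ) {ε : ℝ} (hε : 0 < ε) :
    ∀ᶠ w : ℕ in Filter.atTop, Real.exp (C / w) ≤ 1 + ε := by
  have h : Filter.Tendsto (fun w : ℕ => Real.exp (C / w)) Filter.atTop (nhds 1) := by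
    rw [← Real.exp_zero]
    exact (Real.continuous_exp.tendsto 0).comp (tendsto_const_div_atTop_nhds_zero_nat C)
  exact (h.eventually_lt_const (by linarith)).mono fun _ h => h.le

lemma eventually_log_pow_div_lt (k : ℕ) {c : ℝ} (hc : 0 < c) :
    ∀ᶠ R : ℕ in Filter.atTop, Real.log R ^ k < c * R := by
  have h := (Real.isLittleO_pow_log_id_atTop (n := k)).def (half_pos hc)
  have h2 := tendsto_natCast_atTop_atTop (R := ℝ).eventually h
  filter_upwards [h2, Filter.eventually_gt_atTop 0] with R hR h0
  have h0' : (0 : ℝ) < R := by exact_mod_cast h0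
  have h3 := (le_abs_self _).trans hR
  rw [id, Real.norm_of_nonneg h0'.le] at h3
  nlinarith

theorem exists_prime_progression {n : ℕ} (hn : 1 ≤ n) (N₁ : ℕ) :
    ∃ a d : ℕ, N₁ < a ∧ 1 ≤ d ∧ ∀ i : ℕ, i ≤ n + 1 → (a + i * d).Prime := by
  set m := (n + 2) * 2 ^ (n + 2) with hm
  set K := 7 * m + 1 with hK
  have hm1 : 1 ≤ m := Nat.mul_pos (by omega) (by positivity)
  obtain ⟨ε, hε, c, hc, N₀, H⟩ :=
    relative_szemeredi hn (δ := 1 / (8 * ((K : ℝ) + 1))) (by positivity)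
  obtain ⟨w, hw1, hw2⟩ := ((eventually_exp_div_le (128 ^ m) (half_pos hε)).and
    (Filter.eventually_ge_atTop ((n + 2).factorial + 1))).exists
  have hlarge : ∀ a : ℕ, ∀ᶠ R : ℕ in Filter.atTop, a ≤ R := Filter.eventually_ge_atTop
  obtain ⟨R, r1, r2, r3, r4, r5, r6, r7, r8⟩ := ((eventually_log_pow_div_lt (n + 2) hc).and <|
    (hlarge N₀).and <| (hlarge N₁).and <| (hlarge m).and <| (hlarge w).and <|
    (hlarge (smallProd w)).and <| (hlarge (16 * (K + 1))).and
    (hlarge ⌈4 * m / ε⌉₊)).exists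
  have hR1 : 1 ≤ R := by omega
  have hRr : (0 : ℝ) < R := by exact_mod_cast hR1
  have hRK : R ≤ R ^ K := Nat.le_self_pow (by omega) R
  obtain ⟨b, hb⟩ := exists_sum_primeWeight_ge (show 3 ≤ K by omega) r5 r6 r7
  have hps : PseudoRandom (sieveWeight (primesIoc w R) R (smallProd w) b) m (n + 2).factorial
      (R ^ K) ε := by
    have h := pseudoRandom_sieveWeight (W := (smallProd w : ℤ)) (b := (b : ℤ)) (m := m)
      (A := (n + 2).factorial) (N := R ^ K) (R := R) (P := primesIoc w R)
      prime_of_mem_primesIoc hR1 ?_ ?_ ?_ (by omega)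
    · have h1 := prod_one_add_le_exp (w := w) (R := R) (by omega)
        (show (0 : ℝ) ≤ 128 ^ m by positivity)
      have h2 : 2 * ((m : ℝ) * R ^ (7 * m) / ((R ^ K : ℕ) : ℝ)) ≤ ε / 2 := by
        rw [Nat.cast_pow, hK, pow_succ, mul_comm ((R : ℝ) ^ (7 * m)) R,
          mul_div_mul_right _ _ (by positivity)]
        have h3 := Nat.ceil_le.1 r8
        rw [div_le_iff₀ hε] at h3
        rw [mul_div_assoc', div_le_iff₀ hRr]
        linarith
      intro V I _ _ _ L a g1 g2 g3 g4 g5 g6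
      exact (h V I L a g1 g2 g3 g4 g5 g6).trans (by linarith)
    · intro p hp hd
      have hp' := mem_primesIoc.1 hp
      rw [Int.natCast_dvd_natCast] at hd
      have := (coprime_smallProd hp'.2 hp'.1.1).symm
      exact hp'.2.one_lt.ne' (this.eq_one_of_dvd hd)
    · intro p hp
      have hp' := mem_primesIoc.1 hp
      omega
    · calc m * R ^ (2 * m) ≤ R * R ^ (2 * m) := Nat.mul_le_mul_right _ r4
        _ = R ^ (2 * m + 1) := (pow_succ' _ _).symm
        _ ≤ R ^ K := Nat.pow_le_pow_right hR1 (by omega)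
  have hE := H (R ^ K) (by omega) _ (primeWeight w R b) hps (primeWeight_nonneg w R b)
    (primeWeight_le_sieveWeight hR1 b) hb
  obtain ⟨x, hx0, hx⟩ := exists_sum_ne_zero (primeWeight_nonneg w R b)
    (primeWeight_le_log w R b) hE (by
      rw [div_lt_iff₀ (by positivity)]
      refine r1.trans_le (mul_le_mul_of_nonneg_left ?_ hc.le)
      have : R ≤ 2 * (10 * (n + 2) ^ 2 * R ^ K) + 1 := by
        have := Nat.le_mul_of_pos_left (R ^ K) (show 0 < 10 * (n + 2) ^ 2 by positivity)
        linarith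
      exact_mod_cast this)
  set Q : ℤ := smallProd w * (-∑ i : Fin (n + 2), ((i : ℕ) : ℤ) * x i) + b
  have hW : (smallProd w : ℤ) ≠ 0 := by exact_mod_cast (smallProd_pos w).ne'
  obtain ⟨a, d, h1, h2, h3⟩ := exists_progression_of_int (n := n + 1) (R := R) (Q := Q)
    (mul_ne_zero hW hx0) fun j hj => by
      have h := hx ⟨j, by omega⟩
      rw [primeWeight, ite_ne_right_iff] at h
      have e : (smallProd w : ℤ) * psi (⟨j, by omega⟩ : Fin (n + 2)) x + b =
          Q + j * (smallProd w * ∑ i, x i) := by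
        rw [psi_eq_add]
        ring
      rw [e] at h
      exact h.1
  exact ⟨a, d, by omega, h2, h3⟩

end

end GreenTao

theorem green_tao_arithmetic_progressions_of_primes :
    ∀ k : ℕ, 1 ≤ k → ∀ N : ℕ, ∃ a d : ℕ, N < a ∧ 1 ≤ d ∧
      ∀ i : ℕ, i ≤ k - 1 → Nat.Prime (a + i * d) := by
  intro k hk N
  obtain ⟨a, d, h1, h2, h3⟩ := GreenTao.exists_prime_progression hk N
  exact ⟨a, d, h1, h2, fun i hi => h3 i (by omega)⟩
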